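/- arXiv:1101.3978 — 11 statements merged into one kernel-verified Lean document; each statement's English description precedes it below -/
import Mathlib

section
/- Let $N \ge 1$ be an integer and let $\gamma, \beta > 0$ be real numbers with $\gamma < N$, $\gamma + \beta > N$ and $\beta < N$. Then there exist constants $c, C, R > 0$ such that $c\,|x|^{N - \gamma - \beta} \le J(x) \le C\,|x|^{N - \gamma - \beta}$ for all $x \in \mathbb{R}^N$ with $|x| \ge R$. -/
open MeasureTheory ENNReal

noncomputable def nearK (s t : ℝ) : ℝ := (Set.Iic (1/2 : ℝ)).indicator (fun t => t ^ (-s)) t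
noncomputable def farK (s t : ℝ) : ℝ := (Set.Ioi (1/2 : ℝ)).indicator (fun t => t ^ (-s)) t

lemma nearK_nonneg (s t : ℝ) (ht : 0 ≤ t) : 0 ≤ nearK s t :=
  Set.indicator_apply_nonneg (fun _ => Real.rpow_nonneg ht _)

lemma farK_nonneg (s t : ℝ) (ht : 0 ≤ t) : 0 ≤ farK s t :=
  Set.indicator_apply_nonneg (fun _ => Real.rpow_nonneg ht _)

lemma kernel_bound (γ β a b : ℝ) (hγ : 0 < γ) (hβ : 0 < β) (ha : 0 < a) (hb : 0 < b)
    (h1 : 1 ≤ a + b) (h2 : a ≤ b + 1) :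
    b ^ (-γ) * a ^ (-β) ≤ 2 ^ γ * nearK β a + 2 ^ β * nearK γ b + 3 ^ γ * farK (γ + β) a := by
  have n1 := mul_nonneg (Real.rpow_nonneg zero_le_two γ) (nearK_nonneg β a ha.le)
  have n2 := mul_nonneg (Real.rpow_nonneg zero_le_two β) (nearK_nonneg γ b hb.le)
  have n3 := mul_nonneg (Real.rpow_nonneg zero_le_three γ) (farK_nonneg (γ + β) a ha.le)
  have half : ∀ s t : ℝ, 0 < s → 1 / 2 ≤ t → t ^ (-s) ≤ 2 ^ s := by
    intro s t hs ht
    have := Real.rpow_le_rpow_of_nonpos (by norm_num) ht (neg_nonpos.2 hs.le)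
    refine this.trans_eq ?_
    rw [one_div, Real.inv_rpow zero_le_two, Real.rpow_neg zero_le_two, inv_inv]
  by_cases h : a ≤ 1 / 2
  · have e : nearK β a = a ^ (-β) := Set.indicator_of_mem (s := Set.Iic (1/2 : ℝ)) h _
    have := mul_le_mul_of_nonneg_right (half γ b hγ (by linarith)) (Real.rpow_nonneg ha.le (-β))
    rw [e] at *
    linarith
  by_cases h' : b ≤ 1 / 2
  · have e : nearK γ b = b ^ (-γ) := Set.indicator_of_mem (s := Set.Iic (1/2 : ℝ)) h' _
    have := mul_le_mul_of_nonneg_right (half β a hβ (by linarith)) (Real.rpow_nonneg hb.le (-γ))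
    rw [e] at *
    linarith
  push Not at h h'
  have e : farK (γ + β) a = a ^ (-(γ + β)) := Set.indicator_of_mem (s := Set.Ioi (1/2 : ℝ)) h _
  have h3 : b ^ (-γ) ≤ 3 ^ γ * a ^ (-γ) := by
    have := Real.rpow_le_rpow_of_nonpos (x := a / 3) (y := b) (by positivity) (by linarith)
      (neg_nonpos.2 hγ.le)
    refine this.trans_eq ?_
    rw [Real.div_rpow ha.le zero_le_three, Real.rpow_neg zero_le_three, div_inv_eq_mul, mul_comm]
  have := mul_le_mul_of_nonneg_right h3 (Real.rpow_nonneg ha.le (-β))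
  rw [mul_assoc, ← Real.rpow_add ha, ← neg_add] at this
  rw [e] at *
  linarith

lemma pow_smul_aux (N : ℕ) (hN : 1 ≤ N) (s t : ℝ) (ht : 0 < t) :
    t ^ (N - 1) * t ^ (-s) = t ^ ((N : ℝ) - 1 - s) := by
  rw [← Real.rpow_natCast, ← Real.rpow_add ht, Nat.cast_sub hN]
  congr 1
  push_cast; ring

lemma nearK_integrable (N : ℕ) (hN : 1 ≤ N) (s : ℝ) (hs : s < N) :
    Integrable (fun y : EuclideanSpace ℝ (Fin N) => nearK s ‖y‖) := by
  haveI : Nonempty (Fin N) := ⟨⟨0, hN⟩⟩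
  rw [integrable_fun_norm_addHaar (f := nearK s) volume, finrank_euclideanSpace_fin]
  have h := (intervalIntegral.intervalIntegrable_rpow' (a := 0) (b := 1/2)
    (r := (N : ℝ) - 1 - s) (by linarith))
  rw [intervalIntegrable_iff_integrableOn_Ioc_of_le (by norm_num)] at h
  rw [← integrable_indicator_iff measurableSet_Ioc] at h
  refine h.integrableOn.congr_fun (fun t ht => ?_) measurableSet_Ioi
  have ht : 0 < t := ht
  by_cases h : t ≤ 1/2
  · have e : nearK s t = t ^ (-s) := Set.indicator_of_mem (s := Set.Iic (1/2 : ℝ)) h _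
    simp only [e, smul_eq_mul, pow_smul_aux N hN s t ht]
    exact Set.indicator_of_mem (s := Set.Ioc 0 (1/2 : ℝ)) ⟨ht, h⟩ _
  · have e : nearK s t = 0 := Set.indicator_of_notMem (s := Set.Iic (1/2 : ℝ)) h _
    simp only [e, smul_zero]
    exact Set.indicator_of_notMem (s := Set.Ioc 0 (1/2 : ℝ)) (fun q => h q.2) _

lemma farK_integrable (N : ℕ) (hN : 1 ≤ N) (s : ℝ) (hs : N < s) :
    Integrable (fun y : EuclideanSpace ℝ (Fin N) => farK s ‖y‖) := by
  haveI : Nonempty (Fin N) := ⟨⟨0, hN⟩⟩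
  rw [integrable_fun_norm_addHaar (f := farK s) volume, finrank_euclideanSpace_fin]
  have h := integrableOn_Ioi_rpow_of_lt (a := (N : ℝ) - 1 - s) (c := 1/2) (by linarith)
    (by norm_num)
  rw [← integrable_indicator_iff measurableSet_Ioi] at h
  refine h.integrableOn.congr_fun (fun t ht => ?_) measurableSet_Ioi
  have ht : 0 < t := ht
  by_cases h : 1/2 < t
  · have e : farK s t = t ^ (-s) := Set.indicator_of_mem (s := Set.Ioi (1/2 : ℝ)) h _
    simp only [e, smul_eq_mul, pow_smul_aux N hN s t ht]
    exact Set.indicator_of_mem (s := Set.Ioi (1/2 : ℝ)) h _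
  · have e : farK s t = 0 := Set.indicator_of_notMem (s := Set.Ioi (1/2 : ℝ)) h _
    simp only [e, smul_zero]
    exact Set.indicator_of_notMem (s := Set.Ioi (1/2 : ℝ)) h _

lemma upper_pointwise (N : ℕ) (γ β : ℝ) (hγ : 0 < γ) (hβ : 0 < β)
    (x y : EuclideanSpace ℝ (Fin N)) (hx : 0 < ‖x‖) (hy : y ≠ 0) :
    1 / (‖x - y‖ ^ γ * (1 + ‖y‖ ^ β)) ≤ ‖x‖ ^ (-γ - β) *
      (2 ^ γ * nearK β ‖‖x‖⁻¹ • y‖ + 2 ^ β * nearK γ ‖‖x‖⁻¹ • (x - y)‖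
        + 3 ^ γ * farK (γ + β) ‖‖x‖⁻¹ • y‖) := by
  have hr0 : 0 ≤ ‖x‖ ^ (-γ - β) := Real.rpow_nonneg hx.le _
  rcases eq_or_ne x y with rfl | hxy
  · simp only [sub_self, norm_zero, Real.zero_rpow hγ.ne', zero_mul, _root_.div_zero]
    have n1 := mul_nonneg (Real.rpow_nonneg zero_le_two γ)
      (nearK_nonneg β ‖‖x‖⁻¹ • x‖ (norm_nonneg _))
    have n2 := mul_nonneg (Real.rpow_nonneg zero_le_two β)
      (nearK_nonneg γ ‖‖x‖⁻¹ • (0 : EuclideanSpace ℝ (Fin N))‖ (norm_nonneg _))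
    have n3 := mul_nonneg (Real.rpow_nonneg zero_le_three γ)
      (farK_nonneg (γ + β) ‖‖x‖⁻¹ • x‖ (norm_nonneg _))
    exact mul_nonneg hr0 (add_nonneg (add_nonneg n1 n2) n3)
  have hy' : 0 < ‖y‖ := norm_pos_iff.2 hy
  have hxy' : 0 < ‖x - y‖ := norm_pos_iff.2 (sub_ne_zero.2 hxy)
  have key := kernel_bound γ β (‖x‖⁻¹ * ‖y‖) (‖x‖⁻¹ * ‖x - y‖) hγ hβ (by positivity)
    (by positivity)
    (by
      rw [← mul_add, inv_mul_eq_div, one_le_div hx]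
      have := norm_add_le y (x - y)
      simpa using this)
    (by
      have : ‖y‖ ≤ ‖x - y‖ + ‖x‖ := by
        have := norm_sub_le x (x - y)
        simp at this
        linarith
      have := mul_le_mul_of_nonneg_left this (inv_nonneg.2 hx.le)
      rwa [mul_add, inv_mul_cancel₀ hx.ne'] at this)
  rw [norm_smul, norm_smul, norm_inv, norm_norm]
  refine le_trans ?_ (mul_le_mul_of_nonneg_left key hr0)
  rw [Real.mul_rpow (by positivity) hxy'.le, Real.mul_rpow (by positivity) hy'.le,
    Real.inv_rpow hx.le, Real.inv_rpow hx.le, Real.rpow_neg hx.le, Real.rpow_neg hx.le, inv_inv,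
    inv_inv, sub_eq_add_neg (-γ) β, Real.rpow_add hx, Real.rpow_neg hx.le, Real.rpow_neg hx.le,
    Real.rpow_neg hy'.le, Real.rpow_neg hxy'.le]
  have p1 : 0 < ‖x‖ ^ γ := Real.rpow_pos_of_pos hx _
  have p2 : 0 < ‖x‖ ^ β := Real.rpow_pos_of_pos hx _
  have p3 : 0 < ‖y‖ ^ β := Real.rpow_pos_of_pos hy' _
  have p4 : 0 < ‖x - y‖ ^ γ := Real.rpow_pos_of_pos hxy' _
  have : (‖x‖ ^ γ)⁻¹ * (‖x‖ ^ β)⁻¹ * (‖x‖ ^ γ * (‖x - y‖ ^ γ)⁻¹ * (‖x‖ ^ β * (‖y‖ ^ β)⁻¹))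
      = 1 / (‖x - y‖ ^ γ * ‖y‖ ^ β) := by field_simp
  rw [this]
  gcongr
  linarith

lemma upper_bound (N : ℕ) (hN : 1 ≤ N) (γ β : ℝ) (hγ : 0 < γ) (hβ : 0 < β)
    (hγN : γ < N) (hsum : (N : ℝ) < γ + β) (hβN : β < N) :
    ∃ C : ℝ, 0 < C ∧ ∀ x : EuclideanSpace ℝ (Fin N), 1 ≤ ‖x‖ →
        (∫⁻ y : EuclideanSpace ℝ (Fin N),
            ENNReal.ofReal (1 / (‖x - y‖ ^ γ * (1 + ‖y‖ ^ β)))) ≤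
          ENNReal.ofReal (C * ‖x‖ ^ ((N : ℝ) - γ - β)) := by
  haveI : Nonempty (Fin N) := ⟨⟨0, hN⟩⟩
  set A := ∫ y : EuclideanSpace ℝ (Fin N), nearK β ‖y‖ with hA
  set B := ∫ y : EuclideanSpace ℝ (Fin N), nearK γ ‖y‖ with hB
  set D := ∫ y : EuclideanSpace ℝ (Fin N), farK (γ + β) ‖y‖ with hD
  have iA := nearK_integrable N hN β hβN
  have iB := nearK_integrable N hN γ hγN
  have iD := farK_integrable N hN (γ + β) hsum
  have A0 : 0 ≤ A := integral_nonneg fun y => nearK_nonneg _ _ (norm_nonneg _)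
  have B0 : 0 ≤ B := integral_nonneg fun y => nearK_nonneg _ _ (norm_nonneg _)
  have D0 : 0 ≤ D := integral_nonneg fun y => farK_nonneg _ _ (norm_nonneg _)
  refine ⟨2 ^ γ * A + 2 ^ β * B + 3 ^ γ * D + 1, by positivity, fun x hx => ?_⟩
  have hx0 : 0 < ‖x‖ := by linarith
  have hi0 : ‖x‖⁻¹ ≠ 0 := inv_ne_zero hx0.ne'
  have jA : Integrable (fun y : EuclideanSpace ℝ (Fin N) => 2 ^ γ * nearK β ‖‖x‖⁻¹ • y‖) :=
    (iA.comp_smul hi0).const_mul _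
  have jB : Integrable (fun y : EuclideanSpace ℝ (Fin N) => 2 ^ β * nearK γ ‖‖x‖⁻¹ • (x - y)‖) :=
    ((iB.comp_smul hi0).comp_sub_left x).const_mul _
  have jD : Integrable (fun y : EuclideanSpace ℝ (Fin N) => 3 ^ γ * farK (γ + β) ‖‖x‖⁻¹ • y‖) :=
    (iD.comp_smul hi0).const_mul _
  have eA : ∫ y : EuclideanSpace ℝ (Fin N), nearK β ‖‖x‖⁻¹ • y‖ = ‖x‖ ^ N * A := by
    have := Measure.integral_comp_inv_smul_of_nonneg (volume : Measure (EuclideanSpace ℝ (Fin N)))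
      (fun y => nearK β ‖y‖) hx0.le
    rwa [finrank_euclideanSpace_fin] at this
  have eB : ∫ y : EuclideanSpace ℝ (Fin N), nearK γ ‖‖x‖⁻¹ • (x - y)‖ = ‖x‖ ^ N * B := by
    rw [integral_sub_left_eq_self (fun y => nearK γ ‖‖x‖⁻¹ • y‖) volume x]
    have := Measure.integral_comp_inv_smul_of_nonneg (volume : Measure (EuclideanSpace ℝ (Fin N)))
      (fun y => nearK γ ‖y‖) hx0.le
    rwa [finrank_euclideanSpace_fin] at this
  have eD : ∫ y : EuclideanSpace ℝ (Fin N), farK (γ + β) ‖‖x‖⁻¹ • y‖ = ‖x‖ ^ N * D := by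
    have := Measure.integral_comp_inv_smul_of_nonneg (volume : Measure (EuclideanSpace ℝ (Fin N)))
      (fun y => farK (γ + β) ‖y‖) hx0.le
    rwa [finrank_euclideanSpace_fin] at this
  have hae : ∀ᵐ y : EuclideanSpace ℝ (Fin N), y ≠ 0 := by
    simp [ae_iff]
  calc _ ≤ ∫⁻ y : EuclideanSpace ℝ (Fin N), ENNReal.ofReal (‖x‖ ^ (-γ - β) *
      (2 ^ γ * nearK β ‖‖x‖⁻¹ • y‖ + 2 ^ β * nearK γ ‖‖x‖⁻¹ • (x - y)‖
        + 3 ^ γ * farK (γ + β) ‖‖x‖⁻¹ • y‖)) := by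
        refine lintegral_mono_ae ?_
        filter_upwards [hae] with y hy
        exact ENNReal.ofReal_le_ofReal (upper_pointwise N γ β hγ hβ x y hx0 hy)
    _ = ENNReal.ofReal (∫ y : EuclideanSpace ℝ (Fin N), ‖x‖ ^ (-γ - β) *
      (2 ^ γ * nearK β ‖‖x‖⁻¹ • y‖ + 2 ^ β * nearK γ ‖‖x‖⁻¹ • (x - y)‖
        + 3 ^ γ * farK (γ + β) ‖‖x‖⁻¹ • y‖)) := by
        refine (ofReal_integral_eq_lintegral_ofReal (((jA.add jB).add jD).const_mul _) ?_).symm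
        filter_upwards [hae] with y hy
        exact le_trans (by positivity) (upper_pointwise N γ β hγ hβ x y hx0 hy)
    _ ≤ _ := by
        refine ENNReal.ofReal_le_ofReal ?_
        have e1 := integral_add (jA.add jB) jD
        have e2 := integral_add jA jB
        simp only [Pi.add_apply] at e1
        rw [integral_const_mul, e1, e2, integral_const_mul, integral_const_mul,
          integral_const_mul, eA, eB, eD]
        have : ‖x‖ ^ ((N : ℝ) - γ - β) = ‖x‖ ^ (-γ - β) * ‖x‖ ^ N := by
          rw [← Real.rpow_natCast, ← Real.rpow_add hx0]; congr 1; ring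
        rw [this]
        have : 0 ≤ ‖x‖ ^ (-γ - β) * ‖x‖ ^ N := by positivity
        nlinarith

lemma lower_bound (N : ℕ) (hN : 1 ≤ N) (γ β : ℝ) (hγ : 0 < γ) (hβ : 0 < β) :
    ∃ c : ℝ, 0 < c ∧ ∀ x : EuclideanSpace ℝ (Fin N), 1 ≤ ‖x‖ →
        ENNReal.ofReal (c * ‖x‖ ^ ((N : ℝ) - γ - β)) ≤
        (∫⁻ y : EuclideanSpace ℝ (Fin N),
            ENNReal.ofReal (1 / (‖x - y‖ ^ γ * (1 + ‖y‖ ^ β)))) := by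
  haveI : Nonempty (Fin N) := ⟨⟨0, hN⟩⟩
  set V := (volume (Metric.ball (0 : EuclideanSpace ℝ (Fin N)) 1)).toReal with hV
  have hfin : volume (Metric.ball (0 : EuclideanSpace ℝ (Fin N)) 1) ≠ ⊤ := measure_ball_lt_top.ne
  have hV0 : 0 < V :=
    ENNReal.toReal_pos (Metric.measure_ball_pos volume _ one_pos).ne' hfin
  refine ⟨V / (2 ^ γ * 2), by positivity, fun x hx => ?_⟩
  have hx0 : 0 < ‖x‖ := by linarith
  calc _ = ENNReal.ofReal (1 / ((2 * ‖x‖) ^ γ * (2 * ‖x‖ ^ β))) *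
          volume (Metric.ball (0 : EuclideanSpace ℝ (Fin N)) ‖x‖) := by
        rw [Measure.addHaar_ball_of_pos volume _ hx0, finrank_euclideanSpace_fin,
          ← ENNReal.ofReal_toReal hfin, ← hV, ← ENNReal.ofReal_mul (by positivity),
          ← ENNReal.ofReal_mul (by positivity)]
        congr 1
        rw [Real.rpow_sub hx0, Real.rpow_sub hx0, Real.rpow_natCast,
          Real.mul_rpow zero_le_two hx0.le]
        field_simp
    _ = ∫⁻ y in Metric.ball (0 : EuclideanSpace ℝ (Fin N)) ‖x‖,
          ENNReal.ofReal (1 / ((2 * ‖x‖) ^ γ * (2 * ‖x‖ ^ β))) := by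
        rw [setLIntegral_const]
    _ ≤ ∫⁻ y in Metric.ball (0 : EuclideanSpace ℝ (Fin N)) ‖x‖,
          ENNReal.ofReal (1 / (‖x - y‖ ^ γ * (1 + ‖y‖ ^ β))) := by
        refine setLIntegral_mono' measurableSet_ball fun y hy => ENNReal.ofReal_le_ofReal ?_
        rw [mem_ball_zero_iff] at hy
        have hne : 0 < ‖x - y‖ := by
          refine norm_pos_iff.2 (sub_ne_zero.2 ?_)
          rintro rfl
          exact lt_irrefl _ hy
        have h1 : ‖x - y‖ ≤ 2 * ‖x‖ := by linarith [norm_sub_le x y]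
        have h2 : ‖y‖ ^ β ≤ ‖x‖ ^ β := Real.rpow_le_rpow (norm_nonneg _) hy.le hβ.le
        have h3 : 1 ≤ ‖x‖ ^ β := Real.one_le_rpow hx hβ.le
        have h4 : 0 ≤ ‖y‖ ^ β := by positivity
        have h5 : 0 < ‖x - y‖ ^ γ := by positivity
        refine one_div_le_one_div_of_le (by positivity) ?_
        refine mul_le_mul (Real.rpow_le_rpow hne.le h1 hγ.le) (by linarith) (by positivity)
          (by positivity)
    _ ≤ _ := setLIntegral_le_lintegral _ _


/-- For `γ, β > 0` with `γ < N`, `γ + β > N` and `β < N`, the function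
`J(x) = ∫_{ℝ^N} |x-y|^{-γ} (1+|y|^β)^{-1} dy` behaves like `|x|^{N-γ-β}` at infinity. -/
theorem J_asymptotics_beta_lt (N : ℕ) (hN : 1 ≤ N) (γ β : ℝ) (hγ : 0 < γ) (hβ : 0 < β)
    (hγN : γ < N) (hsum : (N : ℝ) < γ + β) (hβN : β < N) :
    ∃ c C R : ℝ, 0 < c ∧ 0 < C ∧ 0 < R ∧
      ∀ x : EuclideanSpace ℝ (Fin N), R ≤ ‖x‖ →
        ENNReal.ofReal (c * ‖x‖ ^ ((N : ℝ) - γ - β)) ≤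
          (∫⁻ y : EuclideanSpace ℝ (Fin N),
            ENNReal.ofReal (1 / (‖x - y‖ ^ γ * (1 + ‖y‖ ^ β)))) ∧
        (∫⁻ y : EuclideanSpace ℝ (Fin N),
            ENNReal.ofReal (1 / (‖x - y‖ ^ γ * (1 + ‖y‖ ^ β)))) ≤
          ENNReal.ofReal (C * ‖x‖ ^ ((N : ℝ) - γ - β)) := by
  obtain ⟨C, hC, h1⟩ := upper_bound N hN γ β hγ hβ hγN hsum hβN
  obtain ⟨c, hc, h2⟩ := lower_bound N hN γ β hγ hβ
  exact ⟨c, C, 1, hc, hC, one_pos, fun x hx => ⟨h2 x hx, h1 x hx⟩⟩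
end

section
/- Let $N \ge 1$ be an integer and let $\gamma > 0$ be a real number with $\gamma < N$, and set $\beta = N$. Then there exist constants $c, C, R > 0$ (with $R > 1$) such that $c\,|x|^{-\gamma}\log|x| \le J(x) \le C\,|x|^{-\gamma}\log|x|$ for all $x \in \mathbb{R}^N$ with $|x| \ge R$. -/
open MeasureTheory ENNReal

open Set Metric in
lemma polar_lint (N : ℕ) (hN : 1 ≤ N) (f : ℝ → ℝ≥0∞) (hf : Measurable f) :
    ∫⁻ y : EuclideanSpace ℝ (Fin N), f ‖y‖ =
      ((volume : Measure (EuclideanSpace ℝ (Fin N))).toSphere univ) *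
        ∫⁻ r in Ioi (0:ℝ), ENNReal.ofReal (r ^ (N - 1)) * f r := by
  have : Nonempty (Fin N) := ⟨⟨0, hN⟩⟩
  let μ : Measure (EuclideanSpace ℝ (Fin N)) := volume
  have hfr : Module.finrank ℝ (EuclideanSpace ℝ (Fin N)) = N := by simp
  calc
    ∫⁻ x, f (‖x‖) ∂μ = ∫⁻ x : ({(0)}ᶜ : Set (EuclideanSpace ℝ (Fin N))), f (‖x.1‖) ∂(μ.comap (↑)) := by
      rw [lintegral_subtype_comap (measurableSet_singleton _).compl (fun x ↦ f (‖x‖)),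
        restrict_compl_singleton]
    _ = ∫⁻ x, f x.2 ∂μ.toSphere.prod (.volumeIoiPow (Module.finrank ℝ (EuclideanSpace ℝ (Fin N)) - 1)) := by
      simpa using μ.measurePreserving_homeomorphUnitSphereProd.lintegral_comp_emb
        (Homeomorph.measurableEmbedding _) (f ∘ Subtype.val ∘ Prod.snd)
    _ = μ.toSphere univ * ∫⁻ x : Ioi (0 : ℝ), f x ∂.volumeIoiPow (N - 1) := by
      rw [hfr, lintegral_prod _ (by fun_prop)]
      simp [mul_comm]
    _ = _ := by
      simp only [Measure.volumeIoiPow]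
      rw [lintegral_withDensity_eq_lintegral_mul _ (by fun_prop) (by fun_prop)]
      simp only [Pi.mul_apply]
      rw [lintegral_subtype_comap measurableSet_Ioi
        (fun a ↦ ENNReal.ofReal (a ^ (N - 1)) * f a)]

open Set in
lemma polar_exists (N : ℕ) (hN : 1 ≤ N) : ∃ κ : ℝ, 0 < κ ∧
    ∀ (S : Set ℝ) (g : ℝ → ℝ), MeasurableSet S → Measurable g →
    ∫⁻ y : EuclideanSpace ℝ (Fin N), S.indicator (fun r => ENNReal.ofReal (g r)) ‖y‖ =
      ENNReal.ofReal κ * ∫⁻ r in S ∩ Ioi (0:ℝ), ENNReal.ofReal (r ^ (N - 1) * g r) := by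
  have : Nonempty (Fin N) := ⟨⟨0, hN⟩⟩
  have h1 : ((volume : Measure (EuclideanSpace ℝ (Fin N))).toSphere univ) ≠ ⊤ := measure_ne_top _ _
  have h0 : ((volume : Measure (EuclideanSpace ℝ (Fin N))).toSphere univ) ≠ 0 := by
    rw [Measure.toSphere_apply_univ]
    have := (Metric.measure_ball_pos (volume : Measure (EuclideanSpace ℝ (Fin N))) 0 one_pos).ne'
    simp only [ne_eq, mul_eq_zero, not_or]
    refine ⟨?_, this⟩
    simp; omega
  refine ⟨_, ENNReal.toReal_pos h0 h1, fun S g hS hg => ?_⟩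
  rw [polar_lint N hN _ (by fun_prop (disch := assumption)), ENNReal.ofReal_toReal h1]
  congr 1
  rw [← Measure.restrict_restrict hS, ← lintegral_indicator hS]
  refine setLIntegral_congr_fun measurableSet_Ioi fun r hr => ?_
  simp only [mem_Ioi] at hr
  by_cases h : r ∈ S
  · simp [h]
    rw [ENNReal.ofReal_mul (by positivity)]
  · simp [h]

open Set in
lemma lint_inv (X : ℝ) (hX : 1 ≤ X) :
    ∫⁻ r in Ioc (1:ℝ) X, ENNReal.ofReal (1 / r) = ENNReal.ofReal (Real.log X) := by
  rw [← ofReal_integral_eq_lintegral_ofReal]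
  · rw [← intervalIntegral.integral_of_le hX, integral_one_div_of_pos one_pos (by linarith), div_one]
  · rw [← IntegrableOn, ← intervalIntegrable_iff_integrableOn_Ioc_of_le hX]
    apply intervalIntegral.intervalIntegrable_one_div
    · intro x hx; rw [uIcc_of_le hX] at hx; linarith [hx.1]
    · fun_prop
  · filter_upwards [ae_restrict_mem measurableSet_Ioc] with r hr
    have := hr.1
    simp only [Pi.zero_apply]; positivity

open Set in
lemma lint_near (a p : ℝ) (ha : 0 < a) (hp : 0 < p) :
    ∫⁻ r in Ioc (0:ℝ) a, ENNReal.ofReal (r ^ (p - 1)) = ENNReal.ofReal (a ^ p / p) := by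
  rw [← ofReal_integral_eq_lintegral_ofReal]
  · rw [← intervalIntegral.integral_of_le ha.le, integral_rpow (by left; linarith)]
    simp [Real.zero_rpow hp.ne']
  · rw [← IntegrableOn, ← intervalIntegrable_iff_integrableOn_Ioc_of_le ha.le]
    exact intervalIntegral.intervalIntegrable_rpow' (by linarith)
  · filter_upwards [ae_restrict_mem measurableSet_Ioc] with r hr
    have := hr.1
    simp only [Pi.zero_apply]; positivity

open Set in
lemma lint_far (a p : ℝ) (ha : 0 < a) (hp : 0 < p) :
    ∫⁻ r in Ioi a, ENNReal.ofReal (r ^ (-p - 1)) = ENNReal.ofReal (a ^ (-p) / p) := by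
  rw [← ofReal_integral_eq_lintegral_ofReal]
  · rw [integral_Ioi_rpow_of_lt (by linarith) ha]
    simp [neg_div_neg_eq]
  · exact integrableOn_Ioi_rpow_of_lt (by linarith) ha
  · filter_upwards [ae_restrict_mem measurableSet_Ioi] with r hr
    have : 0 < r := lt_trans ha hr
    simp only [Pi.zero_apply]; positivity

open Set in
lemma rad_one (N : ℕ) (hN : 1 ≤ N) (X : ℝ) (hX : 1 ≤ X) :
    ∫⁻ r in Iic X ∩ Ioi (0:ℝ), ENNReal.ofReal (r ^ (N - 1) * (1 / (1 + r ^ N))) ≤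
      ENNReal.ofReal (1 + Real.log X) := by
  have hS : Iic X ∩ Ioi (0:ℝ) = Ioc 0 1 ∪ Ioc 1 X := by
    rw [Ioc_union_Ioc_eq_Ioc zero_le_one hX]; ext; simp [and_comm]
  rw [hS, ENNReal.ofReal_add zero_le_one (Real.log_nonneg hX), ← lint_inv X hX]
  refine (lintegral_union_le _ _ _).trans (add_le_add ?_ ?_)
  · calc _ ≤ ∫⁻ r in Ioc (0:ℝ) 1, ENNReal.ofReal 1 := by
          refine setLIntegral_mono' measurableSet_Ioc fun r hr => ENNReal.ofReal_le_ofReal ?_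
          have h0 := hr.1
          rw [mul_one_div, div_le_one (by positivity)]
          have := pow_le_one₀ h0.le hr.2 (n := N - 1)
          have : 0 < r ^ N := by positivity
          linarith
      _ = _ := by simp
  · refine setLIntegral_mono' measurableSet_Ioc fun r hr => ENNReal.ofReal_le_ofReal ?_
    have h0 : 0 < r := by linarith [hr.1]
    rw [mul_one_div, div_le_div_iff₀ (by positivity) h0, ← pow_succ, Nat.sub_add_cancel hN]
    linarith

open Set in
lemma rad_low (N : ℕ) (hN : 1 ≤ N) (X : ℝ) (hX : 1 ≤ X) :
    ENNReal.ofReal (1 / 2) * ENNReal.ofReal (Real.log X) ≤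
    ∫⁻ r in Ioo 1 X ∩ Ioi (0:ℝ), ENNReal.ofReal (r ^ (N - 1) * (1 / (1 + r ^ N))) := by
  have hS : Ioo 1 X ∩ Ioi (0:ℝ) = Ioo 1 X := by
    rw [inter_eq_left]; intro r hr; exact lt_trans one_pos hr.1
  rw [hS, ← lint_inv X hX, restrict_Ioo_eq_restrict_Ioc,
    ← lintegral_const_mul' _ _ ENNReal.ofReal_ne_top]
  refine setLIntegral_mono' measurableSet_Ioc fun r hr => ?_
  rw [← ENNReal.ofReal_mul (by norm_num)]
  refine ENNReal.ofReal_le_ofReal ?_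
  have h0 : 0 < r := by linarith [hr.1]
  have h1 : 1 ≤ r ^ N := one_le_pow₀ hr.1.le
  rw [mul_one_div, mul_one_div, div_le_div_iff₀ (by positivity) (by positivity)]
  have : r ^ (N - 1) * r = r ^ N := by rw [← pow_succ, Nat.sub_add_cancel hN]
  nlinarith

open Set in
lemma rad_two (N : ℕ) (hN : 1 ≤ N) (γ : ℝ) (hγN : γ < N) (a : ℝ) (ha : 0 < a) :
    ∫⁻ r in Iic a ∩ Ioi (0:ℝ), ENNReal.ofReal (r ^ (N - 1) * r ^ (-γ)) =
      ENNReal.ofReal (a ^ (N - γ) / (N - γ)) := by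
  have hS : Iic a ∩ Ioi (0:ℝ) = Ioc 0 a := by ext; simp [and_comm]
  rw [hS, ← lint_near a _ ha (by linarith)]
  refine setLIntegral_congr_fun measurableSet_Ioc fun r hr => ?_
  rw [← Real.rpow_natCast, ← Real.rpow_add hr.1]
  congr 2
  push_cast [hN]; ring

open Set in
lemma rad_three (N : ℕ) (hN : 1 ≤ N) (γ : ℝ) (hγ : 0 < γ) (a : ℝ) (ha : 0 < a) :
    ∫⁻ r in Ioi a ∩ Ioi (0:ℝ), ENNReal.ofReal (r ^ (N - 1) * r ^ (-γ - N)) =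
      ENNReal.ofReal (a ^ (-γ) / γ) := by
  have hS : Ioi a ∩ Ioi (0:ℝ) = Ioi a := by
    rw [inter_eq_left]; exact Ioi_subset_Ioi ha.le
  rw [hS, ← lint_far a _ ha hγ]
  refine setLIntegral_congr_fun measurableSet_Ioi fun r hr => ?_
  have : 0 < r := lt_trans ha hr
  rw [← Real.rpow_natCast, ← Real.rpow_add this]
  congr 2
  push_cast [hN]; ring

open Set in
lemma ptwise_upper (N : ℕ) (γ : ℝ) (hγ : 0 < γ)
    (x y : EuclideanSpace ℝ (Fin N)) (hx : 0 < ‖x‖) :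
    ENNReal.ofReal (1 / (‖x - y‖ ^ γ * (1 + ‖y‖ ^ (N : ℝ)))) ≤
      ENNReal.ofReal ((‖x‖ / 2) ^ (-γ)) *
        (Iic ‖x‖).indicator (fun r => ENNReal.ofReal (1 / (1 + r ^ N))) ‖y‖ +
      (ENNReal.ofReal (1 / (‖x‖ / 2) ^ N) *
        (Iic (3 * ‖x‖)).indicator (fun r => ENNReal.ofReal (r ^ (-γ))) ‖x - y‖ +
      ENNReal.ofReal ((3 / 2) ^ N) *
        (Ioi (3 * ‖x‖)).indicator (fun r => ENNReal.ofReal (r ^ (-γ - N))) ‖x - y‖) := by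
  have t1 : ‖x‖ ≤ ‖x - y‖ + ‖y‖ := by simpa using norm_add_le (x - y) y
  have t2 : ‖x - y‖ ≤ ‖x‖ + ‖y‖ := norm_sub_le x y
  have hr := norm_nonneg y
  have hs := norm_nonneg (x - y)
  rw [Real.rpow_natCast]
  generalize ‖x‖ = X at *
  generalize ‖y‖ = r at *
  generalize ‖x - y‖ = s at *
  rcases le_or_gt r (X / 2) with h | h
  · refine le_trans ?_ le_self_add
    rw [indicator_of_mem (by simp only [mem_Iic]; linarith), ← ENNReal.ofReal_mul (by positivity)]
    apply ENNReal.ofReal_le_ofReal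
    rw [Real.rpow_neg (by positivity), ← one_div, one_div_mul_one_div]
    have : X / 2 ≤ s := by linarith
    gcongr
  · refine le_trans ?_ le_add_self
    rcases le_or_gt s (3 * X) with h' | h'
    · refine le_trans ?_ le_self_add
      rw [indicator_of_mem (by simpa using h'), ← ENNReal.ofReal_mul (by positivity)]
      apply ENNReal.ofReal_le_ofReal
      rw [Real.rpow_neg (by positivity), ← one_div, one_div_mul_one_div]
      rcases hs.eq_or_lt with h0 | h0
      · rw [← h0, Real.zero_rpow hγ.ne']; simp
      · rw [mul_comm]
        have : (X / 2) ^ N ≤ r ^ N := by gcongr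
        gcongr
        linarith
    · refine le_trans ?_ le_add_self
      have h0 : 0 < s := by linarith
      rw [indicator_of_mem (by simpa using h'), ← ENNReal.ofReal_mul (by positivity)]
      apply ENNReal.ofReal_le_ofReal
      have e : (3 / 2 : ℝ) ^ N * s ^ (-γ - N) = 1 / (s ^ γ * ((2 / 3) * s) ^ N) := by
        rw [Real.rpow_sub h0, Real.rpow_neg h0.le, Real.rpow_natCast, mul_pow, div_pow, div_pow]
        field_simp
      rw [e]
      have : (2 / 3 * s) ^ N ≤ r ^ N := by
        have : 2 / 3 * s ≤ r := by linarith
        gcongr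
      gcongr
      linarith

open Set in
lemma ptwise_lower (N : ℕ) (γ : ℝ) (hγ : 0 < γ)
    (x y : EuclideanSpace ℝ (Fin N)) (hx : 0 < ‖x‖) :
    ENNReal.ofReal ((2 * ‖x‖) ^ (-γ)) *
        (Ioo 1 ‖x‖).indicator (fun r => ENNReal.ofReal (1 / (1 + r ^ N))) ‖y‖ ≤
    ENNReal.ofReal (1 / (‖x - y‖ ^ γ * (1 + ‖y‖ ^ (N : ℝ)))) := by
  have t1 : ‖x‖ ≤ ‖x - y‖ + ‖y‖ := by simpa using norm_add_le (x - y) y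
  have t2 : ‖x - y‖ ≤ ‖x‖ + ‖y‖ := norm_sub_le x y
  have hr := norm_nonneg y
  rw [Real.rpow_natCast]
  generalize ‖x‖ = X at *
  generalize ‖y‖ = r at *
  generalize ‖x - y‖ = s at *
  by_cases h : r ∈ Ioo 1 X
  · rw [indicator_of_mem h, ← ENNReal.ofReal_mul (by positivity)]
    apply ENNReal.ofReal_le_ofReal
    have h2 := h.2
    have h0 : 0 < s := by linarith
    rw [Real.rpow_neg (by positivity), ← one_div, one_div_mul_one_div]
    have : s ≤ 2 * X := by linarith
    gcongr
  · simp [h]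

/-- For `γ > 0` with `γ < N` and `β = N`, the function
`J(x) = ∫_{ℝ^N} |x-y|^{-γ} (1+|y|^N)^{-1} dy` behaves like `|x|^{-γ} log|x|` at infinity. -/
theorem J_asymptotics_beta_eq (N : ℕ) (hN : 1 ≤ N) (γ : ℝ) (hγ : 0 < γ) (hγN : γ < N) :
    ∃ c C R : ℝ, 0 < c ∧ 0 < C ∧ 1 < R ∧
      ∀ x : EuclideanSpace ℝ (Fin N), R ≤ ‖x‖ →
        ENNReal.ofReal (c * ‖x‖ ^ (-γ) * Real.log ‖x‖) ≤
          (∫⁻ y : EuclideanSpace ℝ (Fin N),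
            ENNReal.ofReal (1 / (‖x - y‖ ^ γ * (1 + ‖y‖ ^ (N : ℝ))))) ∧
        (∫⁻ y : EuclideanSpace ℝ (Fin N),
            ENNReal.ofReal (1 / (‖x - y‖ ^ γ * (1 + ‖y‖ ^ (N : ℝ))))) ≤
          ENNReal.ofReal (C * ‖x‖ ^ (-γ) * Real.log ‖x‖) := by
  obtain ⟨κ, hκ, hpol⟩ := polar_exists N hN
  have hNγ : 0 < (N:ℝ) - γ := by linarith
  refine ⟨κ * 2 ^ (-γ) / 2, κ * (2 ^ γ * 2 + 2 ^ N * 3 ^ (N - γ) / (N - γ)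
    + (3 / 2) ^ N * 3 ^ (-γ) / γ), 3, by positivity, by positivity, by norm_num, fun x hx => ?_⟩
  have hX : 0 < ‖x‖ := by linarith
  have hlog : 1 ≤ Real.log ‖x‖ := by
    rw [Real.le_log_iff_exp_le hX]
    linarith [Real.exp_one_lt_d9]
  have hm1 : Measurable fun r : ℝ => 1 / (1 + r ^ N) := by fun_prop
  have hm2 : Measurable fun r : ℝ => r ^ (-γ) := by fun_prop
  have hm3 : Measurable fun r : ℝ => r ^ (-γ - N) := by fun_prop
  constructor
  · refine le_trans ?_ (lintegral_mono fun y => ptwise_lower N γ hγ x y hX)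
    rw [lintegral_const_mul' _ _ ENNReal.ofReal_ne_top, hpol _ _ measurableSet_Ioo hm1]
    refine le_trans ?_ (mul_le_mul_right (mul_le_mul_right (rad_low N hN ‖x‖ (by linarith)) _) _)
    rw [← ENNReal.ofReal_mul (by positivity), ← ENNReal.ofReal_mul (by positivity),
      ← ENNReal.ofReal_mul (by positivity)]
    apply ENNReal.ofReal_le_ofReal
    rw [Real.mul_rpow (by norm_num) hX.le]
    apply le_of_eq; ring
  · refine le_trans (lintegral_mono fun y => ptwise_upper N γ hγ x y hX) ?_
    rw [lintegral_add_left, lintegral_add_left, lintegral_const_mul' _ _ ENNReal.ofReal_ne_top,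
      lintegral_const_mul' _ _ ENNReal.ofReal_ne_top,
      lintegral_const_mul' _ _ ENNReal.ofReal_ne_top,
      lintegral_sub_left_eq_self (fun z : EuclideanSpace ℝ (Fin N) =>
        (Set.Iic (3 * ‖x‖)).indicator (fun r => ENNReal.ofReal (r ^ (-γ))) ‖z‖) x,
      lintegral_sub_left_eq_self (fun z : EuclideanSpace ℝ (Fin N) =>
        (Set.Ioi (3 * ‖x‖)).indicator (fun r => ENNReal.ofReal (r ^ (-γ - N))) ‖z‖) x,
      hpol _ _ measurableSet_Iic hm1, hpol _ _ measurableSet_Iic hm2,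
      hpol _ _ measurableSet_Ioi hm3, rad_two N hN γ hγN _ (by positivity),
      rad_three N hN γ hγ _ (by positivity)]
    · refine le_trans (add_le_add_left (mul_le_mul_right (mul_le_mul_right
        (rad_one N hN ‖x‖ (by linarith)) _) _) _) ?_
      rw [← ENNReal.ofReal_mul (by positivity), ← ENNReal.ofReal_mul (by positivity),
        ← ENNReal.ofReal_mul (by positivity), ← ENNReal.ofReal_mul (by positivity),
        ← ENNReal.ofReal_mul (by positivity), ← ENNReal.ofReal_mul (by positivity),
        ← ENNReal.ofReal_add (by positivity) (by positivity),
        ← ENNReal.ofReal_add (by positivity) (by positivity)]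
      apply ENNReal.ofReal_le_ofReal
      have e1 : (‖x‖ / 2) ^ (-γ) = 2 ^ γ * ‖x‖ ^ (-γ) := by
        rw [Real.div_rpow hX.le (by norm_num), Real.rpow_neg (by norm_num : (0:ℝ) ≤ 2)]
        field_simp
      have e2 : 1 / (‖x‖ / 2) ^ N * (3 * ‖x‖) ^ (N - γ) = 2 ^ N * 3 ^ (N - γ) * ‖x‖ ^ (-γ) := by
        rw [Real.mul_rpow (by norm_num) hX.le, sub_eq_add_neg, Real.rpow_add hX,
          Real.rpow_natCast, div_pow]
        field_simp
      have e3 : (3 * ‖x‖) ^ (-γ) = 3 ^ (-γ) * ‖x‖ ^ (-γ) := Real.mul_rpow (by norm_num) hX.le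
      have hP : 0 < ‖x‖ ^ (-γ) := by positivity
      generalize ‖x‖ ^ (-γ) = P at *
      generalize Real.log ‖x‖ = L at *
      calc _ = κ * P * (2 ^ γ * (1 + L)) + κ * P * ((2 ^ N * 3 ^ (N - γ) / (N - γ)
              + (3 / 2) ^ N * 3 ^ (-γ) / γ) * 1) := by
            rw [e1, e3]
            linear_combination (κ / (N - γ)) * e2
        _ ≤ κ * P * (2 ^ γ * (L + L)) + κ * P * ((2 ^ N * 3 ^ (N - γ) / (N - γ)
              + (3 / 2) ^ N * 3 ^ (-γ) / γ) * L) := by gcongr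
        _ = _ := by ring
    · exact (((hm2.ennreal_ofReal.indicator measurableSet_Iic).comp (by fun_prop)).const_mul _)
    · exact (((hm1.ennreal_ofReal.indicator measurableSet_Iic).comp measurable_norm).const_mul _)
end

section
/- Let $N \ge 1$ be an integer and let $\gamma, \beta > 0$ be real numbers with $\gamma < N$ and $\beta > N$. Then there exist constants $c, C, R > 0$ such that $c\,|x|^{-\gamma} \le J(x) \le C\,|x|^{-\gamma}$ for all $x \in \mathbb{R}^N$ with $|x| \ge R$. -/
open MeasureTheory ENNReal

lemma aux_pt (t β : ℝ) (ht : 0 ≤ t) (hβ : 0 < β) :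
    1 / (1 + t ^ β) ≤ 2 ^ β * (1 + t) ^ (-β) := by
  have h0 : 0 ≤ t ^ β := Real.rpow_nonneg ht _
  have h1 : (1 + t) ^ β ≤ 2 ^ β * (1 + t ^ β) := by
    rcases le_total t 1 with h | h
    · calc (1 + t) ^ β ≤ 2 ^ β := Real.rpow_le_rpow (by linarith) (by linarith) hβ.le
        _ ≤ _ := le_mul_of_one_le_right (by positivity) (by linarith)
    · calc (1 + t) ^ β ≤ (2 * t) ^ β := Real.rpow_le_rpow (by linarith) (by linarith) hβ.le
        _ = 2 ^ β * t ^ β := Real.mul_rpow (by norm_num) ht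
        _ ≤ _ := by gcongr; linarith
  rw [Real.rpow_neg (by linarith), ← div_eq_mul_inv, div_le_div_iff₀ (by positivity) (by positivity)]
  linarith

/-- truncated singular kernel -/
noncomputable def auxG (N : ℕ) (γ : ℝ) : EuclideanSpace ℝ (Fin N) → ℝ :=
  (Metric.ball 0 1).indicator (fun w => ‖w‖ ^ (-γ))

lemma auxG_nonneg (N : ℕ) (γ : ℝ) (w : EuclideanSpace ℝ (Fin N)) : 0 ≤ auxG N γ w :=
  Set.indicator_nonneg (fun _ _ => by positivity) _

lemma auxG_int (N : ℕ) (hN : 1 ≤ N) (γ : ℝ) (hγN : γ < N) : Integrable (auxG N γ) := by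
  unfold auxG
  rw [integrable_indicator_iff Metric.isOpen_ball.measurableSet]
  refine integrableOn_ball_of_norm_le_rpow (C := 1) (α := γ) (by simpa using hN)
    (by simpa using hγN) ?_ ?_
  · refine Filter.Eventually.of_forall fun x => ?_
    rw [one_mul, Real.norm_of_nonneg (by positivity)]
  · exact (by fun_prop : Measurable fun w : EuclideanSpace ℝ (Fin N) => ‖w‖ ^ (-γ)).aestronglyMeasurable

lemma aux_upper (N : ℕ) (γ β : ℝ) (hγ : 0 < γ) (hβ : 0 < β)
    (x y : EuclideanSpace ℝ (Fin N)) (hx : 0 < ‖x‖) :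
    1 / (‖x - y‖ ^ γ * (1 + ‖y‖ ^ β)) ≤
      2 ^ γ * 2 ^ β * ‖x‖ ^ (-γ) * (1 + ‖y‖) ^ (-β) +
      2 ^ β * ‖x‖ ^ (-β) * ‖x‖ ^ (-γ) * auxG N γ (‖x‖⁻¹ • (x - y)) := by
  have hG := auxG_nonneg N γ (‖x‖⁻¹ • (x - y))
  have e : 1 / (‖x - y‖ ^ γ * (1 + ‖y‖ ^ β)) = ‖x - y‖ ^ (-γ) * (1 / (1 + ‖y‖ ^ β)) := by
    rw [Real.rpow_neg (norm_nonneg _)]; field_simp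
  rw [e]
  have hi : ∀ b : ℝ, (‖x‖ / 2) ^ (-b) = 2 ^ b * ‖x‖ ^ (-b) := fun b => by
    rw [Real.div_rpow hx.le (by norm_num), Real.rpow_neg (by norm_num : (0:ℝ) ≤ 2)]
    field_simp
  rcases le_or_gt (‖x‖ / 2) ‖x - y‖ with h | h
  · have h1 : ‖x - y‖ ^ (-γ) ≤ 2 ^ γ * ‖x‖ ^ (-γ) := by
      rw [← hi]
      exact Real.rpow_le_rpow_of_nonpos (by positivity) h (by linarith)
    have h2 := aux_pt ‖y‖ β (norm_nonneg _) hβ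
    calc _ ≤ (2 ^ γ * ‖x‖ ^ (-γ)) * (2 ^ β * (1 + ‖y‖) ^ (-β)) := by gcongr
      _ = 2 ^ γ * 2 ^ β * ‖x‖ ^ (-γ) * (1 + ‖y‖) ^ (-β) := by ring
      _ ≤ _ := le_add_of_nonneg_right (by positivity)
  · have h1 : ‖x‖ / 2 ≤ ‖y‖ := by
      have := norm_sub_norm_le x y
      linarith
    have hn : ‖‖x‖⁻¹ • (x - y)‖ = ‖x - y‖ / ‖x‖ := by
      rw [norm_smul, norm_inv, norm_norm]; field_simp
    have h2 : auxG N γ (‖x‖⁻¹ • (x - y)) = ‖x - y‖ ^ (-γ) * (‖x‖ ^ (-γ))⁻¹ := by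
      unfold auxG
      rw [Set.indicator_of_mem, hn, Real.div_rpow (norm_nonneg _) hx.le, div_eq_mul_inv]
      rw [mem_ball_zero_iff, hn, div_lt_one hx]
      linarith
    have h3 : 1 / (1 + ‖y‖ ^ β) ≤ 2 ^ β * ‖x‖ ^ (-β) := by
      rw [← hi, Real.rpow_neg (by positivity), ← one_div]
      have := Real.rpow_le_rpow (by positivity) h1 hβ.le
      gcongr
      linarith
    have hxp : ‖x‖ ^ (-γ) ≠ 0 := (Real.rpow_pos_of_pos hx _).ne'
    calc _ ≤ ‖x - y‖ ^ (-γ) * (2 ^ β * ‖x‖ ^ (-β)) := by gcongr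
      _ = 2 ^ β * ‖x‖ ^ (-β) * ‖x‖ ^ (-γ) * auxG N γ (‖x‖⁻¹ • (x - y)) := by
        rw [h2]; field_simp
      _ ≤ _ := le_add_of_nonneg_left (by positivity)

/-- For `γ, β > 0` with `γ < N` and `β > N`, the function
`J(x) = ∫_{ℝ^N} |x-y|^{-γ} (1+|y|^β)^{-1} dy` behaves like `|x|^{-γ}` at infinity. -/
theorem J_asymptotics_beta_gt (N : ℕ) (hN : 1 ≤ N) (γ β : ℝ) (hγ : 0 < γ) (hβ : 0 < β)
    (hγN : γ < N) (hβN : (N : ℝ) < β) :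
    ∃ c C R : ℝ, 0 < c ∧ 0 < C ∧ 0 < R ∧
      ∀ x : EuclideanSpace ℝ (Fin N), R ≤ ‖x‖ →
        ENNReal.ofReal (c * ‖x‖ ^ (-γ)) ≤
          (∫⁻ y : EuclideanSpace ℝ (Fin N),
            ENNReal.ofReal (1 / (‖x - y‖ ^ γ * (1 + ‖y‖ ^ β)))) ∧
        (∫⁻ y : EuclideanSpace ℝ (Fin N),
            ENNReal.ofReal (1 / (‖x - y‖ ^ γ * (1 + ‖y‖ ^ β)))) ≤
          ENNReal.ofReal (C * ‖x‖ ^ (-γ)) := by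
  classical
  set K : ℝ := ∫ y : EuclideanSpace ℝ (Fin N), (1 + ‖y‖) ^ (-β) with hK
  set A : ℝ := ∫ w, auxG N γ w with hA
  have hK0 : 0 ≤ K := integral_nonneg fun y => by positivity
  have hA0 : 0 ≤ A := integral_nonneg fun y => auxG_nonneg _ _ _
  have hKi : Integrable fun y : EuclideanSpace ℝ (Fin N) => (1 + ‖y‖) ^ (-β) :=
    integrable_one_add_norm (by simpa using hβN)
  set V : ℝ := (volume (Metric.ball (0 : EuclideanSpace ℝ (Fin N)) 1)).toReal with hV
  have hVfin : volume (Metric.ball (0 : EuclideanSpace ℝ (Fin N)) 1) ≠ ⊤ :=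
    measure_ball_lt_top.ne
  have hV0 : 0 < V := ENNReal.toReal_pos (Metric.measure_ball_pos _ _ one_pos).ne' hVfin
  refine ⟨(2 ^ γ)⁻¹ * 2⁻¹ * V, 2 ^ γ * 2 ^ β * K + 2 ^ β * A + 1, 1, by positivity, by positivity,
    one_pos, fun x hx => ⟨?_, ?_⟩⟩
  · have hx0 : 0 < ‖x‖ := by linarith
    -- almost everywhere lower bound on the unit ball, off the point `x`
    calc ENNReal.ofReal ((2 ^ γ)⁻¹ * 2⁻¹ * V * ‖x‖ ^ (-γ))
        = ENNReal.ofReal ((2 ^ γ)⁻¹ * 2⁻¹ * ‖x‖ ^ (-γ)) *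
            volume (Metric.ball (0 : EuclideanSpace ℝ (Fin N)) 1) := by
          rw [← ENNReal.ofReal_toReal hVfin, ← ENNReal.ofReal_mul (by positivity)]
          congr 1; rw [← hV]; ring
      _ = ∫⁻ y in Metric.ball (0 : EuclideanSpace ℝ (Fin N)) 1,
            ENNReal.ofReal ((2 ^ γ)⁻¹ * 2⁻¹ * ‖x‖ ^ (-γ)) := by
          rw [setLIntegral_const]
      _ ≤ ∫⁻ y in Metric.ball (0 : EuclideanSpace ℝ (Fin N)) 1,
            ENNReal.ofReal (1 / (‖x - y‖ ^ γ * (1 + ‖y‖ ^ β))) := by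
          refine setLIntegral_mono' Metric.isOpen_ball.measurableSet fun y hy => ?_
          rw [mem_ball_zero_iff] at hy
          refine ENNReal.ofReal_le_ofReal ?_
          have hpos : 0 < ‖x - y‖ := by
            have := norm_sub_norm_le x y
            linarith
          have h1 : ‖x - y‖ ≤ 2 * ‖x‖ := by
            have := norm_sub_le x y
            linarith
          have h2 : ‖x - y‖ ^ γ ≤ 2 ^ γ * ‖x‖ ^ γ := by
            rw [← Real.mul_rpow (by norm_num) hx0.le]
            exact Real.rpow_le_rpow hpos.le h1 hγ.le
          have h3 : ‖y‖ ^ β ≤ 1 := Real.rpow_le_one (norm_nonneg _) hy.le hβ.le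
          have h4 : 0 ≤ ‖y‖ ^ β := by positivity
          have h5 : 0 < ‖x - y‖ ^ γ := Real.rpow_pos_of_pos hpos _
          have e : (2 ^ γ)⁻¹ * 2⁻¹ * ‖x‖ ^ (-γ) = 1 / ((2 ^ γ * ‖x‖ ^ γ) * 2) := by
            rw [Real.rpow_neg hx0.le]; field_simp
          rw [e]
          apply one_div_le_one_div_of_le (by positivity)
          apply mul_le_mul h2 (by linarith) (by positivity) (by positivity)
      _ ≤ _ := setLIntegral_le_lintegral _ _
  · have hx0 : 0 < ‖x‖ := by linarith
    have hGi : Integrable fun y => auxG N γ (‖x‖⁻¹ • (x - y)) :=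
      ((auxG_int N hN γ hγN).comp_smul (inv_ne_zero hx0.ne')).comp_sub_left x
    have hGe : ∫ y, auxG N γ (‖x‖⁻¹ • (x - y)) = ‖x‖ ^ N * A := by
      rw [integral_sub_left_eq_self (fun z => auxG N γ (‖x‖⁻¹ • z)) volume x,
        Measure.integral_comp_inv_smul_of_nonneg _ _ hx0.le]
      simp [hA]
    have hI1 := hKi.const_mul (2 ^ γ * 2 ^ β * ‖x‖ ^ (-γ))
    have hI2 := hGi.const_mul (2 ^ β * ‖x‖ ^ (-β) * ‖x‖ ^ (-γ))
    refine (lintegral_mono fun y =>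
      ENNReal.ofReal_le_ofReal (aux_upper N γ β hγ hβ x y hx0)).trans ?_
    refine (ofReal_integral_eq_lintegral_ofReal (hI1.add hI2)
      (Filter.Eventually.of_forall fun y => ?_)).symm.le.trans ?_
    · have := auxG_nonneg N γ (‖x‖⁻¹ • (x - y))
      simp only [Pi.zero_apply, Pi.add_apply]
      positivity
    · refine ENNReal.ofReal_le_ofReal ?_
      rw [integral_add' hI1 hI2, integral_const_mul, integral_const_mul, hGe, ← hK]
      have hp : ‖x‖ ^ (-β) * ‖x‖ ^ N ≤ 1 := by
        rw [← Real.rpow_natCast, ← Real.rpow_add hx0]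
        exact Real.rpow_le_one_of_one_le_of_nonpos hx (by linarith)
      have hg : 0 ≤ ‖x‖ ^ (-γ) := by positivity
      have hq : 2 ^ β * A * ‖x‖ ^ (-γ) * (‖x‖ ^ (-β) * ‖x‖ ^ N) ≤ 2 ^ β * A * ‖x‖ ^ (-γ) :=
        mul_le_of_le_one_right (by positivity) hp
      nlinarith [hq, hg]
end

section
/- Let $N \ge 3$ and $\alpha > 0$. There exists a constant $C > 0$ such that for every $u \in C_c^\infty(\mathbb{R}^N)$, $\left(\int_{\mathbb{R}^N} |u|^2 \, d\mu\right)^{1+\frac{2}{N}} \le C \left(\int_{\mathbb{R}^N} |\nabla u|^2 \, dx\right) \left(\int_{\mathbb{R}^N} |u|\,(1+|x|^{\alpha})^{\frac{2-N}{4}} \, d\mu\right)^{\frac{4}{N}}$. -/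
open MeasureTheory

/-- Weighted Nash inequality with weight `(1+|x|^α)^{(2-N)/4}` for the measure
`dμ = (1+|x|^α)^{-1} dx`, valid for all `α > 0` and `N ≥ 3`. -/
theorem weighted_nash_alpha_pos (N : ℕ) (hN : 3 ≤ N) (α : ℝ) (hα : 0 < α) :
    ∃ C : ℝ, 0 < C ∧ ∀ u : EuclideanSpace ℝ (Fin N) → ℝ,
      ContDiff ℝ (⊤ : ℕ∞) u → HasCompactSupport u →
      (∫ x : EuclideanSpace ℝ (Fin N), (u x) ^ 2 * (1 + ‖x‖ ^ α)⁻¹) ^ (1 + 2 / (N : ℝ)) ≤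
        C * (∫ x : EuclideanSpace ℝ (Fin N), ‖fderiv ℝ u x‖ ^ 2) *
          (∫ x : EuclideanSpace ℝ (Fin N),
            |u x| * (1 + ‖x‖ ^ α) ^ ((2 - (N : ℝ)) / 4) * (1 + ‖x‖ ^ α)⁻¹) ^ (4 / (N : ℝ)) := by
  set K : NNReal := eLpNormLESNormFDerivOfEqInnerConst
    (volume : Measure (EuclideanSpace ℝ (Fin N))) ((2 : NNReal) : ℝ) with hK
  refine ⟨(K : ℝ) ^ 2 + 1, by positivity, ?_⟩
  intro u hu hcu
  have hN3 : (3 : ℝ) ≤ N := by exact_mod_cast hN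
  have hN0 : (0 : ℝ) < N := by linarith
  have hN2 : (0 : ℝ) < N - 2 := by linarith
  have hw : ∀ x : EuclideanSpace ℝ (Fin N), 0 < 1 + ‖x‖ ^ α := fun x => by positivity
  have hwc : Continuous fun x : EuclideanSpace ℝ (Fin N) => 1 + ‖x‖ ^ α :=
    continuous_const.add (continuous_norm.rpow_const fun _ => Or.inr hα.le)
  have hwi : Continuous fun x : EuclideanSpace ℝ (Fin N) => (1 + ‖x‖ ^ α)⁻¹ :=
    hwc.inv₀ fun x => (hw x).ne'
  have hwp : Continuous fun x : EuclideanSpace ℝ (Fin N) =>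
      (1 + ‖x‖ ^ α) ^ ((2 - (N : ℝ)) / 4) :=
    hwc.rpow_const fun x => Or.inl (hw x).ne'
  have huc : Continuous u := hu.continuous
  have hdc : Continuous (fderiv ℝ u) := hu.continuous_fderiv (by simp)
  have hAi : Integrable (fun x => (u x) ^ 2 * (1 + ‖x‖ ^ α)⁻¹) := by
    refine ((huc.pow 2).mul hwi).integrable_of_hasCompactSupport ?_
    refine hcu.mono fun x hx => ?_
    simp only [Function.mem_support] at *
    intro h; simp [h] at hx
  have hBi : Integrable (fun x => |u x| * (1 + ‖x‖ ^ α) ^ ((2 - (N : ℝ)) / 4)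
      * (1 + ‖x‖ ^ α)⁻¹) := by
    refine ((huc.abs.mul hwp).mul hwi).integrable_of_hasCompactSupport ?_
    refine hcu.mono fun x hx => ?_
    simp only [Function.mem_support] at *
    intro h; simp [h] at hx
  have hGi : Integrable (fun x => ‖fderiv ℝ u x‖ ^ 2) := by
    refine (hdc.norm.pow 2).integrable_of_hasCompactSupport ?_
    refine (hcu.fderiv (𝕜 := ℝ)).mono fun x hx => ?_
    simp only [Function.mem_support] at *
    intro h; simp [h] at hx
  have hA0 : ∀ x, 0 ≤ (u x) ^ 2 * (1 + ‖x‖ ^ α)⁻¹ := fun x => by positivity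
  have hB0 : ∀ x, 0 ≤ |u x| * (1 + ‖x‖ ^ α) ^ ((2 - (N : ℝ)) / 4)
      * (1 + ‖x‖ ^ α)⁻¹ := fun x => by positivity
  have hG0 : ∀ x, 0 ≤ ‖fderiv ℝ u x‖ ^ 2 := fun x => by positivity
  have hAe := ofReal_integral_eq_lintegral_ofReal hAi (Filter.Eventually.of_forall hA0)
  have hBe := ofReal_integral_eq_lintegral_ofReal hBi (Filter.Eventually.of_forall hB0)
  have hGe := ofReal_integral_eq_lintegral_ofReal hGi (Filter.Eventually.of_forall hG0)
  have hA1 : 0 ≤ ∫ x, (u x) ^ 2 * (1 + ‖x‖ ^ α)⁻¹ := integral_nonneg hA0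
  have hB1 : 0 ≤ ∫ x, |u x| * (1 + ‖x‖ ^ α) ^ ((2 - (N : ℝ)) / 4) * (1 + ‖x‖ ^ α)⁻¹ := integral_nonneg hB0
  have hG1 : 0 ≤ ∫ x, ‖fderiv ℝ u x‖ ^ 2 := integral_nonneg hG0
  set A := ∫ x, (u x) ^ 2 * (1 + ‖x‖ ^ α)⁻¹
  set B := ∫ x, |u x| * (1 + ‖x‖ ^ α) ^ ((2 - (N : ℝ)) / 4) * (1 + ‖x‖ ^ α)⁻¹
  set G := ∫ x, ‖fderiv ℝ u x‖ ^ 2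
  -- the Sobolev exponent
  let p' : NNReal := ⟨2 * N / (N - 2), by positivity⟩
  have hp' : (p' : ℝ) = 2 * N / (N - 2) := rfl
  have hp'0 : 0 < (p' : ℝ) := by rw [hp']; positivity
  have hS := eLpNorm_le_eLpNorm_fderiv_of_eq_inner (μ := volume) (p := 2) (p' := p')
    (hu.of_le (by simp)) hcu (by norm_num) (by simp; omega) (by
      rw [hp']; simp; field_simp)
  rw [← hK, eLpNorm_nnreal_eq_lintegral (by exact_mod_cast hp'0.ne'),
    eLpNorm_nnreal_eq_lintegral (by norm_num)] at hS
  have hG2 : ∫⁻ x, ‖fderiv ℝ u x‖ₑ ^ ((2 : NNReal) : ℝ) = ENNReal.ofReal G := by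
    rw [hGe]
    congr with x
    rw [ENNReal.ofReal_pow (norm_nonneg _), ofReal_norm_eq_enorm]
    norm_num
  rw [hG2] at hS
  set S := ∫⁻ x, ‖u x‖ₑ ^ (p' : ℝ) with hSdef
  have hS2 : S ^ (((N : ℝ) - 2) / N) ≤ (K : ENNReal) ^ 2 * ENNReal.ofReal G := by
    have h := ENNReal.rpow_le_rpow hS (zero_le_two (α := ℝ))
    rw [ENNReal.mul_rpow_of_nonneg _ _ zero_le_two, ← ENNReal.rpow_mul, ← ENNReal.rpow_mul] at h
    convert h using 2
    · rw [hp']; field_simp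
    · norm_num
    · norm_num
  -- Hölder
  have hH : ENNReal.ofReal A ≤ S ^ (((N : ℝ) - 2) / (N + 2)) *
      ENNReal.ofReal B ^ (4 / ((N : ℝ) + 2)) := by
    rw [hAe, hBe]
    refine le_trans (le_of_eq ?_) (ENNReal.lintegral_mul_norm_pow_le
      (f := fun x => ‖u x‖ₑ ^ (p' : ℝ)) (huc.enorm.measurable.pow_const _).aemeasurable
      hBi.1.aemeasurable.ennreal_ofReal (by positivity) (by positivity)
      (by field_simp; ring))
    refine lintegral_congr fun x => ?_
    rw [← ofReal_norm_eq_enorm, ENNReal.ofReal_rpow_of_nonneg (norm_nonneg _) hp'0.le,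
      ENNReal.ofReal_rpow_of_nonneg (by positivity) (by positivity),
      ENNReal.ofReal_rpow_of_nonneg (hB0 x) (by positivity),
      ← ENNReal.ofReal_mul (by positivity)]
    congr 1
    have hwx := hw x
    rw [← Real.rpow_mul (norm_nonneg _), mul_assoc, ← Real.rpow_neg_one, ← Real.rpow_add hwx,
      Real.mul_rpow (abs_nonneg _) (by positivity), ← Real.rpow_mul hwx.le, ← mul_assoc,
      Real.norm_eq_abs, ← Real.rpow_add_of_nonneg (abs_nonneg _) (by positivity) (by positivity),
      ← sq_abs, ← Real.rpow_natCast]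
    congr 2
    · rw [hp']; field_simp; push_cast; ring
    · field_simp; ring
  have hfin : ENNReal.ofReal (A ^ (1 + 2 / (N : ℝ))) ≤
      ENNReal.ofReal (((K : ℝ) ^ 2 + 1) * G * B ^ (4 / (N : ℝ))) := by
    rw [← ENNReal.ofReal_rpow_of_nonneg hA1 (by positivity), ENNReal.ofReal_mul (by positivity),
      ENNReal.ofReal_mul (by positivity), ← ENNReal.ofReal_rpow_of_nonneg hB1 (by positivity)]
    calc _ ≤ (S ^ (((N : ℝ) - 2) / (N + 2)) *
          ENNReal.ofReal B ^ (4 / ((N : ℝ) + 2))) ^ (1 + 2 / (N : ℝ)) :=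
          ENNReal.rpow_le_rpow hH (by positivity)
      _ = S ^ (((N : ℝ) - 2) / N) * ENNReal.ofReal B ^ (4 / (N : ℝ)) := by
          rw [ENNReal.mul_rpow_of_nonneg _ _ (by positivity), ← ENNReal.rpow_mul,
            ← ENNReal.rpow_mul]
          congr 2 <;> field_simp
      _ ≤ _ := by
          gcongr
          refine hS2.trans ?_
          gcongr
          rw [ENNReal.ofReal_add (by positivity) (by positivity),
            ENNReal.ofReal_pow (by positivity), ENNReal.ofReal_coe_nnreal]
          exact le_self_add
  exact (ENNReal.ofReal_le_ofReal_iff (by positivity)).1 hfin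
end

section
/- Let $N \ge 3$ and $\alpha \ge 4$. There exists a constant $C > 0$ such that for every $u \in C_c^\infty(\mathbb{R}^N)$, $\left(\int_{\mathbb{R}^N} |u|^2 \, d\mu\right)^{1+\frac{2}{N}} \le C \left(\int_{\mathbb{R}^N} |\nabla u|^2 \, dx\right) \left(\int_{\mathbb{R}^N} |u|\,(1+|x|)^{2-N} \, d\mu\right)^{\frac{4}{N}}$. -/
open MeasureTheory

lemma wn_sobolev (N : ℕ) (hN : 3 ≤ N) :
    ∃ C : ℝ, 0 < C ∧ ∀ u : EuclideanSpace ℝ (Fin N) → ℝ,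
      ContDiff ℝ (⊤ : ℕ∞) u → HasCompactSupport u →
      (∫ x : EuclideanSpace ℝ (Fin N), |u x| ^ (2 * (N : ℝ) / (N - 2))) ^ (((N : ℝ) - 2) / N) ≤
        C * (∫ x : EuclideanSpace ℝ (Fin N), ‖fderiv ℝ u x‖ ^ 2) := by
  have hn : (3 : ℝ) ≤ N := by exact_mod_cast hN
  have hn2 : (0 : ℝ) < N - 2 := by linarith
  set K := SNormLESNormFDerivOfEqConst ℝ (volume : Measure (EuclideanSpace ℝ (Fin N))) 2 with hK
  refine ⟨(K : ℝ) ^ 2 + 1, by positivity, fun u hu hc => ?_⟩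
  have hu1 : ContDiff ℝ 1 u := hu.of_le (by exact_mod_cast le_top)
  have hp0 : (0 : ℝ) < 2 * (N : ℝ) / (N - 2) := by positivity
  set p' : NNReal := ⟨2 * (N : ℝ) / (N - 2), hp0.le⟩ with hp'
  have hp'c : (p' : ℝ) = 2 * (N : ℝ) / (N - 2) := rfl
  have hp'0 : (p' : ENNReal) ≠ 0 := by
    intro h
    have : p' = 0 := by exact_mod_cast h
    have : (p' : ℝ) = 0 := by rw [this]; rfl
    linarith
  have key := eLpNorm_le_eLpNorm_fderiv_of_eq (F := ℝ)
    (volume : Measure (EuclideanSpace ℝ (Fin N))) hu1 hc (p := 2) (p' := p')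
    (by norm_num) (by simp; omega) (by
      rw [hp'c]; simp; field_simp)
  have hm1 : MemLp u p' (volume : Measure (EuclideanSpace ℝ (Fin N))) :=
    hu.continuous.memLp_of_hasCompactSupport hc
  have hm2 : MemLp (fderiv ℝ u) (2 : NNReal) (volume : Measure (EuclideanSpace ℝ (Fin N))) :=
    (hu1.continuous_fderiv (by norm_num)).memLp_of_hasCompactSupport (hc.fderiv ℝ)
  rw [hm1.eLpNorm_eq_integral_rpow_norm hp'0 ENNReal.coe_ne_top,
    hm2.eLpNorm_eq_integral_rpow_norm (by norm_num) ENNReal.coe_ne_top] at key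
  simp only [ENNReal.coe_toReal, Real.norm_eq_abs, hp'c, NNReal.coe_ofNat, Real.rpow_ofNat] at key
  rw [← hp'c] at key ⊢
  have hI : 0 ≤ ∫ x : EuclideanSpace ℝ (Fin N), |u x| ^ (p' : ℝ) :=
    integral_nonneg fun x => by positivity
  have hJ : 0 ≤ ∫ x : EuclideanSpace ℝ (Fin N), ‖fderiv ℝ u x‖ ^ 2 :=
    integral_nonneg fun x => by positivity
  rw [← ENNReal.ofReal_coe_nnreal, ← ENNReal.ofReal_mul (NNReal.coe_nonneg _),
    ENNReal.ofReal_le_ofReal_iff (by positivity)] at key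
  have h2 := pow_le_pow_left₀ (by positivity) key 2
  rw [mul_pow, ← Real.rpow_mul_natCast hI, ← Real.rpow_mul_natCast hJ] at h2
  have e1 : (p' : ℝ)⁻¹ * (2 : ℕ) = ((N : ℝ) - 2) / N := by
    rw [hp'c]; push_cast; field_simp
  rw [e1] at h2
  norm_num at h2
  refine h2.trans ?_
  gcongr
  rw [hK]
  linarith

lemma wn_weight (α r : ℝ) (hα : 4 ≤ α) (hr : 0 ≤ r) :
    (1 + r) ^ (4 : ℝ) * (1 + r ^ α)⁻¹ ≤ 16 := by
  have h0 : 0 ≤ r ^ α := by positivity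
  rw [← div_eq_mul_inv, div_le_iff₀ (by positivity)]
  norm_num
  rcases le_total r 1 with h | h
  · have : (1 + r) ^ 4 ≤ (2 : ℝ) ^ 4 := by gcongr; linarith
    linarith
  · have h1 : (1 + r) ^ 4 ≤ (2 * r) ^ 4 := by gcongr; linarith
    have h2 : r ^ (4 : ℝ) ≤ r ^ α := Real.rpow_le_rpow_of_exponent_le h hα
    norm_num at h2
    nlinarith

lemma wn_pointwise (n a b w : ℝ) (hn : 3 ≤ n) (ha : 0 ≤ a) (hb : 0 < b) (hw : 0 < w)
    (h : b ^ (4 : ℝ) * w ≤ 16) :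
    a ^ 2 * w ≤ 16 ^ ((n - 2) / (n + 2)) *
      (a ^ (2 * n / (n + 2)) * (a * b ^ (2 - n) * w) ^ (4 / (n + 2))) := by
  have hs : 0 ≤ (n - 2) / (n + 2) := div_nonneg (by linarith) (by linarith)
  have hn2 : n + 2 ≠ 0 := by linarith
  have e1 : a ^ 2 = a ^ (2 * n / (n + 2)) * a ^ (4 / (n + 2)) := by
    have e : 2 * n / (n + 2) + 4 / (n + 2) = 2 := by field_simp; ring
    rw [← Real.rpow_add' ha (by rw [e]; norm_num), e]; norm_num
  have e2 : w = (b ^ (2 - n) * w) ^ (4 / (n + 2)) * (b ^ (4 : ℝ) * w) ^ ((n - 2) / (n + 2)) := by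
    rw [Real.mul_rpow (by positivity) hw.le, Real.mul_rpow (by positivity) hw.le,
      ← Real.rpow_mul hb.le, ← Real.rpow_mul hb.le, mul_mul_mul_comm, ← Real.rpow_add hb,
      ← Real.rpow_add hw]
    have x1 : (2 - n) * (4 / (n + 2)) + 4 * ((n - 2) / (n + 2)) = 0 := by field_simp; ring
    have x2 : 4 / (n + 2) + (n - 2) / (n + 2) = 1 := by field_simp; ring
    rw [x1, x2]; simp
  have h3 : (b ^ (4 : ℝ) * w) ^ ((n - 2) / (n + 2)) ≤ 16 ^ ((n - 2) / (n + 2)) :=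
    Real.rpow_le_rpow (by positivity) h hs
  have h4 : w ≤ (b ^ (2 - n) * w) ^ (4 / (n + 2)) * 16 ^ ((n - 2) / (n + 2)) := by
    calc w = _ := e2
      _ ≤ _ := by gcongr
  calc a ^ 2 * w ≤ a ^ 2 * ((b ^ (2 - n) * w) ^ (4 / (n + 2)) * 16 ^ ((n - 2) / (n + 2))) := by
        gcongr
    _ = _ := by
      rw [e1, mul_assoc a, Real.mul_rpow ha (by positivity)]; ring

/-- Weighted Nash inequality with weight `(1+|x|)^{2-N}` for the measure
`dμ = (1+|x|^α)^{-1} dx`, valid for `α ≥ 4` and `N ≥ 3`. -/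
theorem weighted_nash_alpha_ge_four (N : ℕ) (hN : 3 ≤ N) (α : ℝ) (hα : 4 ≤ α) :
    ∃ C : ℝ, 0 < C ∧ ∀ u : EuclideanSpace ℝ (Fin N) → ℝ,
      ContDiff ℝ (⊤ : ℕ∞) u → HasCompactSupport u →
      (∫ x : EuclideanSpace ℝ (Fin N), (u x) ^ 2 * (1 + ‖x‖ ^ α)⁻¹) ^ (1 + 2 / (N : ℝ)) ≤
        C * (∫ x : EuclideanSpace ℝ (Fin N), ‖fderiv ℝ u x‖ ^ 2) *
          (∫ x : EuclideanSpace ℝ (Fin N),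
            |u x| * (1 + ‖x‖) ^ (2 - (N : ℝ)) * (1 + ‖x‖ ^ α)⁻¹) ^ (4 / (N : ℝ)) := by
  obtain ⟨C, hC, hsob⟩ := wn_sobolev N hN
  have hn : (3 : ℝ) ≤ N := by exact_mod_cast hN
  have hn2 : (0 : ℝ) < N - 2 := by linarith
  set n : ℝ := (N : ℝ) with hnN
  set K : ℝ := 16 ^ ((n - 2) / (n + 2)) with hK
  have hK0 : 0 < K := by positivity
  refine ⟨K ^ (1 + 2 / n) * C, by positivity, fun u hu hc => ?_⟩
  have hs := hsob u hu hc
  have huc := hu.continuous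
  have hwpos : ∀ x : EuclideanSpace ℝ (Fin N), 0 < (1 + ‖x‖ ^ α)⁻¹ := fun x => by positivity
  have hwc : Continuous fun x : EuclideanSpace ℝ (Fin N) => (1 + ‖x‖ ^ α)⁻¹ := by
    refine Continuous.inv₀ ?_ fun x => by positivity
    exact continuous_const.add (continuous_norm.rpow_const fun x => Or.inr (by linarith))
  have hbc : Continuous fun x : EuclideanSpace ℝ (Fin N) => (1 + ‖x‖) ^ (2 - n) :=
    (continuous_const.add continuous_norm).rpow_const fun x => Or.inl ((add_pos_of_pos_of_nonneg one_pos (norm_nonneg x)).ne')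
  set f : EuclideanSpace ℝ (Fin N) → ℝ := fun x => |u x| ^ (2 * n / (n + 2)) with hf
  set h : EuclideanSpace ℝ (Fin N) → ℝ :=
    fun x => |u x| * (1 + ‖x‖) ^ (2 - n) * (1 + ‖x‖ ^ α)⁻¹ with hh
  set g : EuclideanSpace ℝ (Fin N) → ℝ := fun x => (h x) ^ (4 / (n + 2)) with hg
  have hh0 : ∀ x, 0 ≤ h x := fun x => by positivity
  have hfc : Continuous f := huc.abs.rpow_const fun x => Or.inr (by positivity)
  have hgc : Continuous g :=
    ((huc.abs.mul hbc).mul hwc).rpow_const fun x => Or.inr (by positivity)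
  have hfs : HasCompactSupport f := by
    refine hc.comp_left (g := fun y : ℝ => |y| ^ (2 * n / (n + 2))) ?_
    have : 2 * n / (n + 2) ≠ 0 := by positivity
    simp [Real.zero_rpow this]
  have hgs : HasCompactSupport g := by
    refine hc.mono fun x hx hx0 => hx ?_
    have : 4 / (n + 2) ≠ 0 := by positivity
    simp [hg, hh, hx0, Real.zero_rpow this]
  have hol := integral_mul_le_Lp_mul_Lq_of_nonneg (μ := volume)
    (p := (n + 2) / (n - 2)) (q := (n + 2) / 4) (f := f) (g := g)
    (by
      rw [Real.holderConjugate_iff]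
      refine ⟨by rw [lt_div_iff₀ hn2]; linarith, by field_simp; ring⟩)
    (Filter.Eventually.of_forall fun x => by positivity)
    (Filter.Eventually.of_forall fun x => Real.rpow_nonneg (hh0 x) _)
    (hfc.memLp_of_hasCompactSupport hfs) (hgc.memLp_of_hasCompactSupport hgs)
  have ef : ∀ x, f x ^ ((n + 2) / (n - 2)) = |u x| ^ (2 * n / (n - 2)) := fun x => by
    simp only [hf]
    rw [← Real.rpow_mul (abs_nonneg _)]
    congr 1; field_simp
  have eg : ∀ x, g x ^ ((n + 2) / 4) = h x := fun x => by
    simp only [hg]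
    rw [← Real.rpow_mul (hh0 x)]
    have : 4 / (n + 2) * ((n + 2) / 4) = 1 := by field_simp
    rw [this, Real.rpow_one]
  simp only [ef, eg] at hol
  set A := ∫ x : EuclideanSpace ℝ (Fin N), |u x| ^ (2 * n / (n - 2)) with hA
  set B := ∫ x : EuclideanSpace ℝ (Fin N), h x with hB
  have hA0 : 0 ≤ A := integral_nonneg fun x => by positivity
  have hB0 : 0 ≤ B := integral_nonneg hh0
  have hint : Integrable (fun x => K * (f x * g x)) (volume : Measure (EuclideanSpace ℝ (Fin N))) :=
    (continuous_const.mul (hfc.mul hgc)).integrable_of_hasCompactSupport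
      ((hfs.mul_right).mul_left)
  have h1 : ∫ x : EuclideanSpace ℝ (Fin N), (u x) ^ 2 * (1 + ‖x‖ ^ α)⁻¹ ≤
      K * (A ^ (1 / ((n + 2) / (n - 2))) * B ^ (1 / ((n + 2) / 4))) := by
    calc _ ≤ ∫ x : EuclideanSpace ℝ (Fin N), K * (f x * g x) := by
          refine integral_mono_of_nonneg (Filter.Eventually.of_forall fun x => by positivity) hint
            (Filter.Eventually.of_forall fun x => ?_)
          have := wn_pointwise n |u x| (1 + ‖x‖) (1 + ‖x‖ ^ α)⁻¹ hn (abs_nonneg _)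
            (by positivity) (hwpos x) (wn_weight α ‖x‖ hα (norm_nonneg _))
          rwa [sq_abs] at this
      _ = K * ∫ x : EuclideanSpace ℝ (Fin N), f x * g x := integral_const_mul _ _
      _ ≤ _ := by gcongr
  have h2 := Real.rpow_le_rpow (z := 1 + 2 / n)
    (integral_nonneg fun x => by positivity) h1 (by positivity)
  rw [Real.mul_rpow hK0.le (by positivity), Real.mul_rpow (by positivity) (by positivity),
    ← Real.rpow_mul hA0, ← Real.rpow_mul hB0] at h2
  have x1 : 1 / ((n + 2) / (n - 2)) * (1 + 2 / n) = (n - 2) / n := by field_simp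
  have x2 : 1 / ((n + 2) / 4) * (1 + 2 / n) = 4 / n := by field_simp
  rw [x1, x2] at h2
  refine h2.trans ?_
  rw [← mul_assoc, mul_assoc _ C]
  gcongr
end

section
/- Let $N \ge 3$ and $2 < \alpha \le 4$, and set $\theta = \frac{2(N+\alpha-4)}{\alpha-2}$. There exists a constant $C > 0$ such that for every $u \in C_c^\infty(\mathbb{R}^N)$, $\left(\int_{\mathbb{R}^N} |u|^2 \, d\mu\right)^{1+\frac{2}{\theta}} \le C \left(\int_{\mathbb{R}^N} |\nabla u|^2 \, dx + \int_{\mathbb{R}^N} |u|^2 \, d\mu\right) \left(\int_{\mathbb{R}^N} |u|\,(1+|x|)^{2-N} \, d\mu\right)^{\frac{4}{\theta}}$. -/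
open MeasureTheory
lemma aux_sobolev (N : ℕ) (hN : 3 ≤ N) : ∃ C : ℝ, 0 < C ∧ ∀ u : EuclideanSpace ℝ (Fin N) → ℝ,
      ContDiff ℝ (⊤ : ℕ∞) u → HasCompactSupport u →
      ∫ x, |u x| ^ (2 * N / (N - 2) : ℝ) ≤ C * (∫ x, ‖fderiv ℝ u x‖ ^ 2) ^ (N / (N - 2) : ℝ) := by
  have hN' : (3:ℝ) ≤ N := by exact_mod_cast hN
  have hp0 : (0:ℝ) < 2 * N / (N - 2) := by apply div_pos <;> linarith
  obtain ⟨p, hp⟩ : ∃ p : NNReal, (p:ℝ) = 2 * N / (N - 2) := ⟨⟨_, hp0.le⟩, rfl⟩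
  let K := eLpNormLESNormFDerivOfEqInnerConst (volume : Measure (EuclideanSpace ℝ (Fin N))) (2:NNReal)
  refine ⟨(K:ℝ) ^ (p:ℝ) + 1, by positivity, fun u hu hc => ?_⟩
  have hu1 : ContDiff ℝ 1 u := hu.of_le (by exact_mod_cast le_top)
  have h := eLpNorm_le_eLpNorm_fderiv_of_eq_inner (volume : Measure (EuclideanSpace ℝ (Fin N))) hu1 hc
    (p := 2) (p' := p) (by norm_num) (by simp; omega) (by
      rw [hp]; simp
      have : (N:ℝ) - 2 ≠ 0 := by linarith
      field_simp)
  have hpp : 0 < (p:ℝ) := by rw [hp]; exact hp0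
  have hcf : HasCompactSupport (fderiv ℝ u) := hc.fderiv (𝕜 := ℝ)
  have hcontf : Continuous (fderiv ℝ u) := hu1.continuous_fderiv (by norm_num)
  have i1 : Integrable (fun x => |u x| ^ (p:ℝ)) := by
    apply Continuous.integrable_of_hasCompactSupport
    · exact (hu1.continuous.abs).rpow_const (fun x => Or.inr hpp.le)
    · exact hc.comp_left (g := fun t => |t| ^ (p:ℝ)) (by simp [hpp.ne'])
  have i2 : Integrable (fun x => ‖fderiv ℝ u x‖ ^ 2) := by
    apply Continuous.integrable_of_hasCompactSupport
    · fun_prop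
    · exact hcf.comp_left (g := fun t => ‖t‖ ^ 2) (by simp)
  have e1 : eLpNorm u p volume ^ (p:ℝ) = ENNReal.ofReal (∫ x, |u x| ^ (p:ℝ)) := by
    rw [eLpNorm_nnreal_pow_eq_lintegral (by exact_mod_cast hpp.ne'),
      ofReal_integral_eq_lintegral_ofReal i1 (Filter.Eventually.of_forall fun x => by positivity)]
    congr 1; ext x
    rw [Real.enorm_eq_ofReal_abs, ENNReal.ofReal_rpow_of_nonneg (abs_nonneg _) hpp.le]
  have e2 : eLpNorm (fderiv ℝ u) ((2:NNReal):ENNReal) volume ^ (2:ℝ) = ENNReal.ofReal (∫ x, ‖fderiv ℝ u x‖ ^ 2) := by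
    have := eLpNorm_nnreal_pow_eq_lintegral (μ := (volume : Measure (EuclideanSpace ℝ (Fin N)))) (f := fderiv ℝ u) (p := 2) (by norm_num)
    simp only [NNReal.coe_ofNat] at this
    rw [this,
      ofReal_integral_eq_lintegral_ofReal i2 (Filter.Eventually.of_forall fun x => by positivity)]
    congr 1; ext x
    rw [← ofReal_norm, ENNReal.ofReal_rpow_of_nonneg (norm_nonneg _) (by norm_num)]
    norm_num
  have hI2 : 0 ≤ ∫ x, ‖fderiv ℝ u x‖ ^ 2 := integral_nonneg fun x => by positivity
  have h3 := ENNReal.rpow_le_rpow h hpp.le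
  rw [e1, ENNReal.mul_rpow_of_nonneg _ _ hpp.le, show (p:ℝ) = 2 * (N / (N-2)) by rw [hp]; ring,
    ENNReal.rpow_mul (eLpNorm _ _ _), e2, ← mul_div_assoc, ← hp, ENNReal.ofReal_rpow_of_nonneg hI2 (by apply div_nonneg <;> linarith),
    ← ENNReal.ofReal_coe_nnreal, ENNReal.ofReal_rpow_of_nonneg (by positivity) hpp.le, ← ENNReal.ofReal_mul (by positivity)] at h3
  rw [ENNReal.ofReal_le_ofReal_iff (by positivity)] at h3
  rw [← hp]
  refine h3.trans ?_
  gcongr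
  change (K:ℝ)^(p:ℝ) ≤ _
  linarith

lemma aux_holder {E : Type*} [MeasurableSpace E] (μ : Measure E) (f g h : E → ℝ) (hf : Integrable f μ)
    (hg : Integrable g μ) (hh : Integrable h μ) (f0 : ∀ x, 0 ≤ f x) (g0 : ∀ x, 0 ≤ g x) (h0 : ∀ x, 0 ≤ h x)
    (a b c : ℝ) (ha : 0 ≤ a) (hb : 0 ≤ b) (hc : 0 ≤ c) (habc : a + b + c = 1)
    (k : E → ℝ) (hk : Integrable k μ) (k0 : ∀ x, 0 ≤ k x) (hkk : ∀ x, k x ≤ f x ^ a * g x ^ b * h x ^ c) :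
    ∫ x, k x ∂μ ≤ (∫ x, f x ∂μ) ^ a * (∫ x, g x ∂μ) ^ b * (∫ x, h x ∂μ) ^ c := by
  have H := ENNReal.lintegral_prod_norm_pow_le (μ := μ) (Finset.univ : Finset (Fin 3))
    (f := ![fun x => ENNReal.ofReal (f x), fun x => ENNReal.ofReal (g x), fun x => ENNReal.ofReal (h x)])
    (p := ![a, b, c]) (by
      intro i _
      fin_cases i
      · exact hf.aemeasurable.ennreal_ofReal
      · exact hg.aemeasurable.ennreal_ofReal
      · exact hh.aemeasurable.ennreal_ofReal) (by simp [Fin.sum_univ_three, habc]) (by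
      intro i _; fin_cases i <;> simpa)
  simp only [Fin.prod_univ_three, Matrix.cons_val] at H
  have If : 0 ≤ ∫ x, f x ∂μ := integral_nonneg f0
  have Ig : 0 ≤ ∫ x, g x ∂μ := integral_nonneg g0
  have Ih : 0 ≤ ∫ x, h x ∂μ := integral_nonneg h0
  rw [← ofReal_integral_eq_lintegral_ofReal hf (Filter.Eventually.of_forall f0),
    ← ofReal_integral_eq_lintegral_ofReal hg (Filter.Eventually.of_forall g0),
    ← ofReal_integral_eq_lintegral_ofReal hh (Filter.Eventually.of_forall h0),
    ENNReal.ofReal_rpow_of_nonneg If ha, ENNReal.ofReal_rpow_of_nonneg Ig hb,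
    ENNReal.ofReal_rpow_of_nonneg Ih hc, ← ENNReal.ofReal_mul (by positivity), ← ENNReal.ofReal_mul (by positivity)] at H
  rw [← ENNReal.ofReal_le_ofReal_iff (by positivity), ofReal_integral_eq_lintegral_ofReal hk (Filter.Eventually.of_forall k0)]
  refine le_trans (lintegral_mono fun x => ?_) H
  have := f0 x; have := g0 x; have := h0 x
  dsimp only
  rw [ENNReal.ofReal_rpow_of_nonneg (f0 x) ha, ENNReal.ofReal_rpow_of_nonneg (g0 x) hb,
    ENNReal.ofReal_rpow_of_nonneg (h0 x) hc, ← ENNReal.ofReal_mul (by positivity), ← ENNReal.ofReal_mul (by positivity)]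
  exact ENNReal.ofReal_le_ofReal (hkk x)

lemma aux_div (N : ℕ) (w : EuclideanSpace ℝ (Fin N) → ℝ) (hwc : ContDiff ℝ 1 w)
    (hws : HasCompactSupport w) : Integrable (fun x => - fderiv ℝ w x x) ∧
    N * ∫ x, w x = ∫ x, - fderiv ℝ w x x := by
  have hdwc : Continuous (fderiv ℝ w) := hwc.continuous_fderiv (by norm_num)
  have hdws : HasCompactSupport (fderiv ℝ w) := hws.fderiv (𝕜 := ℝ)
  have hwi : Integrable w := hwc.continuous.integrable_of_hasCompactSupport hws
  have hcsi : ∀ v, HasCompactSupport (fun x => fderiv ℝ w x v) := fun v =>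
    hdws.comp_left (g := fun L : EuclideanSpace ℝ (Fin N) →L[ℝ] ℝ => L v) rfl
  have key : ∀ i : Fin N, ∫ x, w x = - ∫ x, fderiv ℝ w x (EuclideanSpace.single i 1) * x i := by
    intro i
    have hd : ∀ x : EuclideanSpace ℝ (Fin N), fderiv ℝ (fun x : EuclideanSpace ℝ (Fin N) => x i) x (EuclideanSpace.single i 1) = 1 := by
      intro x
      have : (fun x : EuclideanSpace ℝ (Fin N) => x i) = (EuclideanSpace.proj i : EuclideanSpace ℝ (Fin N) →L[ℝ] ℝ) := by
        ext; simp
      rw [this, ContinuousLinearMap.fderiv]; simp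
    have := integral_mul_fderiv_eq_neg_fderiv_mul_of_integrable (μ := volume) (f := w)
      (g := fun x : EuclideanSpace ℝ (Fin N) => x i) (v := EuclideanSpace.single i 1) ?_ ?_ ?_ ?_ ?_
    · simpa [hd] using this
    · apply Continuous.integrable_of_hasCompactSupport
      · fun_prop
      · exact (hcsi (EuclideanSpace.single i 1)).mul_right
    · simpa [hd] using hwi
    · apply Continuous.integrable_of_hasCompactSupport
      · exact hwc.continuous.mul (by fun_prop)
      · exact hws.mul_right
    · exact fun x _ => (hwc.differentiable (by norm_num)) x
    · intro x _; fun_prop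
  have hint : ∀ i : Fin N, Integrable (fun x : EuclideanSpace ℝ (Fin N) => fderiv ℝ w x (EuclideanSpace.single i 1) * x i) := by
    intro i
    apply Continuous.integrable_of_hasCompactSupport
    · fun_prop
    · exact (hcsi (EuclideanSpace.single i 1)).mul_right
  have hsum : ∀ x : EuclideanSpace ℝ (Fin N), ∑ i, fderiv ℝ w x (EuclideanSpace.single i 1) * x i = fderiv ℝ w x x := by
    intro x
    have hx : x = ∑ i, x i • EuclideanSpace.single i (1:ℝ) := by
      ext j; simp [Finset.sum_apply, Pi.single_apply]
    conv_rhs => rw [show fderiv ℝ w x x = fderiv ℝ w x (∑ i, x i • EuclideanSpace.single i (1:ℝ)) from congrArg _ hx]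
    rw [map_sum]
    refine Finset.sum_congr rfl fun i _ => ?_
    simp [mul_comm]
  refine ⟨?_, ?_⟩
  · have := (integrable_finsetSum Finset.univ (fun i _ => hint i)).neg
    refine this.congr (Filter.Eventually.of_forall fun x => ?_)
    simp [hsum]
  have hNw : N * ∫ x, w x = ∫ x, - fderiv ℝ w x x := by
    have : ∑ i : Fin N, ∫ x, w x = ∑ i : Fin N, - ∫ x, fderiv ℝ w x (EuclideanSpace.single i 1) * x i :=
      Finset.sum_congr rfl fun i _ => key i
    rw [Finset.sum_neg_distrib, ← integral_finsetSum _ (fun i _ => hint i)] at this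
    simp only [hsum] at this
    rw [integral_neg, ← this]; simp
  exact hNw


lemma aux_hardy (N : ℕ) (hN : 3 ≤ N) (u : EuclideanSpace ℝ (Fin N) → ℝ)
    (hu : ContDiff ℝ (⊤ : ℕ∞) u) (hc : HasCompactSupport u) :
    ∫ x, (u x) ^ 2 * (1 + ‖x‖ ^ 2)⁻¹ ≤ 4 * ∫ x, ‖fderiv ℝ u x‖ ^ 2 := by
  have hN' : (3:ℝ) ≤ N := by exact_mod_cast hN
  have hu1 : ContDiff ℝ 1 u := hu.of_le (by exact_mod_cast le_top)
  have hcf : HasCompactSupport (fderiv ℝ u) := hc.fderiv (𝕜 := ℝ)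
  have hcontf : Continuous (fderiv ℝ u) := hu1.continuous_fderiv (by norm_num)
  have i2 : Integrable (fun x => ‖fderiv ℝ u x‖ ^ 2) := by
    apply Continuous.integrable_of_hasCompactSupport
    · fun_prop
    · exact hcf.comp_left (g := fun t => ‖t‖ ^ 2) (by simp)
  set w : EuclideanSpace ℝ (Fin N) → ℝ := fun x => (u x) ^ 2 * (1 + ‖x‖ ^ 2)⁻¹ with hw
  have hpos : ∀ x : EuclideanSpace ℝ (Fin N), (1 + ‖x‖ ^ 2) ≠ 0 := fun x => by positivity
  have hwc : ContDiff ℝ 1 w := by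
    apply (hu1.pow 2).mul
    exact (contDiff_const.add (contDiff_norm_sq ℝ)).inv hpos
  have hws : HasCompactSupport w := by
    have : HasCompactSupport (fun x => (u x)^2) := hc.comp_left (g := fun t => t^2) (by simp)
    exact this.mul_right
  have hwi : Integrable w := hwc.continuous.integrable_of_hasCompactSupport hws
  obtain ⟨hdi, hNw⟩ := aux_div N w hwc hws
  have hpt : ∀ x, - fderiv ℝ w x x ≤ (5/2) * w x + 2 * ‖fderiv ℝ u x‖ ^ 2 := by
    intro x
    have h1 : HasFDerivAt u (fderiv ℝ u x) x := (hu1.differentiable (by norm_num) x).hasFDerivAt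
    have h2 : HasFDerivAt (fun y : EuclideanSpace ℝ (Fin N) => 1 + ‖y‖ ^ 2) (2 • innerSL ℝ x) x :=
      ((hasStrictFDerivAt_norm_sq x).hasFDerivAt).const_add 1
    have h3 := (h1.pow 2).mul ((hasDerivAt_inv (hpos x)).comp_hasFDerivAt x h2)
    have h4 : fderiv ℝ w x x = 2 * u x * fderiv ℝ u x x * (1 + ‖x‖ ^ 2)⁻¹ - 2 * (u x)^2 * ‖x‖^2 * ((1 + ‖x‖ ^ 2)⁻¹)^2 := by
      rw [show fderiv ℝ w x = _ from h3.fderiv]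
      simp
      ring
    rw [h4, hw]
    dsimp only
    set r := ‖x‖ with hr
    set s := (1 + r^2)⁻¹ with hs
    have hs0 : 0 < s := by positivity
    have hs1 : s * (1 + r^2) = 1 := inv_mul_cancel₀ (hpos x)
    set d := fderiv ℝ u x x with hd
    set g := ‖fderiv ℝ u x‖ with hg
    have hdg : |d| ≤ g * r := (fderiv ℝ u x).le_opNorm x
    have hd2 : d^2 ≤ g^2 * r^2 := by rw [← mul_pow, ← sq_abs d]; gcongr
    have e1 : r^2 * s = 1 - s := by linarith
    have h5 : s^2 * d^2 ≤ s * g^2 := by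
      calc s^2 * d^2 ≤ s^2 * (g^2 * r^2) := by gcongr
        _ = s * g^2 * (r^2 * s) := by ring
        _ ≤ s * g^2 * 1 := by gcongr; linarith
        _ = s * g^2 := by ring
    have h6 : -(2 * u x * d * s) ≤ 1/2 * (u x ^2 * s) + 2 * g^2 := by
      have h7 : -(2 * u x * d * s) ≤ s * (1/2 * u x^2 + 2 * d^2) := by
        nlinarith [mul_nonneg hs0.le (sq_nonneg (u x + 2 * d))]
      have h8 : s * d^2 ≤ g^2 := by
        have : s * (s * d^2) ≤ s * g^2 := by linarith
        exact le_of_mul_le_mul_left this hs0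
      nlinarith
    have h9 : 2 * u x^2 * r^2 * s^2 ≤ 2 * (u x^2 * s) := by
      calc 2 * u x^2 * r^2 * s^2 = 2 * (u x^2 * s) * (r^2 * s) := by ring
        _ ≤ 2 * (u x^2 * s) * 1 := by gcongr; linarith
        _ = _ := by ring
    linarith
  have hle : ∫ x, - fderiv ℝ w x x ≤ ∫ x, ((5/2) * w x + 2 * ‖fderiv ℝ u x‖ ^ 2) := by
    exact integral_mono hdi ((hwi.const_mul _).add (i2.const_mul _)) hpt
  rw [← hNw, integral_add (hwi.const_mul _) (i2.const_mul _), integral_const_mul, integral_const_mul] at hle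
  have hw0 : 0 ≤ ∫ x, w x := integral_nonneg fun x => by rw [hw]; positivity
  nlinarith

lemma aux_weight (α r : ℝ) (hα : 0 < α) (hr : 0 ≤ r) :
    (1 + r ^ α)⁻¹ ≤ 2 ^ α * (1 + r) ^ (-α) := by
  have h : (1 + r) ^ α ≤ 2 ^ α * (1 + r ^ α) := by
    have hrα : 0 ≤ r ^ α := by positivity
    have h2 : (0:ℝ) < 2 ^ α := by positivity
    rcases le_total r 1 with h | h
    · calc (1 + r) ^ α ≤ 2 ^ α := by apply Real.rpow_le_rpow <;> linarith
        _ ≤ _ := by nlinarith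
    · calc (1 + r) ^ α ≤ (2 * r) ^ α := by apply Real.rpow_le_rpow <;> linarith
        _ = 2 ^ α * r ^ α := Real.mul_rpow (by norm_num) hr
        _ ≤ _ := by nlinarith
  rw [Real.rpow_neg (by positivity), ← div_eq_mul_inv, le_div_iff₀ (by positivity), inv_mul_le_iff₀ (by positivity)]
  linarith

lemma aux_pointwise (n α a b c p t r : ℝ) (hα : 0 < α) (ha : 0 ≤ a) (hc1 : c ≤ 1)
    (ht : 0 < t) (hr : 0 ≤ r) (e1 : 2 * a + p * b + c = 2) (e2 : 2 * a + (n - 2) * c = α * (1 - c)) :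
    t ^ 2 * (1 + r ^ α)⁻¹ ≤ (2 ^ α) ^ (1 - c) *
      ((t ^ 2 * (1 + r ^ 2)⁻¹) ^ a * (t ^ p) ^ b * (t * (1 + r) ^ (2 - n) * (1 + r ^ α)⁻¹) ^ c) := by
  have hm : 0 < 1 + r := by linarith
  have hW0 : 0 < (1 + r ^ α)⁻¹ := by positivity
  have hW := aux_weight α r hα hr
  set W := (1 + r ^ α)⁻¹
  have h1 : W ^ (1 - c) ≤ (2 ^ α) ^ (1 - c) * ((1 + r) ^ (-(2 * a)) * (1 + r) ^ ((2 - n) * c)) := by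
    calc W ^ (1 - c) ≤ (2 ^ α * (1 + r) ^ (-α)) ^ (1 - c) := by
          apply Real.rpow_le_rpow hW0.le hW; linarith
      _ = (2 ^ α) ^ (1 - c) * (1 + r) ^ (-α * (1 - c)) := by
          rw [Real.mul_rpow (by positivity) (by positivity), ← Real.rpow_mul hm.le]
      _ = _ := by
          rw [← Real.rpow_add hm]; congr 2; linarith
  have h2 : (1 + r) ^ (-(2 * a)) ≤ ((1 + r ^ 2)⁻¹) ^ a := by
    rw [Real.rpow_neg hm.le, Real.rpow_mul hm.le, Real.inv_rpow (by positivity)]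
    apply inv_anti₀ (by positivity)
    apply Real.rpow_le_rpow (by positivity) _ ha
    norm_num; nlinarith
  have hWW : W = W ^ (1 - c) * W ^ c := by rw [← Real.rpow_add hW0]; simp
  have htt : t ^ 2 = t ^ (2 * a) * t ^ (p * b) * t ^ c := by
    rw [← Real.rpow_add ht, ← Real.rpow_add ht, e1]; norm_num
  have hta : (t ^ 2) ^ a = t ^ (2 * a) := by rw [Real.rpow_mul ht.le]; norm_num
  rw [Real.mul_rpow (by positivity) (by positivity), Real.mul_rpow (by positivity) (by positivity),
    Real.mul_rpow (by positivity) (by positivity), hta, ← Real.rpow_mul ht.le p b, ← Real.rpow_mul hm.le]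
  calc t ^ 2 * W = (t ^ (2 * a) * t ^ (p * b) * t ^ c * W ^ c) * W ^ (1 - c) := by
        rw [htt]; nth_rewrite 1 [hWW]; ring
    _ ≤ (t ^ (2 * a) * t ^ (p * b) * t ^ c * W ^ c) *
        ((2 ^ α) ^ (1 - c) * (((1 + r ^ 2)⁻¹) ^ a * (1 + r) ^ ((2 - n) * c))) := by
        gcongr
        refine h1.trans ?_
        gcongr
    _ = _ := by ring

/-- Weighted Nash inequality with weight `(1+|x|)^{2-N}` and rate exponent
`θ = 2(N+α-4)/(α-2)` for the measure `dμ = (1+|x|^α)^{-1} dx`, valid for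
`2 < α ≤ 4` and `N ≥ 3`.  Here the Dirichlet form of `L + I` appears. -/
theorem weighted_nash_two_lt_alpha_le_four (N : ℕ) (hN : 3 ≤ N) (α : ℝ)
    (hα : 2 < α) (hα' : α ≤ 4) (θ : ℝ) (hθ : θ = 2 * ((N : ℝ) + α - 4) / (α - 2)) :
    ∃ C : ℝ, 0 < C ∧ ∀ u : EuclideanSpace ℝ (Fin N) → ℝ,
      ContDiff ℝ (⊤ : ℕ∞) u → HasCompactSupport u →
      (∫ x : EuclideanSpace ℝ (Fin N), (u x) ^ 2 * (1 + ‖x‖ ^ α)⁻¹) ^ (1 + 2 / θ) ≤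
        C * ((∫ x : EuclideanSpace ℝ (Fin N), ‖fderiv ℝ u x‖ ^ 2) +
              (∫ x : EuclideanSpace ℝ (Fin N), (u x) ^ 2 * (1 + ‖x‖ ^ α)⁻¹)) *
          (∫ x : EuclideanSpace ℝ (Fin N),
            |u x| * (1 + ‖x‖) ^ (2 - (N : ℝ)) * (1 + ‖x‖ ^ α)⁻¹) ^ (4 / θ) := by
  have hN' : (3:ℝ) ≤ N := by exact_mod_cast hN
  obtain ⟨n, hn⟩ : ∃ n : ℝ, n = N := ⟨_, rfl⟩
  obtain ⟨CS, hCS, hS⟩ := aux_sobolev N hN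
  simp only [← hn] at *
  have hn2 : 0 < n - 2 := by linarith
  have hα2 : 0 < α - 2 := by linarith
  have hK : 0 < n + 2 * α - 6 := by linarith
  have hJ : 0 < n + α - 4 := by linarith
  have hθ0 : 0 < θ := by rw [hθ]; positivity
  obtain ⟨a, ha⟩ : ∃ a, a = (4 - α) * (n - 2) / (2 * (n + 2 * α - 6)) := ⟨_, rfl⟩
  obtain ⟨b, hb⟩ : ∃ b, b = (n - 2) * (α - 2) / (2 * (n + 2 * α - 6)) := ⟨_, rfl⟩
  obtain ⟨c, hc⟩ : ∃ c, c = 2 * (α - 2) / (n + 2 * α - 6) := ⟨_, rfl⟩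
  obtain ⟨p, hp⟩ : ∃ p, p = 2 * n / (n - 2) := ⟨_, rfl⟩
  have ha0 : 0 ≤ a := by
    rw [ha]; apply div_nonneg _ (by positivity); apply mul_nonneg <;> linarith
  have hb0 : 0 ≤ b := by rw [hb]; positivity
  have hc0 : 0 ≤ c := by rw [hc]; positivity
  have hp0 : 0 < p := by rw [hp]; apply div_pos <;> linarith
  have habc : a + b + c = 1 := by
    rw [ha, hb, hc, ← add_div, div_add_div _ _ (by positivity) hK.ne', div_eq_one_iff_eq (by positivity)]; ring
  have hpb : p * b = n * (α - 2) / (n + 2 * α - 6) := by rw [hb, hp]; field_simp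
  have e1 : 2 * a + p * b + c = 2 := by
    rw [hpb, ha, hc]; field_simp; ring
  have e2 : 2 * a + (n - 2) * c = α * (1 - c) := by rw [ha, hc]; field_simp; ring
  have e3 : (a + n / (n - 2) * b) * (1 + 2 / θ) = 1 := by
    have h1 : a + n / (n - 2) * b = (n + α - 4) / (n + 2 * α - 6) := by
      rw [show n / (n - 2) * b = p * b / 2 by rw [hp]; ring, hpb, ha]; field_simp; ring
    have h2 : 1 + 2 / θ = (n + 2 * α - 6) / (n + α - 4) := by
      rw [hθ, eq_div_iff hJ.ne']; field_simp; ring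
    rw [h1, h2, div_mul_div_comm, mul_comm, div_self (by positivity)]
  have e4 : c * (1 + 2 / θ) = 4 / θ := by rw [hc, hθ]; field_simp; ring
  have hc1 : c ≤ 1 := by linarith
  obtain ⟨κ, hκ⟩ : ∃ κ : ℝ, κ = (2 ^ α) ^ (1 - c) := ⟨_, rfl⟩
  have hκ0 : 0 < κ := by rw [hκ]; positivity
  obtain ⟨Q, hQ⟩ : ∃ Q : ℝ, Q = κ * (4 ^ a * CS ^ b) := ⟨_, rfl⟩
  have hQ0 : 0 < Q := by rw [hQ]; positivity
  refine ⟨Q ^ (1 + 2 / θ), by positivity, fun u hu hcs => ?_⟩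
  have hH := aux_hardy N hN u hu hcs
  have hS := hS u hu hcs
  rw [← hp] at hS
  have huc : Continuous u := hu.continuous
  have hWc : Continuous (fun x : EuclideanSpace ℝ (Fin N) => (1 + ‖x‖ ^ α)⁻¹) := by
    apply Continuous.inv₀
    · exact continuous_const.add (continuous_norm.rpow_const fun x => Or.inr (by linarith))
    · intro x; positivity
  have husq : HasCompactSupport (fun x => (u x)^2) := hcs.comp_left (g := fun t => t^2) (by simp)
  have if' : Integrable (fun x : EuclideanSpace ℝ (Fin N) => (u x) ^ 2 * (1 + ‖x‖ ^ 2)⁻¹) := by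
    apply Continuous.integrable_of_hasCompactSupport _ husq.mul_right
    apply (huc.pow 2).mul
    apply Continuous.inv₀ (by fun_prop)
    intro x; positivity
  have ig' : Integrable (fun x : EuclideanSpace ℝ (Fin N) => |u x| ^ p) := by
    apply Continuous.integrable_of_hasCompactSupport
    · exact (huc.abs).rpow_const (fun x => Or.inr hp0.le)
    · exact hcs.comp_left (g := fun t => |t| ^ p) (by simp [hp0.ne'])
  have ih' : Integrable (fun x : EuclideanSpace ℝ (Fin N) =>
      |u x| * (1 + ‖x‖) ^ (2 - n) * (1 + ‖x‖ ^ α)⁻¹) := by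
    apply Continuous.integrable_of_hasCompactSupport
    · refine (huc.abs.mul ?_).mul hWc
      refine Continuous.rpow_const (by fun_prop) fun x => Or.inl ?_
      positivity
    · exact HasCompactSupport.mul_right (HasCompactSupport.mul_right
        (hcs.comp_left (g := fun t => |t|) (by simp)))
  have ik' : Integrable (fun x : EuclideanSpace ℝ (Fin N) => (u x) ^ 2 * (1 + ‖x‖ ^ α)⁻¹) :=
    ((huc.pow 2).mul hWc).integrable_of_hasCompactSupport husq.mul_right
  have main := aux_holder volume _ _ _ if' ig' ih' (fun x => by positivity) (fun x => by positivity)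
    (fun x => by positivity) a b c ha0 hb0 hc0 habc _ (ik'.const_mul κ⁻¹) (fun x => by positivity) (by
      intro x
      rw [inv_mul_le_iff₀ hκ0, hκ]
      by_cases h0 : u x = 0
      · simp only [h0]
        rw [zero_pow two_ne_zero, zero_mul]
        positivity
      · have := aux_pointwise n α a b c p |u x| ‖x‖ (by linarith) ha0 hc1 (abs_pos.2 h0) (norm_nonneg x) e1 e2
        rw [sq_abs] at this
        exact this)
  rw [integral_const_mul, inv_mul_le_iff₀ hκ0] at main
  have D0 : 0 ≤ ∫ x : EuclideanSpace ℝ (Fin N), ‖fderiv ℝ u x‖ ^ 2 := integral_nonneg fun x => by positivity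
  have M0 : 0 ≤ ∫ x : EuclideanSpace ℝ (Fin N), (u x) ^ 2 * (1 + ‖x‖ ^ α)⁻¹ := integral_nonneg fun x => by positivity
  have L0 : 0 ≤ ∫ x : EuclideanSpace ℝ (Fin N), |u x| * (1 + ‖x‖) ^ (2 - n) * (1 + ‖x‖ ^ α)⁻¹ :=
    integral_nonneg fun x => by positivity
  have H0 : 0 ≤ ∫ x : EuclideanSpace ℝ (Fin N), (u x) ^ 2 * (1 + ‖x‖ ^ 2)⁻¹ := integral_nonneg fun x => by positivity
  have S0 : 0 ≤ ∫ x : EuclideanSpace ℝ (Fin N), |u x| ^ p := integral_nonneg fun x => by positivity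
  generalize (∫ x : EuclideanSpace ℝ (Fin N), ‖fderiv ℝ u x‖ ^ 2) = D at *
  generalize (∫ x : EuclideanSpace ℝ (Fin N), (u x) ^ 2 * (1 + ‖x‖ ^ α)⁻¹) = M at *
  generalize (∫ x : EuclideanSpace ℝ (Fin N), |u x| * (1 + ‖x‖) ^ (2 - n) * (1 + ‖x‖ ^ α)⁻¹) = L at *
  generalize (∫ x : EuclideanSpace ℝ (Fin N), (u x) ^ 2 * (1 + ‖x‖ ^ 2)⁻¹) = H at *
  generalize (∫ x : EuclideanSpace ℝ (Fin N), |u x| ^ p) = S at *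
  have hnb : 0 ≤ n / (n - 2) * b := by
    apply mul_nonneg _ hb0
    apply div_nonneg <;> linarith
  have hM : M ≤ Q * (D ^ (a + n / (n - 2) * b) * L ^ c) := by
    calc M ≤ κ * (H ^ a * S ^ b * L ^ c) := main
      _ ≤ κ * ((4 * D) ^ a * (CS * D ^ (n / (n - 2))) ^ b * L ^ c) := by gcongr
      _ = _ := by
        rw [Real.mul_rpow (by norm_num) D0, Real.mul_rpow hCS.le (by positivity),
          ← Real.rpow_mul D0, Real.rpow_add_of_nonneg D0 ha0 hnb, hQ]
        ring
  calc M ^ (1 + 2 / θ) ≤ (Q * (D ^ (a + n / (n - 2) * b) * L ^ c)) ^ (1 + 2 / θ) := by gcongr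
    _ = Q ^ (1 + 2 / θ) * D * L ^ (4 / θ) := by
      rw [Real.mul_rpow hQ0.le (by positivity), Real.mul_rpow (by positivity) (by positivity),
        ← Real.rpow_mul D0, ← Real.rpow_mul L0, e3, e4, Real.rpow_one]
      ring
    _ ≤ Q ^ (1 + 2 / θ) * (D + M) * L ^ (4 / θ) := by
      gcongr
      linarith
end

section
/- Let $N \ge 3$, $\alpha > 2$ and $\beta > 0$. Suppose there exists a constant $C > 0$ such that for every $u \in C_c^\infty(\mathbb{R}^N)$, $\left(\int_{\mathbb{R}^N} |u|^2 \, d\mu\right)^{1+\frac{1}{\beta}} \le C \left(\int_{\mathbb{R}^N} |\nabla u|^2 \, dx\right) \left(\int_{\mathbb{R}^N} |u|\,(1+|x|)^{2-N} \, d\mu\right)^{\frac{2}{\beta}}$. Then $\beta \ge \frac{N+\alpha-4}{\alpha-2}$. -/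
open MeasureTheory

lemma nash_scaled (N : ℕ) (hN : 3 ≤ N) (α : ℝ) (hα : 2 < α)
    (φ : EuclideanSpace ℝ (Fin N) → ℝ) (hc : Continuous φ) (hs : HasCompactSupport φ)
    (hlow : ∀ y, φ y ≠ 0 → 1 ≤ ‖y‖) (hup : ∀ y, φ y ≠ 0 → ‖y‖ ≤ 3) (R : ℝ) (hR : 1 ≤ R) :
    R ^ ((N : ℝ) - α) * ((∫ y, φ y ^ 2) * (1 + 3 ^ α)⁻¹) ≤
      ∫ x : EuclideanSpace ℝ (Fin N), (φ (R⁻¹ • x)) ^ 2 * (1 + ‖x‖ ^ α)⁻¹ ∧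
    ∫ x : EuclideanSpace ℝ (Fin N), ‖fderiv ℝ (fun x => φ (R⁻¹ • x)) x‖ ^ 2
      = R ^ ((N : ℝ) - 2) * ∫ y, ‖fderiv ℝ φ y‖ ^ 2 ∧
    ∫ x : EuclideanSpace ℝ (Fin N), |φ (R⁻¹ • x)| * (1 + ‖x‖) ^ (2 - (N : ℝ)) * (1 + ‖x‖ ^ α)⁻¹
      ≤ R ^ (2 - α) * ∫ y, |φ y| := by
  have hR0 : 0 < R := by linarith
  have hN' : (3 : ℝ) ≤ N := by exact_mod_cast hN
  have key : ∀ g : EuclideanSpace ℝ (Fin N) → ℝ,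
      ∫ x, g x = R ^ (N : ℝ) * ∫ y, g (R • y) := by
    intro g
    have := Measure.integral_comp_inv_smul (volume : Measure (EuclideanSpace ℝ (Fin N)))
      (fun y => g (R • y)) R
    simp only [smul_inv_smul₀ hR0.ne', finrank_euclideanSpace, Fintype.card_fin, smul_eq_mul] at this
    rw [this, abs_of_pos (by positivity), Real.rpow_natCast]
  have hnorm : ∀ y : EuclideanSpace ℝ (Fin N), ‖R • y‖ = R * ‖y‖ := by
    intro y; rw [norm_smul, Real.norm_of_nonneg hR0.le]
  have hRα : 1 ≤ R ^ α := Real.one_le_rpow hR (by linarith)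
  refine ⟨?_, ?_, ?_⟩
  · rw [key (fun x => (φ (R⁻¹ • x)) ^ 2 * (1 + ‖x‖ ^ α)⁻¹), Real.rpow_sub hR0, div_eq_mul_inv,
      mul_assoc]
    refine mul_le_mul_of_nonneg_left ?_ (by positivity)
    rw [← integral_mul_const, ← integral_const_mul]
    simp only [inv_smul_smul₀ hR0.ne', hnorm]
    have hs2 : HasCompactSupport (fun y => φ y ^ 2) := by
      have := hs.mul_right (f' := φ)
      simpa [pow_two, Pi.mul_def] using this
    refine integral_mono ?_ ?_ ?_
    · exact ((((hc.pow 2).integrable_of_hasCompactSupport hs2).mul_const _).const_mul _)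
    · refine Continuous.integrable_of_hasCompactSupport ?_ hs2.mul_right
      refine (hc.pow 2).mul (Continuous.inv₀ ?_ ?_)
      · exact continuous_const.add ((continuous_const.mul continuous_norm).rpow_const
          (fun _ => Or.inr (by linarith)))
      · intro x; positivity
    · intro y
      simp only
      by_cases h : φ y = 0
      · simp [h]
      have h3 := hup y h
      rw [mul_left_comm, ← mul_inv]
      refine mul_le_mul_of_nonneg_left ?_ (by positivity)
      refine inv_anti₀ (by positivity) ?_
      rw [Real.mul_rpow hR0.le (norm_nonneg _)]
      have : ‖y‖ ^ α ≤ 3 ^ α := Real.rpow_le_rpow (norm_nonneg _) h3 (by linarith)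
      nlinarith
  · rw [key, Real.rpow_sub hR0, div_eq_mul_inv, mul_assoc]
    congr 1
    rw [← integral_const_mul]
    refine integral_congr_ae (Filter.Eventually.of_forall fun y => ?_)
    simp only
    have : fderiv ℝ (fun x => φ (R⁻¹ • x)) (R • y) = R⁻¹ • fderiv ℝ φ y := by
      rw [fderiv_comp_smul, inv_smul_smul₀ hR0.ne']
    rw [this, norm_smul, mul_pow, Real.norm_of_nonneg (by positivity)]
    norm_num
  · rw [key]
    have e : R ^ (2 - α) = R ^ (N : ℝ) * (R ^ (2 - (N : ℝ)) * (R ^ α)⁻¹) := by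
      rw [← Real.rpow_neg hR0.le, ← Real.rpow_add hR0, ← Real.rpow_add hR0]; congr 1; ring
    rw [e, mul_assoc]
    refine mul_le_mul_of_nonneg_left ?_ (by positivity)
    rw [← integral_const_mul]
    simp only [inv_smul_smul₀ hR0.ne', hnorm]
    refine integral_mono_of_nonneg (Filter.Eventually.of_forall fun y => by positivity)
      ((hc.abs.integrable_of_hasCompactSupport hs.norm).const_mul _)
      (Filter.Eventually.of_forall fun y => ?_)
    simp only
    by_cases h : φ y = 0
    · simp [h]
    have h1 := hlow y h
    rw [mul_assoc, mul_comm]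
    refine mul_le_mul_of_nonneg_right ?_ (abs_nonneg _)
    refine mul_le_mul ?_ ?_ (by positivity) (by positivity)
    · exact Real.rpow_le_rpow_of_nonpos hR0 (by nlinarith) (by linarith)
    · refine inv_anti₀ (by positivity) ?_
      have : R ^ α ≤ (R * ‖y‖) ^ α := Real.rpow_le_rpow hR0.le (by nlinarith) (by linarith)
      linarith

/-- Optimality of the time exponent: if a weighted Nash inequality with weight
`(1+|x|)^{2-N}` and exponent `β` holds for the measure `dμ = (1+|x|^α)^{-1} dx`
with `α > 2`, then necessarily `β ≥ (N+α-4)/(α-2)`. -/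
theorem nash_exponent_optimal (N : ℕ) (hN : 3 ≤ N) (α : ℝ) (hα : 2 < α)
    (β : ℝ) (hβ : 0 < β)
    (H : ∃ C : ℝ, 0 < C ∧ ∀ u : EuclideanSpace ℝ (Fin N) → ℝ,
      ContDiff ℝ (⊤ : ℕ∞) u → HasCompactSupport u →
      (∫ x : EuclideanSpace ℝ (Fin N), (u x) ^ 2 * (1 + ‖x‖ ^ α)⁻¹) ^ (1 + 1 / β) ≤
        C * (∫ x : EuclideanSpace ℝ (Fin N), ‖fderiv ℝ u x‖ ^ 2) *
          (∫ x : EuclideanSpace ℝ (Fin N),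
            |u x| * (1 + ‖x‖) ^ (2 - (N : ℝ)) * (1 + ‖x‖ ^ α)⁻¹) ^ (2 / β)) :
    ((N : ℝ) + α - 4) / (α - 2) ≤ β := by
  obtain ⟨C, hC, H⟩ := H
  let c : EuclideanSpace ℝ (Fin N) := EuclideanSpace.single ⟨0, by omega⟩ 2
  have hcn : ‖c‖ = 2 := by simp [c]
  let φ : ContDiffBump c := ⟨1 / 2, 1, by norm_num, by norm_num⟩
  have hsup : ∀ y, φ y ≠ 0 → ‖y - c‖ < 1 := by
    intro y hy
    have : y ∈ Function.support φ := hy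
    rw [φ.support_eq] at this
    simpa [φ, dist_eq_norm] using this
  have hlow : ∀ y, φ y ≠ 0 → 1 ≤ ‖y‖ := by
    intro y hy
    have h1 := hsup y hy
    have h2 := norm_sub_norm_le c y
    rw [norm_sub_rev] at h2
    linarith
  have hup : ∀ y, φ y ≠ 0 → ‖y‖ ≤ 3 := by
    intro y hy
    have h1 := hsup y hy
    have h2 := norm_sub_norm_le y c
    linarith
  have hφ2 : 0 < ∫ y, φ y ^ 2 := by
    refine Continuous.integral_pos_of_hasCompactSupport_nonneg_nonzero (x := c)
      (φ.continuous.pow 2) ?_ (fun y => by positivity) ?_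
    · have := φ.hasCompactSupport.mul_right (f' := φ)
      simpa [pow_two, Pi.mul_def] using this
    · have : φ c = 1 := φ.one_of_mem_closedBall (by simp [φ])
      simp [this]
  set A := (∫ y, φ y ^ 2) * (1 + 3 ^ α)⁻¹ with hA
  have hA0 : 0 < A := by positivity
  set B := ∫ y, ‖fderiv ℝ φ y‖ ^ 2 with hB
  have hB0 : 0 ≤ B := integral_nonneg fun y => by positivity
  set D := ∫ y, |φ y| with hD
  have hD0 : 0 ≤ D := integral_nonneg fun y => by positivity
  set p := ((N : ℝ) - α) * (1 + 1 / β) with hp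
  set q := ((N : ℝ) - 2) + (2 - α) * (2 / β) with hq
  have main : ∀ R : ℝ, 1 ≤ R → R ^ (p - q) * A ^ (1 + 1 / β) ≤ C * B * D ^ (2 / β) := by
    intro R hR
    have hR0 : 0 < R := by linarith
    obtain ⟨h1, h2, h3⟩ := nash_scaled N hN α hα φ φ.continuous φ.hasCompactSupport hlow hup R hR
    have h := H (fun x => φ (R⁻¹ • x)) (φ.contDiff.comp (contDiff_const_smul _))
      (φ.hasCompactSupport.comp_smul (inv_ne_zero hR0.ne'))
    rw [h2] at h
    have e1 := Real.rpow_le_rpow (z := 1 + 1 / β) (by positivity) h1 (by positivity)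
    have e3 := Real.rpow_le_rpow (z := 2 / β)
      (integral_nonneg fun x => by positivity) h3 (by positivity)
    have e4 := mul_le_mul_of_nonneg_left e3
      (show 0 ≤ C * (R ^ ((N : ℝ) - 2) * B) by positivity)
    have e5 := e1.trans (h.trans e4)
    rw [Real.mul_rpow (by positivity) hA0.le, Real.mul_rpow (by positivity) hD0,
      ← Real.rpow_mul hR0.le, ← Real.rpow_mul hR0.le, ← hp] at e5
    have e6 : C * (R ^ ((N : ℝ) - 2) * B) * (R ^ ((2 - α) * (2 / β)) * D ^ (2 / β))
        = R ^ q * (C * B * D ^ (2 / β)) := by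
      rw [hq, Real.rpow_add hR0]; ring
    rw [e6] at e5
    rw [Real.rpow_sub hR0, div_mul_eq_mul_div, div_le_iff₀ (by positivity)]
    linarith
  have hpq : p - q ≤ 0 := by
    by_contra! hpos
    have ht := (tendsto_rpow_atTop hpos).atTop_mul_const
      (show 0 < A ^ (1 + 1 / β) by positivity)
    obtain ⟨R, hR1, hR2⟩ := ((ht.eventually_gt_atTop (C * B * D ^ (2 / β))).and
      (Filter.eventually_ge_atTop 1)).exists
    exact absurd (main R hR2) (not_le.mpr hR1)
  have e : p - q = (((N : ℝ) + α - 4) - β * (α - 2)) / β := by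
    rw [hp, hq]; field_simp; ring
  rw [e, div_le_iff₀ hβ] at hpq
  rw [div_le_iff₀ (by linarith)]
  linarith
end

section
/- Let $N \ge 3$ and $0 < \alpha \le 4$. Define $V(x) = (1+|x|^{\alpha})^{\frac{2-N}{4}}$ for $x \in \mathbb{R}^N$. Then for every $x \in \mathbb{R}^N$ with $x \ne 0$, $\Delta V(x) \le 0$. -/
open MeasureTheory

/-- The Laplacian `Δ f = ∑ i ∂²f/∂xᵢ²` of a function on `ℝ^N`. -/
noncomputable def laplacian {N : ℕ} (f : EuclideanSpace ℝ (Fin N) → ℝ)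
    (x : EuclideanSpace ℝ (Fin N)) : ℝ :=
  ∑ i : Fin N,
    fderiv ℝ (fun y => fderiv ℝ f y (EuclideanSpace.single i 1)) x (EuclideanSpace.single i 1)

theorem laplacian_radial {N : ℕ} (f : EuclideanSpace ℝ (Fin N) → ℝ) (g g1 : ℝ → ℝ) (g2 : ℝ)
    (hf : ∀ y, f y = g (‖y‖ ^ 2))
    (hg : ∀ s, 0 < s → HasDerivAt g (g1 s) s) (x : EuclideanSpace ℝ (Fin N)) (hx : x ≠ 0)
    (hg1 : HasDerivAt g1 g2 (‖x‖ ^ 2)) :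
    laplacian f x = 2 * N * g1 (‖x‖ ^ 2) + 4 * ‖x‖ ^ 2 * g2 := by
  have hsq : ∀ y : EuclideanSpace ℝ (Fin N),
      HasFDerivAt (fun y : EuclideanSpace ℝ (Fin N) => ‖y‖ ^ 2) (2 • innerSL ℝ y) y :=
    fun y => (hasStrictFDerivAt_norm_sq y).hasFDerivAt
  have hff : f = fun y => g (‖y‖ ^ 2) := funext hf
  have h1 : ∀ i : Fin N, ∀ y : EuclideanSpace ℝ (Fin N), y ≠ 0 →
      fderiv ℝ f y (EuclideanSpace.single i 1) = g1 (‖y‖ ^ 2) * (2 * y i) := by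
    intro i y hy
    have h := (hg (‖y‖ ^ 2) (by positivity)).comp_hasFDerivAt y (hsq y)
    have h' : fderiv ℝ f y = g1 (‖y‖ ^ 2) • 2 • (innerSL ℝ) y := by
      rw [hff]; exact h.fderiv
    rw [h']
    simp [EuclideanSpace.inner_single_right]
  have h2 : ∀ i : Fin N,
      fderiv ℝ (fun y => fderiv ℝ f y (EuclideanSpace.single i 1)) x (EuclideanSpace.single i 1)
        = 2 * g1 (‖x‖ ^ 2) + 4 * g2 * (x i) ^ 2 := by
    intro i
    have he : (fun y => fderiv ℝ f y (EuclideanSpace.single i 1)) =ᶠ[nhds x]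
        fun y => g1 (‖y‖ ^ 2) * (2 * y i) := by
      filter_upwards [isOpen_ne.mem_nhds hx] with y hy using h1 i y hy
    rw [he.fderiv_eq]
    have ha := hg1.comp_hasFDerivAt x (hsq x)
    have hb : HasFDerivAt (fun y : EuclideanSpace ℝ (Fin N) => 2 * y i)
        ((2 : ℝ) • (EuclideanSpace.proj i : EuclideanSpace ℝ (Fin N) →L[ℝ] ℝ)) x :=
      (EuclideanSpace.proj i : EuclideanSpace ℝ (Fin N) →L[ℝ] ℝ).hasFDerivAt.const_mul 2
    have h := (ha.mul hb).fderiv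
    have h' : fderiv ℝ (fun y : EuclideanSpace ℝ (Fin N) => g1 (‖y‖ ^ 2) * (2 * y i)) x = _ := h
    rw [h']
    simp [EuclideanSpace.inner_single_right]
    ring
  unfold laplacian
  rw [Finset.sum_congr rfl (fun i _ => h2 i), Finset.sum_add_distrib, ← Finset.mul_sum, ← Finset.mul_sum,
    ← EuclideanSpace.real_norm_sq_eq]
  simp
  ring

/-- For `0 < α ≤ 4` and `N ≥ 3`, the function `V(x) = (1+|x|^α)^{(2-N)/4}` satisfies
`Δ V(x) ≤ 0` for all `x ≠ 0`. -/
theorem lyapunov_ineq_special (N : ℕ) (hN : 3 ≤ N) (α : ℝ) (hα : 0 < α) (hα' : α ≤ 4) :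
    ∀ x : EuclideanSpace ℝ (Fin N), x ≠ 0 →
      laplacian (fun y => (1 + ‖y‖ ^ α) ^ ((2 - (N : ℝ)) / 4)) x ≤ 0 := by
  intro x hx
  set b : ℝ := (2 - (N : ℝ)) / 4 with hb
  set a : ℝ := α / 2 with ha
  have hN' : (3 : ℝ) ≤ N := by exact_mod_cast hN
  have ha0 : 0 < a := by positivity
  have hd : ∀ s : ℝ, 0 < s → HasDerivAt (fun s : ℝ => 1 + s ^ a) (a * s ^ (a - 1)) s := by
    intro s hs
    exact (Real.hasDerivAt_rpow_const (Or.inl hs.ne')).const_add 1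
  have hd2 : ∀ c s : ℝ, 0 < s → HasDerivAt (fun s : ℝ => (1 + s ^ a) ^ c)
      ((a * s ^ (a - 1)) * c * (1 + s ^ a) ^ (c - 1)) s := by
    intro c s hs
    exact (hd s hs).rpow_const (Or.inl (by positivity))
  have hs : 0 < ‖x‖ ^ 2 := by positivity
  have hg1 := ((((Real.hasDerivAt_rpow_const (p := a - 1) (Or.inl hs.ne')).const_mul a).mul_const
    b).mul (hd2 (b - 1) _ hs))
  rw [laplacian_radial _ (fun s => (1 + s ^ a) ^ b) _ _ ?_ (hd2 b) x hx hg1]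
  · generalize ‖x‖ ^ 2 = s at hs
    have e1 : (1 + s ^ a) ^ (b - 1) = (1 + s ^ a) ^ (b - 1 - 1) * (1 + s ^ a) := by
      rw [← Real.rpow_add_one (by positivity)]; ring_nf
    have e2 : s ^ (a - 1) = s ^ (a - 1 - 1) * s := by
      rw [← Real.rpow_add_one hs.ne']; ring_nf
    have e3 : s ^ a = s ^ (a - 1 - 1) * s * s := by
      rw [← e2, ← Real.rpow_add_one hs.ne']; ring_nf
    have hA : 0 < (1 + s ^ a) ^ (b - 1 - 1) := by positivity
    have hB : 0 < s ^ (a - 1 - 1) := by positivity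
    rw [e1, e2]
    generalize (1 + s ^ a) ^ (b - 1 - 1) = A at hA
    rw [e3]
    generalize s ^ (a - 1 - 1) = B at hB
    have hbr : 0 ≤ (2 * N - 4 + 4 * a) + (N - 2) * (2 - a) * (B * s * s) := by
      have h1 : 0 ≤ (N - 2 : ℝ) * (2 - a) := mul_nonneg (by linarith) (by linarith)
      have h2 : 0 ≤ (N - 2 : ℝ) * (2 - a) * (B * s * s) := mul_nonneg h1 (by positivity)
      linarith
    have hp : 0 ≤ a * B * s * A * (N - 2) / 4 :=
      div_nonneg (mul_nonneg (by positivity) (by linarith)) (by norm_num)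
    have := mul_nonneg hp hbr
    have hNb : (N : ℝ) = 2 - 4 * b := by rw [hb]; ring
    rw [hNb] at this ⊢
    nlinarith [this]
  · intro y
    show (1 + ‖y‖ ^ α) ^ b = (1 + (‖y‖ ^ 2) ^ a) ^ b
    rw [← Real.rpow_natCast, ← Real.rpow_mul (norm_nonneg y)]
    congr 3
    rw [ha]; push_cast; ring
end

section
/- Let $N \ge 1$, let $1 < p < \infty$ and let $\gamma \in \mathbb{R}$ satisfy $N + p(\gamma-1) \ne 0$. Then for every $u \in C_c^\infty(\mathbb{R}^N \setminus \{0\})$, $\left(\int_{\mathbb{R}^N} |x|^{(\gamma-1)p} |u(x)|^p \, dx\right)^{\frac{1}{p}} \le \frac{p}{|N + p(\gamma-1)|} \left(\int_{\mathbb{R}^N} |x|^{\gamma p} |\nabla u(x)|^p \, dx\right)^{\frac{1}{p}}$. -/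
open MeasureTheory

/-- Euler identity: `∫ x·∇f = -N ∫ f` for `f` of class `C^1` with compact support. -/
lemma hardy_euler (N : ℕ) (f : EuclideanSpace ℝ (Fin N) → ℝ) (hf : ContDiff ℝ 1 f)
    (hc : HasCompactSupport f) :
    Integrable (fun x => fderiv ℝ f x x) ∧ ∫ x, fderiv ℝ f x x = -(N : ℝ) * ∫ x, f x := by
  have hcf : Continuous (fderiv ℝ f) := hf.continuous_fderiv (by norm_num)
  have hcs : HasCompactSupport (fderiv ℝ f) := hc.fderiv ℝ
  have hint : ∀ i, Integrable
      (fun x : EuclideanSpace ℝ (Fin N) => x i * fderiv ℝ f x (EuclideanSpace.single i 1)) := by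
    intro i
    refine Continuous.integrable_of_hasCompactSupport (by fun_prop) ?_
    refine HasCompactSupport.mono hcs ?_
    intro x hx
    simp only [Function.mem_support] at hx ⊢
    intro h
    simp [h] at hx
  have hfi : Integrable f := hf.continuous.integrable_of_hasCompactSupport hc
  have key : ∀ i, ∫ x : EuclideanSpace ℝ (Fin N),
      x i * fderiv ℝ f x (EuclideanSpace.single i 1) = - ∫ x, f x := by
    intro i
    have hd : ∀ x : EuclideanSpace ℝ (Fin N),
        fderiv ℝ (fun x : EuclideanSpace ℝ (Fin N) => x i) x (EuclideanSpace.single i 1) = 1 := by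
      intro x
      let P : EuclideanSpace ℝ (Fin N) →L[ℝ] ℝ := EuclideanSpace.proj i
      have := P.hasFDerivAt (x := x)
      have h2 : HasFDerivAt (fun x : EuclideanSpace ℝ (Fin N) => x i)
        P x := this
      rw [h2.fderiv]
      simp [P]
    rw [integral_mul_fderiv_eq_neg_fderiv_mul_of_integrable
      (f := fun x : EuclideanSpace ℝ (Fin N) => x i) (g := f)]
    · simp [hd]
    · simpa [hd] using hfi
    · exact hint i
    · exact Continuous.integrable_of_hasCompactSupport (by have := hf.continuous; fun_prop)
        hc.mul_left
    · intro x _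
      fun_prop
    · intro x _
      exact hf.differentiable (by norm_num) x
  have hexp : ∀ x : EuclideanSpace ℝ (Fin N),
      fderiv ℝ f x x = ∑ i, x i * fderiv ℝ f x (EuclideanSpace.single i 1) := by
    intro x
    have hx : x = ∑ i, x i • EuclideanSpace.single i (1 : ℝ) := by
      ext j
      simp [Finset.sum_apply, Pi.single_apply]
    have h := congrArg (fderiv ℝ f x) hx
    rw [map_sum] at h
    simpa using h
  simp_rw [hexp]
  refine ⟨integrable_finsetSum _ fun i _ => hint i, ?_⟩
  rw [integral_finsetSum _ fun i _ => hint i]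
  simp [key]

lemma hardy_norm_rpow_hasFDerivAt {N : ℕ} (x : EuclideanSpace ℝ (Fin N)) (hx : x ≠ 0) (a : ℝ) :
    HasFDerivAt (fun x : EuclideanSpace ℝ (Fin N) ↦ ‖x‖ ^ a)
      ((a * ‖x‖ ^ (a - 2)) • innerSL ℝ x) x := by
  apply HasStrictFDerivAt.hasFDerivAt
  convert! (hasStrictFDerivAt_norm_sq x).rpow_const (p := a / 2) (by simp [hx]) using 0
  simp_rw [← Real.rpow_natCast_mul (norm_nonneg _), ← Nat.cast_smul_eq_nsmul ℝ, smul_smul]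
  ring_nf

lemma hardy_cont {N : ℕ} (b : ℝ) (g : EuclideanSpace ℝ (Fin N) → ℝ) (hg : Continuous g)
    (h0 : (0 : EuclideanSpace ℝ (Fin N)) ∉ tsupport g) :
    Continuous (fun x => ‖x‖ ^ b * g x) := by
  rw [continuous_iff_continuousAt]
  intro x
  by_cases hx : x = 0
  · subst hx
    have h : g =ᶠ[nhds 0] 0 := notMem_tsupport_iff_eventuallyEq.1 h0
    have h2 : (fun x => ‖x‖ ^ b * g x) =ᶠ[nhds 0] fun _ => 0 := by
      filter_upwards [h] with y hy
      simp [hy]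
    exact continuousAt_const.congr h2.symm
  · exact (continuousAt_id.norm.rpow_const (Or.inl (by simpa using hx))).mul hg.continuousAt

/-- Weighted Hardy inequality with explicit constant: for `1 < p < ∞` and
`N + p(γ-1) ≠ 0`, every `u ∈ C_c^∞(ℝ^N \ {0})` satisfies
`‖ |x|^{γ-1} u ‖_p ≤ p/|N+p(γ-1)| ‖ |x|^γ ∇u ‖_p`. -/
theorem weighted_hardy (N : ℕ) (hN : 1 ≤ N) (p : ℝ) (hp : 1 < p) (γ : ℝ)
    (hγ : (N : ℝ) + p * (γ - 1) ≠ 0) :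
    ∀ u : EuclideanSpace ℝ (Fin N) → ℝ,
      ContDiff ℝ (⊤ : ℕ∞) u → HasCompactSupport u → (0 : EuclideanSpace ℝ (Fin N)) ∉ tsupport u →
      (∫ x : EuclideanSpace ℝ (Fin N), ‖x‖ ^ ((γ - 1) * p) * |u x| ^ p) ^ (1 / p) ≤
        (p / |(N : ℝ) + p * (γ - 1)|) *
          (∫ x : EuclideanSpace ℝ (Fin N), ‖x‖ ^ (γ * p) * ‖fderiv ℝ u x‖ ^ p) ^ (1 / p) := by
  intro u hu hc h0
  have hp0 : 0 < p := by linarith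
  have hu1 : ContDiff ℝ 1 u := hu.of_le (by exact_mod_cast le_top)
  have hcd : Continuous (fderiv ℝ u) := hu1.continuous_fderiv (by norm_num)
  have hup : ContDiff ℝ 1 (fun x => |u x| ^ p) := by
    have := (contDiff_norm_rpow (E := ℝ) hp).comp hu1
    simpa [Function.comp_def] using this
  -- the function `f`
  set f : EuclideanSpace ℝ (Fin N) → ℝ := fun x => ‖x‖ ^ ((γ - 1) * p) * |u x| ^ p with hfdef
  have hf1 : ContDiff ℝ 1 f := by
    rw [contDiff_iff_contDiffAt]
    intro x
    by_cases hx : x = 0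
    · subst hx
      have h : u =ᶠ[nhds 0] 0 := notMem_tsupport_iff_eventuallyEq.1 h0
      have h2 : f =ᶠ[nhds 0] fun _ => 0 := by
        filter_upwards [h] with y hy
        simp [hfdef, hy, hp0.ne']
      exact contDiffAt_const.congr_of_eventuallyEq h2
    · exact ((contDiffAt_id.norm ℝ hx).rpow_const_of_ne (by simpa using hx)).mul hup.contDiffAt
  have hfc : HasCompactSupport f := by
    refine hc.mono ?_
    intro x hx
    simp only [Function.mem_support] at hx ⊢
    intro h
    simp [hfdef, h, hp0.ne'] at hx
  have hfi : Integrable f := hf1.continuous.integrable_of_hasCompactSupport hfc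
  obtain ⟨hEi, hE⟩ := hardy_euler N f hf1 hfc
  -- the two Hölder factors
  set F : EuclideanSpace ℝ (Fin N) → ℝ := fun x => (‖x‖ ^ (γ - 1) * |u x|) ^ (p - 1) with hF
  set G : EuclideanSpace ℝ (Fin N) → ℝ := fun x => ‖x‖ ^ γ * ‖fderiv ℝ u x‖ with hG
  have hFcont : Continuous F := by
    refine (hardy_cont (γ - 1) (fun x => |u x|) hu1.continuous.abs ?_).rpow_const
      (fun _ => Or.inr (by linarith))
    intro h
    refine h0 (closure_mono ?_ h)
    intro x hx
    simpa using hx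
  have hGcont : Continuous G := by
    refine hardy_cont γ (fun x => ‖fderiv ℝ u x‖) hcd.norm ?_
    intro h
    refine h0 (tsupport_fderiv_subset ℝ (closure_mono ?_ h))
    intro x hx
    simpa using hx
  have hFc : HasCompactSupport F := by
    refine hc.mono ?_
    intro x hx
    simp only [Function.mem_support] at hx ⊢
    intro h
    simp [hF, h, (by linarith : p - 1 ≠ 0)] at hx
  have hGc : HasCompactSupport G := by
    refine (hc.fderiv ℝ).mono ?_
    intro x hx
    simp only [Function.mem_support] at hx ⊢
    intro h
    simp [hG, h] at hx
  have hF0 : ∀ x, 0 ≤ F x := fun x => by positivity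
  have hG0 : ∀ x, 0 ≤ G x := fun x => by positivity
  have hFG : Integrable (fun x => F x * G x) :=
    (hFcont.mul hGcont).integrable_of_hasCompactSupport hGc.mul_left
  have hpt : ∀ x, |fderiv ℝ f x x - (γ - 1) * p * f x| ≤ p * (F x * G x) := by
    intro x
    by_cases hx : x = 0
    · subst hx
      have : u 0 = 0 := image_eq_zero_of_notMem_tsupport h0
      have h2 : f 0 = 0 := by simp [hfdef, this, hp0.ne']
      rw [h2]
      simp only [map_zero, mul_zero, sub_zero, abs_zero]
      exact mul_nonneg hp0.le (mul_nonneg (hF0 _) (hG0 _))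
    have hn : 0 < ‖x‖ := norm_pos_iff.2 hx
    have h1 := hardy_norm_rpow_hasFDerivAt x hx ((γ - 1) * p)
    have h2 : HasFDerivAt (fun x => |u x| ^ p)
        ((p * |u x| ^ (p - 2) * u x) • fderiv ℝ u x) x :=
      (hasDerivAt_abs_rpow (u x) hp).comp_hasFDerivAt x
        (hu1.differentiable (by norm_num) x).hasFDerivAt
    have h3 : fderiv ℝ f x x = (γ - 1) * p * f x +
        ‖x‖ ^ ((γ - 1) * p) * ((p * |u x| ^ (p - 2) * u x) * fderiv ℝ u x x) := by
      have h4 : HasFDerivAt f _ x := h1.mul h2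
      rw [h4.fderiv]
      have e : ‖x‖ ^ ((γ - 1) * p) = ‖x‖ ^ ((γ - 1) * p - 2) * (‖x‖ * ‖x‖) := by
        rw [Real.rpow_sub hn, Real.rpow_two]
        field_simp
      simp [hfdef, real_inner_self_eq_norm_mul_norm]
      rw [e]
      ring
    rw [h3, add_sub_cancel_left, abs_mul, abs_mul, abs_mul, abs_mul, abs_of_pos hp0,
      abs_of_nonneg (Real.rpow_nonneg hn.le _), abs_of_nonneg (Real.rpow_nonneg (abs_nonneg _) _)]
    have e1 : |u x| ^ (p - 2) * |u x| = |u x| ^ (p - 1) := by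
      rw [← Real.rpow_add_one' (abs_nonneg _) (by linarith)]
      ring_nf
    have e2 : F x * G x = ‖x‖ ^ ((γ - 1) * p) * |u x| ^ (p - 1) * (‖fderiv ℝ u x‖ * ‖x‖) := by
      simp only [hF, hG]
      rw [Real.mul_rpow (by positivity) (by positivity), ← Real.rpow_mul hn.le]
      have : ‖x‖ ^ ((γ - 1) * (p - 1)) * ‖x‖ ^ γ = ‖x‖ ^ ((γ - 1) * p) * ‖x‖ := by
        rw [← Real.rpow_add hn, ← Real.rpow_add_one hn.ne']
        ring_nf
      linear_combination (|u x| ^ (p - 1) * ‖fderiv ℝ u x‖) * this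
    rw [e2]
    have e3 : |fderiv ℝ u x x| ≤ ‖fderiv ℝ u x‖ * ‖x‖ := (fderiv ℝ u x).le_opNorm x
    calc ‖x‖ ^ ((γ - 1) * p) * (p * |u x| ^ (p - 2) * |u x| * |fderiv ℝ u x x|)
        = p * (‖x‖ ^ ((γ - 1) * p) * |u x| ^ (p - 1) * |fderiv ℝ u x x|) := by
          rw [← e1]; ring
      _ ≤ _ := by gcongr
  set I := ∫ x, f x with hI
  have hI0 : 0 ≤ I := integral_nonneg fun x => by positivity
  have hmain : |(N : ℝ) + p * (γ - 1)| * I ≤ p * ∫ x, F x * G x := by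
    have e : ∫ x, (fderiv ℝ f x x - (γ - 1) * p * f x) = -(((N : ℝ) + p * (γ - 1)) * I) := by
      rw [integral_sub hEi (hfi.const_mul _), hE, integral_const_mul]
      ring
    calc |(N : ℝ) + p * (γ - 1)| * I = |∫ x, (fderiv ℝ f x x - (γ - 1) * p * f x)| := by
          rw [e, abs_neg, abs_mul, abs_of_nonneg hI0]
      _ ≤ ∫ x, |fderiv ℝ f x x - (γ - 1) * p * f x| := abs_integral_le_integral_abs
      _ ≤ ∫ x, p * (F x * G x) :=
          integral_mono (hEi.sub (hfi.const_mul _)).abs (hFG.const_mul _) hpt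
      _ = _ := integral_const_mul _ _
  have hpq : (p / (p - 1)).HolderConjugate p := (Real.HolderConjugate.conjExponent hp).symm
  have hH := integral_mul_le_Lp_mul_Lq_of_nonneg (μ := volume) hpq
    (Filter.Eventually.of_forall hF0) (Filter.Eventually.of_forall hG0)
    (hFcont.memLp_of_hasCompactSupport hFc) (hGcont.memLp_of_hasCompactSupport hGc)
  have eF : ∀ x, F x ^ (p / (p - 1)) = f x := by
    intro x
    simp only [hF, hfdef]
    rw [← Real.rpow_mul (by positivity), mul_div_cancel₀ _ (by linarith : p - 1 ≠ 0),
      Real.mul_rpow (by positivity) (by positivity), ← Real.rpow_mul (norm_nonneg _)]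
  have eG : ∀ x, G x ^ p = ‖x‖ ^ (γ * p) * ‖fderiv ℝ u x‖ ^ p := by
    intro x
    simp only [hG]
    rw [Real.mul_rpow (by positivity) (by positivity), ← Real.rpow_mul (norm_nonneg _)]
  simp_rw [eF, eG] at hH
  rw [← hI] at hH
  set J := ∫ x : EuclideanSpace ℝ (Fin N), ‖x‖ ^ (γ * p) * ‖fderiv ℝ u x‖ ^ p with hJ
  have hJ0 : 0 ≤ J := integral_nonneg fun x => by positivity
  have hA : 0 < |(N : ℝ) + p * (γ - 1)| := abs_pos.2 hγ
  rcases hI0.eq_or_lt with h | h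
  · rw [← h, Real.zero_rpow (by positivity)]
    positivity
  · have hs : 1 / (p / (p - 1)) + 1 / p = 1 := by
      have : p - 1 ≠ 0 := by linarith
      field_simp
      ring
    have hsplit : I = I ^ (1 / (p / (p - 1))) * I ^ (1 / p) := by
      rw [← Real.rpow_add h, hs, Real.rpow_one]
    have hK : 0 < I ^ (1 / (p / (p - 1))) := Real.rpow_pos_of_pos h _
    rw [div_mul_eq_mul_div, le_div_iff₀ hA]
    refine le_of_mul_le_mul_left ?_ hK
    calc I ^ (1 / (p / (p - 1))) * (I ^ (1 / p) * |(N : ℝ) + p * (γ - 1)|)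
        = |(N : ℝ) + p * (γ - 1)| * I := by
          conv_rhs => rw [hsplit]
          ring
      _ ≤ p * ∫ x, F x * G x := hmain
      _ ≤ p * (I ^ (1 / (p / (p - 1))) * J ^ (1 / p)) := by gcongr
      _ = _ := by ring
end

section
/- Let $N \ge 2$, let $1 < p < N$, set $p^* = \frac{Np}{N-p}$, and let $\gamma \in \mathbb{R}$ satisfy $N + p(\gamma-1) \ne 0$. Then there exists a constant $C > 0$ such that for every $u \in C_c^\infty(\mathbb{R}^N \setminus \{0\})$, $\left(\int_{\mathbb{R}^N} |x|^{\gamma p^*} |u(x)|^{p^*} \, dx\right)^{\frac{1}{p^*}} \le C \left(\int_{\mathbb{R}^N} |x|^{\gamma p} |\nabla u(x)|^p \, dx\right)^{\frac{1}{p}}$. -/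
open MeasureTheory

namespace WSC

variable {N : ℕ}

lemma hasFDerivAt_npow (c : ℝ) {x : EuclideanSpace ℝ (Fin N)} (hx : x ≠ 0) :
    HasFDerivAt (fun x : EuclideanSpace ℝ (Fin N) => ‖x‖ ^ c)
      ((c * ‖x‖ ^ (c - 2)) • innerSL ℝ x) x := by
  apply HasStrictFDerivAt.hasFDerivAt
  convert! (hasStrictFDerivAt_norm_sq x).rpow_const (p := c / 2) (by simp [hx]) using 0
  simp_rw [← Real.rpow_natCast_mul (norm_nonneg _), ← Nat.cast_smul_eq_nsmul ℝ, smul_smul]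
  ring_nf

lemma contDiffAt_npow (c : ℝ) {x : EuclideanSpace ℝ (Fin N)} (hx : x ≠ 0) :
    ContDiffAt ℝ 1 (fun x : EuclideanSpace ℝ (Fin N) => ‖x‖ ^ c) x :=
  (contDiffAt_norm ℝ hx).rpow_const_of_ne (by simpa using hx)

lemma contDiff_mul (c : ℝ) {f : EuclideanSpace ℝ (Fin N) → ℝ} (hf : ContDiff ℝ 1 f)
    (h0 : (0 : EuclideanSpace ℝ (Fin N)) ∉ tsupport f) :
    ContDiff ℝ 1 (fun x => ‖x‖ ^ c * f x) := by
  rw [contDiff_iff_contDiffAt]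
  intro x
  by_cases hx : x ∈ tsupport (fun x => ‖x‖ ^ c * f x)
  swap
  · exact contDiffAt_const.congr_of_eventuallyEq (notMem_tsupport_iff_eventuallyEq.1 hx)
  have hx' : x ∈ tsupport f := tsupport_mul_subset_right hx
  have : x ≠ 0 := fun h => h0 (h ▸ hx')
  exact (contDiffAt_npow c this).mul hf.contDiffAt

lemma continuous_mul (c : ℝ) {f : EuclideanSpace ℝ (Fin N) → ℝ} (hf : Continuous f)
    (h0 : (0 : EuclideanSpace ℝ (Fin N)) ∉ tsupport f) :
    Continuous (fun x => ‖x‖ ^ c * f x) := by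
  apply continuous_of_tsupport
  intro x hx
  have hx' : x ∈ tsupport f := tsupport_mul_subset_right hx
  have : x ≠ 0 := fun h => h0 (h ▸ hx')
  exact (contDiffAt_npow c this).continuousAt.mul hf.continuousAt

lemma tsupport_rpow_subset {F : Type*} [NormedAddCommGroup F]
    {f : EuclideanSpace ℝ (Fin N) → F} {q : ℝ} (hq : 0 < q) :
    tsupport (fun x => ‖f x‖ ^ q) ⊆ tsupport f := by
  apply closure_mono
  intro x hx h
  apply hx
  simp [h, hq.ne']

/-- Euler-type integration by parts. -/
lemma integral_fderiv_self {w : EuclideanSpace ℝ (Fin N) → ℝ} (hw : ContDiff ℝ 1 w)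
    (hc : HasCompactSupport w) : ∫ x, fderiv ℝ w x x = - (N * ∫ x, w x) := by
  have hcont : Continuous (fderiv ℝ w) := hw.continuous_fderiv one_ne_zero
  have hi : ∀ i : Fin N, Integrable
      (fun x : EuclideanSpace ℝ (Fin N) => fderiv ℝ w x (EuclideanSpace.single i 1) * x i) := by
    intro i
    apply Continuous.integrable_of_hasCompactSupport
    · fun_prop
    · exact (hc.fderiv_apply ℝ _).mul_right
  have key : ∀ i : Fin N, ∫ x : EuclideanSpace ℝ (Fin N),
      fderiv ℝ w x (EuclideanSpace.single i 1) * x i = - ∫ x, w x := by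
    intro i
    have hd : ∀ x : EuclideanSpace ℝ (Fin N),
        fderiv ℝ (fun x : EuclideanSpace ℝ (Fin N) => x i) x (EuclideanSpace.single i 1) = 1 := by
      intro x
      have : HasFDerivAt (fun x : EuclideanSpace ℝ (Fin N) => x i)
        (EuclideanSpace.proj (𝕜 := ℝ) i) x :=
        ContinuousLinearMap.hasFDerivAt (EuclideanSpace.proj i : EuclideanSpace ℝ (Fin N) →L[ℝ] ℝ)
      rw [this.fderiv]
      simp
    have := integral_mul_fderiv_eq_neg_fderiv_mul_of_integrable (𝕜 := ℝ)
      (μ := (volume : Measure (EuclideanSpace ℝ (Fin N)))) (f := w)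
      (g := fun x => x i) (v := EuclideanSpace.single i 1) (hi i) ?_ ?_ ?_ ?_
    · simp only [hd, mul_one] at this
      linarith
    · simp only [hd, mul_one]
      exact hw.continuous.integrable_of_hasCompactSupport hc
    · apply Continuous.integrable_of_hasCompactSupport
      · have := hw.continuous
        fun_prop
      · exact hc.mul_right
    · intro x _
      exact hw.differentiable one_ne_zero x
    · intro x _
      fun_prop
  have : ∀ x, fderiv ℝ w x x = ∑ i, fderiv ℝ w x (EuclideanSpace.single i 1) * x i := by
    intro x
    have h := congrArg (fderiv ℝ w x) ((EuclideanSpace.basisFun (Fin N) ℝ).sum_repr x)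
    rw [← h]
    simp [map_sum, mul_comm]
  simp_rw [this]
  rw [integral_finsetSum _ (fun i _ => hi i)]
  simp [key]

lemma rpow_add_le {a b p : ℝ} (ha : 0 ≤ a) (hb : 0 ≤ b) (hp : 1 ≤ p) :
    (a + b) ^ p ≤ 2 ^ (p - 1) * (a ^ p + b ^ p) := by
  lift a to NNReal using ha
  lift b to NNReal using hb
  exact_mod_cast NNReal.rpow_add_le_mul_rpow_add_rpow a b hp

lemma hardy {p γ : ℝ} (hp : 1 < p) (hγ : (N : ℝ) + p * (γ - 1) ≠ 0)
    {u : EuclideanSpace ℝ (Fin N) → ℝ} (hu : ContDiff ℝ 1 u) (hc : HasCompactSupport u)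
    (h0 : (0 : EuclideanSpace ℝ (Fin N)) ∉ tsupport u) :
    ∫ x, ‖x‖ ^ (p * (γ - 1)) * ‖u x‖ ^ p ≤
      (p / |(N : ℝ) + p * (γ - 1)|) ^ p * ∫ x, ‖x‖ ^ (γ * p) * ‖fderiv ℝ u x‖ ^ p := by
  have hp0 : 0 < p := by linarith
  have hp1 : 0 < p - 1 := by linarith
  set a := p * (γ - 1) with ha
  set A := ∫ x, ‖x‖ ^ a * ‖u x‖ ^ p with hA
  set B := ∫ x, ‖x‖ ^ (γ * p) * ‖fderiv ℝ u x‖ ^ p with hB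
  have hB0 : 0 ≤ B := integral_nonneg fun x => by positivity
  have hA0 : 0 ≤ A := integral_nonneg fun x => by positivity
  have hu0 : u 0 = 0 := image_eq_zero_of_notMem_tsupport h0
  have hv : ContDiff ℝ 1 (fun x => ‖u x‖ ^ p) := hu.norm_rpow hp
  have hv0 : (0 : EuclideanSpace ℝ (Fin N)) ∉ tsupport (fun x => ‖u x‖ ^ p) :=
    fun h => h0 (tsupport_rpow_subset hp0 h)
  have hvc : HasCompactSupport (fun x => ‖u x‖ ^ p) := hc.norm.rpow_const hp0.ne'
  have hDc : Continuous (fderiv ℝ u) := hu.continuous_fderiv one_ne_zero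
  have hw := contDiff_mul a hv hv0
  have hwc : HasCompactSupport (fun x => ‖x‖ ^ a * ‖u x‖ ^ p) := hvc.mul_left
  have hE := integral_fderiv_self hw hwc
  -- the pointwise identity
  have hpt : ∀ x, fderiv ℝ (fun x => ‖x‖ ^ a * ‖u x‖ ^ p) x x =
      a * (‖x‖ ^ a * ‖u x‖ ^ p) + ‖x‖ ^ a * fderiv ℝ (fun x => ‖u x‖ ^ p) x x := by
    intro x
    by_cases hx : x = 0
    · subst hx
      simp [hu0, hp0.ne']
    · have h1 := (hasFDerivAt_npow a hx).mul (hv.differentiable one_ne_zero x).hasFDerivAt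
      have h2 := HasFDerivAt.fderiv h1
      change fderiv ℝ (fun x => ‖x‖ ^ a * ‖u x‖ ^ p) x = _ at h2
      rw [h2]
      have hxp : 0 < ‖x‖ := norm_pos_iff.2 hx
      have : ‖x‖ ^ (a - 2) * ‖x‖ ^ 2 = ‖x‖ ^ a := by
        rw [← Real.rpow_natCast, ← Real.rpow_add hxp]; norm_num
      simp only [add_apply, smul_apply, smul_eq_mul,
        innerSL_apply_apply, real_inner_self_eq_norm_sq]
      rw [← this]; ring
  have hI1 : Integrable (fun x => ‖x‖ ^ a * ‖u x‖ ^ p) :=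
    hw.continuous.integrable_of_hasCompactSupport hwc
  have hI2 : Integrable (fun x => ‖x‖ ^ a * fderiv ℝ (fun x => ‖u x‖ ^ p) x x) := by
    have hcl : Continuous (fun x => fderiv ℝ (fun x => ‖u x‖ ^ p) x x) := by
      have := hv.continuous_fderiv one_ne_zero
      fun_prop
    have hts : Function.support (fun x => fderiv ℝ (fun x => ‖u x‖ ^ p) x x) ⊆
        tsupport (fun x => ‖u x‖ ^ p) := by
      intro x hx
      apply support_fderiv_subset ℝ
      intro h
      apply hx
      change fderiv ℝ (fun x => ‖u x‖ ^ p) x x = 0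
      rw [h]; rfl
    have hts' := closure_minimal hts (isClosed_tsupport _)
    refine (continuous_mul a hcl (fun h => hv0 (hts' h))).integrable_of_hasCompactSupport ?_
    have : HasCompactSupport (fun x => fderiv ℝ (fun x => ‖u x‖ ^ p) x x) := hvc.mono' hts
    exact this.mul_left
  simp_rw [hpt] at hE
  rw [integral_add (hI1.const_mul a) hI2, integral_const_mul, ← hA] at hE
  -- Hölder
  set f := fun x : EuclideanSpace ℝ (Fin N) => ‖x‖ ^ γ * ‖fderiv ℝ u x‖ with hf
  set g := fun x : EuclideanSpace ℝ (Fin N) => ‖x‖ ^ ((γ - 1) * (p - 1)) * ‖u x‖ ^ (p - 1) with hg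
  have hpq : p.HolderConjugate (Real.conjExponent p) := .conjExponent hp
  have hfc : Continuous f := by
    apply continuous_mul _ hDc.norm
    intro h
    exact h0 (tsupport_fderiv_subset ℝ (closure_mono (by intro x hx; simpa using hx) h))
  have hfs : HasCompactSupport f := (hc.fderiv ℝ).norm.mul_left
  have hgc : Continuous g := by
    apply continuous_mul _ (hu.continuous.norm.rpow_const fun x => Or.inr hp1.le)
    exact fun h => h0 (tsupport_rpow_subset hp1 h)
  have hgs : HasCompactSupport g := (hc.norm.rpow_const hp1.ne').mul_left
  have hH := integral_mul_le_Lp_mul_Lq_of_nonneg (μ := volume) hpq (f := f) (g := g)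
    (Filter.Eventually.of_forall fun x => by simp only [f, Pi.zero_apply]; positivity)
    (Filter.Eventually.of_forall fun x => by simp only [g, Pi.zero_apply]; positivity)
    (hfc.memLp_of_hasCompactSupport hfs) (hgc.memLp_of_hasCompactSupport hgs)
  have hfp : ∫ x, f x ^ p = B := by
    apply integral_congr_ae
    refine Filter.Eventually.of_forall fun x => ?_
    simp only [f]
    rw [Real.mul_rpow (by positivity) (by positivity), ← Real.rpow_mul (norm_nonneg _)]
  have hqp : (p - 1) * Real.conjExponent p = p := by
    rw [Real.conjExponent]; field_simp
  have hgp : ∫ x, g x ^ Real.conjExponent p = A := by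
    apply integral_congr_ae
    refine Filter.Eventually.of_forall fun x => ?_
    simp only [g]
    rw [Real.mul_rpow (by positivity) (by positivity), ← Real.rpow_mul (norm_nonneg _),
      ← Real.rpow_mul (norm_nonneg _), mul_assoc, hqp, ha, mul_comm p]
  rw [hfp, hgp] at hH
  have hq1 : 1 / Real.conjExponent p = 1 - 1 / p := by
    rw [Real.conjExponent]; field_simp
  rw [hq1] at hH
  have hbd : |∫ x, ‖x‖ ^ a * fderiv ℝ (fun x => ‖u x‖ ^ p) x x| ≤ p * ∫ x, f x * g x := by
    rw [← integral_const_mul, ← Real.norm_eq_abs]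
    apply norm_integral_le_of_norm_le
    · exact ((hfc.mul hgc).integrable_of_hasCompactSupport hfs.mul_right).const_mul p
    · refine Filter.Eventually.of_forall fun x => ?_
      by_cases hx : x = 0
      · subst hx
        simp only [map_zero, mul_zero, norm_zero, f, g]
        positivity
      · have hxp : 0 < ‖x‖ := norm_pos_iff.2 hx
        rw [norm_mul, Real.norm_of_nonneg (by positivity : 0 ≤ ‖x‖ ^ a)]
        calc ‖x‖ ^ a * ‖fderiv ℝ (fun x => ‖u x‖ ^ p) x x‖
            ≤ ‖x‖ ^ a * ((p * ‖u x‖ ^ (p - 1) * ‖fderiv ℝ u x‖) * ‖x‖) := by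
              gcongr
              refine (ContinuousLinearMap.le_opNorm _ _).trans ?_
              gcongr
              exact norm_fderiv_norm_rpow_le (hu.differentiable one_ne_zero) hp
          _ = p * (f x * g x) := by
              have : ‖x‖ ^ a * ‖x‖ = ‖x‖ ^ γ * ‖x‖ ^ ((γ - 1) * (p - 1)) := by
                rw [← Real.rpow_add_one hxp.ne', ← Real.rpow_add hxp]
                congr 1; rw [ha]; ring
              simp only [f, g]
              linear_combination (p * ‖u x‖ ^ (p - 1) * ‖fderiv ℝ u x‖) * this
  have hfin : |(N : ℝ) + a| * A ≤ p * (B ^ (1 / p) * A ^ (1 - 1 / p)) := by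
    calc |(N : ℝ) + a| * A = |((N : ℝ) + a) * A| := by rw [abs_mul, abs_of_nonneg hA0]
      _ = |∫ x, ‖x‖ ^ a * fderiv ℝ (fun x => ‖u x‖ ^ p) x x| := by
          rw [← abs_neg]; congr 1; linarith
      _ ≤ _ := hbd
      _ ≤ _ := by gcongr
  have hN : 0 < |(N : ℝ) + a| := abs_pos.2 hγ
  rcases hA0.eq_or_lt with h | h
  · rw [← h]; positivity
  have h3 : A ^ (1 / p) ≤ p / |(N : ℝ) + a| * B ^ (1 / p) := by
    have hs : A = A ^ (1 / p) * A ^ (1 - 1 / p) := by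
      rw [← Real.rpow_add h]; norm_num
    have hpos : 0 < A ^ (1 - 1 / p) := Real.rpow_pos_of_pos h _
    have : |(N : ℝ) + a| * A ^ (1 / p) ≤ p * B ^ (1 / p) := by
      refine le_of_mul_le_mul_right ?_ hpos
      calc _ = |(N : ℝ) + a| * A := by rw [mul_assoc, ← hs]
        _ ≤ _ := hfin
        _ = _ := by ring
    rw [div_mul_eq_mul_div, le_div_iff₀ hN]; linarith
  have h4 := Real.rpow_le_rpow (by positivity) h3 hp0.le
  rwa [Real.mul_rpow (by positivity) (by positivity), ← Real.rpow_mul hA0, ← Real.rpow_mul hB0,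
    one_div_mul_cancel hp0.ne', Real.rpow_one, Real.rpow_one] at h4

end WSC

/-- Weighted Sobolev inequality: for `1 < p < N`, `p* = Np/(N-p)` and
`N + p(γ-1) ≠ 0`, there is `C > 0` such that every `u ∈ C_c^∞(ℝ^N \ {0})` satisfies
`‖ |x|^γ u ‖_{p*} ≤ C ‖ |x|^γ ∇u ‖_p`. -/
theorem weighted_sobolev_critical (N : ℕ) (hN : 2 ≤ N) (p : ℝ) (hp : 1 < p)
    (hpN : p < N) (pstar : ℝ) (hpstar : pstar = (N : ℝ) * p / ((N : ℝ) - p)) (γ : ℝ)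
    (hγ : (N : ℝ) + p * (γ - 1) ≠ 0) :
    ∃ C : ℝ, 0 < C ∧ ∀ u : EuclideanSpace ℝ (Fin N) → ℝ,
      ContDiff ℝ (⊤ : ℕ∞) u → HasCompactSupport u → (0 : EuclideanSpace ℝ (Fin N)) ∉ tsupport u →
      (∫ x : EuclideanSpace ℝ (Fin N), ‖x‖ ^ (γ * pstar) * |u x| ^ pstar) ^ (1 / pstar) ≤
        C * (∫ x : EuclideanSpace ℝ (Fin N), ‖x‖ ^ (γ * p) * ‖fderiv ℝ u x‖ ^ p) ^ (1 / p) := by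
  have hp0 : 0 < p := by linarith
  have hN0 : (0 : ℝ) < N := by linarith
  have hNp : (0 : ℝ) < N - p := by linarith
  have hs0 : 0 < pstar := by rw [hpstar]; positivity
  set K : ℝ := (p / |(N : ℝ) + p * (γ - 1)|) ^ p with hK
  have hK0 : 0 ≤ K := by positivity
  set M : ℝ := 2 ^ (p - 1) * (1 + |γ| ^ p * K) with hM
  have hM0 : 0 < M := by positivity
  set S : ℝ := ((eLpNormLESNormFDerivOfEqInnerConst
    (volume : Measure (EuclideanSpace ℝ (Fin N))) p : NNReal) : ℝ) with hS
  refine ⟨(S + 1) * M ^ (1 / p), by positivity, ?_⟩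
  intro u hu' hc h0
  have hu : ContDiff ℝ 1 u := hu'.of_le (by exact_mod_cast le_top)
  have hardy := WSC.hardy hp hγ hu hc h0
  have hu0 : u 0 = 0 := image_eq_zero_of_notMem_tsupport h0
  set A := ∫ x, ‖x‖ ^ (p * (γ - 1)) * ‖u x‖ ^ p with hA
  set B := ∫ x, ‖x‖ ^ (γ * p) * ‖fderiv ℝ u x‖ ^ p with hB
  have hB0 : 0 ≤ B := integral_nonneg fun x => by positivity
  have hDc : Continuous (fderiv ℝ u) := hu.continuous_fderiv one_ne_zero
  have hD0 : fderiv ℝ u 0 = 0 :=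
    image_eq_zero_of_notMem_tsupport fun h => h0 (tsupport_fderiv_subset ℝ h)
  set v := fun x : EuclideanSpace ℝ (Fin N) => ‖x‖ ^ γ * u x with hv
  have hvd : ContDiff ℝ 1 v := WSC.contDiff_mul γ hu h0
  have hvc : HasCompactSupport v := hc.mul_left
  have hv0 : (0 : EuclideanSpace ℝ (Fin N)) ∉ tsupport v :=
    fun h => h0 (tsupport_mul_subset_right h)
  have hDv0 : fderiv ℝ v 0 = 0 :=
    image_eq_zero_of_notMem_tsupport fun h => hv0 (tsupport_fderiv_subset ℝ h)
  have hDvc : Continuous (fderiv ℝ v) := hvd.continuous_fderiv one_ne_zero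
  have hpt : ∀ x, ‖fderiv ℝ v x‖ ^ p ≤ 2 ^ (p - 1) * (‖x‖ ^ (γ * p) * ‖fderiv ℝ u x‖ ^ p +
      |γ| ^ p * (‖x‖ ^ (p * (γ - 1)) * ‖u x‖ ^ p)) := by
    intro x
    by_cases hx : x = 0
    · subst hx
      rw [hDv0, norm_zero, Real.zero_rpow hp0.ne']
      positivity
    have hxp : 0 < ‖x‖ := norm_pos_iff.2 hx
    have h1 := (WSC.hasFDerivAt_npow γ hx).mul (hu.differentiable one_ne_zero x).hasFDerivAt
    have h2 : ‖fderiv ℝ v x‖ ≤ ‖x‖ ^ γ * ‖fderiv ℝ u x‖ + |γ| * (‖x‖ ^ (γ - 1) * ‖u x‖) := by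
      have h3 := HasFDerivAt.fderiv h1
      change fderiv ℝ v x = _ at h3
      rw [h3]
      refine (norm_add_le _ _).trans (le_of_eq ?_)
      have : ‖x‖ ^ (γ - 1) = ‖x‖ ^ (γ - 2) * ‖x‖ := by
        rw [← Real.rpow_add_one hxp.ne']; congr 1; ring
      rw [norm_smul, norm_smul, norm_smul, norm_mul, innerSL_apply_norm,
        Real.norm_of_nonneg (by positivity : 0 ≤ ‖x‖ ^ γ),
        Real.norm_of_nonneg (by positivity : 0 ≤ ‖x‖ ^ (γ - 2)), this, Real.norm_eq_abs γ]
      ring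
    calc ‖fderiv ℝ v x‖ ^ p
        ≤ (‖x‖ ^ γ * ‖fderiv ℝ u x‖ + |γ| * (‖x‖ ^ (γ - 1) * ‖u x‖)) ^ p := by gcongr
      _ ≤ 2 ^ (p - 1) * ((‖x‖ ^ γ * ‖fderiv ℝ u x‖) ^ p
          + (|γ| * (‖x‖ ^ (γ - 1) * ‖u x‖)) ^ p) :=
        WSC.rpow_add_le (by positivity) (by positivity) hp.le
      _ = _ := by
        rw [Real.mul_rpow (by positivity) (by positivity),
          Real.mul_rpow (by positivity) (by positivity),
          Real.mul_rpow (by positivity) (by positivity), ← Real.rpow_mul (norm_nonneg _),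
          ← Real.rpow_mul (norm_nonneg _), mul_comm (γ - 1) p]
  have hIB : Integrable (fun x => ‖x‖ ^ (γ * p) * ‖fderiv ℝ u x‖ ^ p) := by
    apply Continuous.integrable_of_hasCompactSupport
    · apply WSC.continuous_mul _ (hDc.norm.rpow_const fun x => Or.inr hp0.le)
      exact fun h => h0 (tsupport_fderiv_subset ℝ (WSC.tsupport_rpow_subset hp0 h))
    · exact ((hc.fderiv ℝ).norm.rpow_const hp0.ne').mul_left
  have hIA : Integrable (fun x => ‖x‖ ^ (p * (γ - 1)) * ‖u x‖ ^ p) := by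
    apply Continuous.integrable_of_hasCompactSupport
    · apply WSC.continuous_mul _ (hu.continuous.norm.rpow_const fun x => Or.inr hp0.le)
      exact fun h => h0 (WSC.tsupport_rpow_subset hp0 h)
    · exact (hc.norm.rpow_const hp0.ne').mul_left
  have hDv : ∫ x, ‖fderiv ℝ v x‖ ^ p ≤ M * B := by
    calc ∫ x, ‖fderiv ℝ v x‖ ^ p ≤ ∫ x, 2 ^ (p - 1) * (‖x‖ ^ (γ * p) * ‖fderiv ℝ u x‖ ^ p +
      |γ| ^ p * (‖x‖ ^ (p * (γ - 1)) * ‖u x‖ ^ p)) := by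
          apply integral_mono _ _ hpt
          · apply Continuous.integrable_of_hasCompactSupport
            · exact hDvc.norm.rpow_const fun x => Or.inr hp0.le
            · exact (hvc.fderiv ℝ).norm.rpow_const hp0.ne'
          · exact (hIB.add (hIA.const_mul _)).const_mul _
      _ = 2 ^ (p - 1) * (B + |γ| ^ p * A) := by
          rw [integral_const_mul, integral_add hIB (hIA.const_mul _), integral_const_mul]
      _ ≤ 2 ^ (p - 1) * (B + |γ| ^ p * (K * B)) := by gcongr
      _ = M * B := by rw [hM]; ring
  lift p to NNReal using hp0.le
  lift pstar to NNReal using hs0.le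
  have hpn : p ≠ 0 := by rintro rfl; simp at hp0
  have hsn : pstar ≠ 0 := by rintro rfl; simp at hs0
  have hsob := eLpNorm_le_eLpNorm_fderiv_of_eq_inner
    (volume : Measure (EuclideanSpace ℝ (Fin N))) hvd hvc (p := p) (p' := pstar)
    (by exact_mod_cast hp.le) (by simp; omega)
    (by rw [hpstar]; simp only [finrank_euclideanSpace, Fintype.card_fin, NNReal.coe_inv]; field_simp)
  rw [MemLp.eLpNorm_eq_integral_rpow_norm (by simpa using hsn) (by simp)
      (hvd.continuous.memLp_of_hasCompactSupport hvc),
    MemLp.eLpNorm_eq_integral_rpow_norm (by simpa using hpn) (by simp)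
      (hDvc.memLp_of_hasCompactSupport (hvc.fderiv ℝ)), ← ENNReal.ofReal_coe_nnreal (p := eLpNormLESNormFDerivOfEqInnerConst _ _),
      ← ENNReal.ofReal_mul (by positivity), ENNReal.ofReal_le_ofReal_iff (by positivity)] at hsob
  simp only [ENNReal.coe_toReal] at hsob
  have hL : ∫ x : EuclideanSpace ℝ (Fin N), ‖x‖ ^ (γ * pstar) * |u x| ^ (pstar : ℝ) =
      ∫ x, ‖v x‖ ^ (pstar : ℝ) := by
    apply integral_congr_ae
    refine Filter.Eventually.of_forall fun x => ?_
    simp only [v]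
    rw [norm_mul, Real.norm_of_nonneg (by positivity : 0 ≤ ‖x‖ ^ γ),
      Real.mul_rpow (by positivity) (by positivity), ← Real.rpow_mul (norm_nonneg _),
      Real.norm_eq_abs]
  rw [hL, one_div, one_div]
  refine hsob.trans ?_
  calc _ ≤ (S + 1) * (M * B) ^ (p : ℝ)⁻¹ := by
        gcongr
        linarith
    _ = _ := by rw [Real.mul_rpow hM0.le hB0]; ring
end

section
/- Let $N \ge 2$ and let $\beta, \gamma \in \mathbb{R}$ and $1 < p \le q < \infty$ satisfy: $\gamma - 1 \le \beta \le \gamma$, $\frac{1}{p} - \frac{1}{q} = \frac{1 - \gamma + \beta}{N}$, $N + p(\gamma-1) \ne 0$, $p < N$, and $q \le p^* := \frac{Np}{N-p}$. Then there exists a constant $C > 0$ such that for every $u \in C_c^\infty(\mathbb{R}^N \setminus \{0\})$, $\left(\int_{\mathbb{R}^N} |x|^{q\beta} |u(x)|^q \, dx\right)^{\frac{1}{q}} \le C \left(\int_{\mathbb{R}^N} |x|^{p\gamma} |\nabla u(x)|^p \, dx\right)^{\frac{1}{p}}$. -/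
open MeasureTheory

lemma ws_cont {E F : Type*} [NormedAddCommGroup E] [NormedAddCommGroup F] [NormedSpace ℝ F]
    (a : ℝ) {f : E → F} (hf : Continuous f) (h0 : (0 : E) ∉ tsupport f) :
    Continuous fun x => ‖x‖ ^ a • f x := by
  rw [continuous_iff_continuousAt]
  intro x
  by_cases hx : x = 0
  · subst hx
    have h := notMem_tsupport_iff_eventuallyEq.mp h0
    have h2 : (fun x => ‖x‖ ^ a • f x) =ᶠ[nhds 0] fun _ => 0 := by
      filter_upwards [h] with y hy
      simp [hy]
    exact continuousAt_const.congr h2.symm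
  · refine ContinuousAt.smul ?_ hf.continuousAt
    exact continuous_norm.continuousAt.rpow_const (Or.inl (norm_ne_zero_iff.mpr hx))

lemma ws_contDiff {E : Type*} [NormedAddCommGroup E] [InnerProductSpace ℝ E]
    (a : ℝ) {u : E → ℝ} (hu : ContDiff ℝ 1 u) (h0 : (0 : E) ∉ tsupport u) :
    ContDiff ℝ 1 fun x => ‖x‖ ^ a * u x := by
  rw [contDiff_iff_contDiffAt]
  intro x
  by_cases hx : x = 0
  · subst hx
    have h := notMem_tsupport_iff_eventuallyEq.mp h0
    have h2 : (fun x => ‖x‖ ^ a * u x) =ᶠ[nhds 0] fun _ => 0 := by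
      filter_upwards [h] with y hy
      simp [hy]
    exact contDiffAt_const.congr_of_eventuallyEq h2
  · refine ContDiffAt.mul ?_ hu.contDiffAt
    exact (contDiffAt_norm ℝ hx).rpow_const_of_ne (norm_ne_zero_iff.mpr hx)

lemma ws_hasFDerivAt {E : Type*} [NormedAddCommGroup E] [InnerProductSpace ℝ E]
    (a : ℝ) {u : E → ℝ} (hu : ContDiff ℝ 1 u) (h0 : (0 : E) ∉ tsupport u) (x : E) :
    HasFDerivAt (fun x => ‖x‖ ^ a * u x)
      (‖x‖ ^ a • fderiv ℝ u x + (a * ‖x‖ ^ (a - 2) * u x) • innerSL ℝ x) x := by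
  by_cases hx : x = 0
  · subst hx
    have h := notMem_tsupport_iff_eventuallyEq.mp h0
    have h2 : (fun x => ‖x‖ ^ a * u x) =ᶠ[nhds 0] fun _ => 0 := by
      filter_upwards [h] with y hy
      simp [hy]
    have h3 : fderiv ℝ u 0 = 0 := by
      rw [h.fderiv_eq]; simp
    rw [h3]
    simp only [smul_zero, map_zero, add_zero]
    exact (hasFDerivAt_const (0 : ℝ) (0 : E)).congr_of_eventuallyEq h2
  · have hn : ‖x‖ ≠ 0 := norm_ne_zero_iff.mpr hx
    have h1 : HasFDerivAt (fun x : E => ‖x‖ ^ a) ((a * ‖x‖ ^ (a - 2)) • innerSL ℝ x) x := by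
      have h := ((hasStrictFDerivAt_norm_sq x).hasFDerivAt).rpow_const (p := a / 2)
        (Or.inl (by positivity))
      have e : (fun x : E => ‖x‖ ^ a) = fun x : E => (‖x‖ ^ 2) ^ (a / 2) := by
        funext y
        rw [← Real.rpow_natCast_mul (norm_nonneg _)]
        congr 1; push_cast; ring
      rw [e]
      convert h using 1
      rw [← Real.rpow_natCast_mul (norm_nonneg _), ← Nat.cast_smul_eq_nsmul ℝ, smul_smul]
      congr 1
      rw [show ((2 : ℕ) : ℝ) * (a / 2 - 1) = a - 2 by push_cast; ring]
      push_cast; ring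
    have h2 := h1.mul (hu.differentiable (by simp) x).hasFDerivAt
    rw [smul_smul, show u x * (a * ‖x‖ ^ (a - 2)) = a * ‖x‖ ^ (a - 2) * u x by ring] at h2
    exact h2

lemma ws_fderiv_norm_le {E : Type*} [NormedAddCommGroup E] [InnerProductSpace ℝ E]
    (a : ℝ) {u : E → ℝ} (hu : ContDiff ℝ 1 u) (h0 : (0 : E) ∉ tsupport u) (x : E) :
    ‖fderiv ℝ (fun x => ‖x‖ ^ a * u x) x‖ ≤
      ‖x‖ ^ a * ‖fderiv ℝ u x‖ + |a| * (‖x‖ ^ (a - 1) * |u x|) := by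
  rw [(ws_hasFDerivAt a hu h0 x).fderiv]
  refine (norm_add_le _ _).trans ?_
  rw [norm_smul, norm_smul, innerSL_apply_norm, Real.norm_of_nonneg (by positivity)]
  refine add_le_add le_rfl ?_
  rw [Real.norm_eq_abs, abs_mul, abs_mul, abs_of_nonneg (a := ‖x‖ ^ (a - 2)) (by positivity)]
  by_cases hx : x = 0
  · subst hx
    simp [image_eq_zero_of_notMem_tsupport h0]
  · have : ‖x‖ ^ (a - 1) = ‖x‖ ^ (a - 2) * ‖x‖ := by
      rw [← Real.rpow_add_one (norm_ne_zero_iff.mpr hx)]; congr 1; ring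
    rw [this]
    apply le_of_eq; ring

lemma ws_euler (N : ℕ) {g : EuclideanSpace ℝ (Fin N) → ℝ} (hg : ContDiff ℝ 1 g)
    (hc : HasCompactSupport g) :
    ∫ x, fderiv ℝ g x x = - (N : ℝ) * ∫ x, g x := by
  have hcd : Continuous (fderiv ℝ g) := hg.continuous_fderiv (by simp)
  have hint : ∀ i : Fin N, Integrable
      (fun x : EuclideanSpace ℝ (Fin N) => x i * fderiv ℝ g x (EuclideanSpace.single i 1)) := by
    intro i
    refine Continuous.integrable_of_hasCompactSupport (by fun_prop) ?_
    exact (((hc.fderiv ℝ).comp_left (g := fun L : EuclideanSpace ℝ (Fin N) →L[ℝ] ℝ =>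
      L (EuclideanSpace.single i 1)) rfl)).mul_left
  have hgi : Integrable g := hg.continuous.integrable_of_hasCompactSupport hc
  have key : ∀ i : Fin N, ∫ x : EuclideanSpace ℝ (Fin N),
      x i * fderiv ℝ g x (EuclideanSpace.single i 1) = - ∫ x, g x := by
    intro i
    have hd : ∀ x, fderiv ℝ (fun x : EuclideanSpace ℝ (Fin N) => x i) x
        (EuclideanSpace.single i 1) = 1 := by
      intro x
      have : HasFDerivAt (fun x : EuclideanSpace ℝ (Fin N) => x i)
        (EuclideanSpace.proj i : EuclideanSpace ℝ (Fin N) →L[ℝ] ℝ) x :=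
        (EuclideanSpace.proj i : EuclideanSpace ℝ (Fin N) →L[ℝ] ℝ).hasFDerivAt
      rw [this.fderiv]; simp
    have h := integral_mul_fderiv_eq_neg_fderiv_mul_of_integrable
      (μ := (volume : Measure (EuclideanSpace ℝ (Fin N))))
      (f := fun x : EuclideanSpace ℝ (Fin N) => x i) (g := g) (v := EuclideanSpace.single i 1)
      (by simpa only [hd, one_mul] using hgi) (hint i)
      (Continuous.integrable_of_hasCompactSupport
        ((by fun_prop : Continuous fun x : EuclideanSpace ℝ (Fin N) => x i).mul hg.continuous)
        hc.mul_left)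
      (fun x _ => by fun_prop) (fun x _ => hg.differentiable (by simp) x)
    simpa only [hd, one_mul] using h
  have hx : ∀ x : EuclideanSpace ℝ (Fin N), fderiv ℝ g x x =
      ∑ i, x i * fderiv ℝ g x (EuclideanSpace.single i 1) := by
    intro x
    have h := (EuclideanSpace.basisFun (Fin N) ℝ).sum_repr x
    generalize fderiv ℝ g x = L
    conv_lhs => rw [← h]
    simp only [map_sum, map_smul, smul_eq_mul]
    simp
  simp_rw [hx]
  rw [integral_finsetSum _ (fun i _ => hint i)]
  simp [key]

lemma ws_tsupport_norm {E F : Type*} [TopologicalSpace E] [NormedAddCommGroup F] (f : E → F) :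
    tsupport (fun x => ‖f x‖) = tsupport f := by
  simp only [tsupport]
  congr 1
  ext x; simp

lemma ws_hardy (N : ℕ) (γ p : ℝ) (hp : 1 < p) (hne : (N : ℝ) + p * (γ - 1) ≠ 0)
    {u : EuclideanSpace ℝ (Fin N) → ℝ} (hu : ContDiff ℝ 1 u) (hc : HasCompactSupport u)
    (h0 : (0 : EuclideanSpace ℝ (Fin N)) ∉ tsupport u) :
    (∫ x, |‖x‖ ^ (γ - 1) * u x| ^ p) ^ (1 / p) ≤ (p / |(N : ℝ) + p * (γ - 1)|) *
      (∫ x, (‖x‖ ^ γ * ‖fderiv ℝ u x‖) ^ p) ^ (1 / p) := by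
  set v : EuclideanSpace ℝ (Fin N) → ℝ := fun x => ‖x‖ ^ (γ - 1) * u x with hv
  have hv1 : ContDiff ℝ 1 v := ws_contDiff _ hu h0
  have hvc : HasCompactSupport v := hc.mul_left
  have hpp : (0 : ℝ) < p := by linarith
  set g : EuclideanSpace ℝ (Fin N) → ℝ := fun x => |v x| ^ p with hgdef
  have hg1 : ContDiff ℝ 1 g := (contDiff_norm_rpow (E := ℝ) hp).comp hv1
  have hgc : HasCompactSupport g :=
    hvc.comp_left (g := fun t : ℝ => |t| ^ p) (by simp [hpp.ne'])
  set W : EuclideanSpace ℝ (Fin N) → ℝ := fun x => ‖x‖ ^ γ * ‖fderiv ℝ u x‖ with hW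
  have hcd : Continuous (fderiv ℝ u) := hu.continuous_fderiv (by simp)
  have h0d : (0 : EuclideanSpace ℝ (Fin N)) ∉ tsupport (fderiv ℝ u) :=
    fun h => h0 (tsupport_fderiv_subset ℝ h)
  have hWcont : Continuous W := ws_cont γ hcd.norm (fun h => h0d (by rwa [ws_tsupport_norm] at h))
  have hWc : HasCompactSupport W := (hc.fderiv ℝ).norm.mul_left
  have hWnn : ∀ x, 0 ≤ W x := fun x => by positivity
  -- the radial derivative of g
  have hrad : ∀ x, |fderiv ℝ g x x - p * (γ - 1) * g x| ≤ p * (W x * |v x| ^ (p - 1)) := by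
    intro x
    have e1 : HasFDerivAt g ((p * |v x| ^ (p - 2) * v x) • (‖x‖ ^ (γ - 1) • fderiv ℝ u x +
        ((γ - 1) * ‖x‖ ^ (γ - 1 - 2) * u x) • innerSL ℝ x)) x :=
      (hasDerivAt_abs_rpow (v x) hp).comp_hasFDerivAt x (ws_hasFDerivAt (γ - 1) hu h0 x)
    rw [e1.fderiv]
    by_cases hvx : v x = 0
    · simp [hvx, hgdef, hpp.ne']
      positivity
    have hx : x ≠ 0 := by
      rintro rfl
      apply hvx
      simp [hv, image_eq_zero_of_notMem_tsupport h0]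
    have hn : 0 < ‖x‖ := norm_pos_iff.mpr hx
    have e2 : ‖x‖ ^ (γ - 1 - 2) * ‖x‖ ^ 2 = ‖x‖ ^ (γ - 1) := by
      rw [← Real.rpow_add_natCast hn.ne']; congr 1; push_cast; ring
    have e3 : |v x| ^ (p - 2) * v x * v x = g x := by
      have : v x * v x = |v x| ^ 2 := by rw [sq_abs]; ring
      rw [mul_assoc, this, ← Real.rpow_add_natCast (abs_ne_zero.mpr hvx)]
      simp only [hgdef]; congr 1; push_cast; ring
    have e4 : |v x| ^ (p - 2) * |v x| = |v x| ^ (p - 1) := by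
      rw [← Real.rpow_add_one (abs_ne_zero.mpr hvx)]; congr 1; ring
    have e5 : ‖x‖ ^ (γ - 1) * ‖x‖ = ‖x‖ ^ γ := by
      rw [← Real.rpow_add_one hn.ne']; congr 1; ring
    have e6 : ((p * |v x| ^ (p - 2) * v x) • (‖x‖ ^ (γ - 1) • fderiv ℝ u x +
        ((γ - 1) * ‖x‖ ^ (γ - 1 - 2) * u x) • innerSL ℝ x)) x - p * (γ - 1) * g x
        = p * |v x| ^ (p - 2) * v x * ‖x‖ ^ (γ - 1) * fderiv ℝ u x x := by
      simp only [smul_apply, add_apply, smul_eq_mul,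
        innerSL_apply_apply, real_inner_self_eq_norm_sq]
      rw [← e3]
      have e7 : (γ - 1) * ‖x‖ ^ (γ - 1 - 2) * u x * ‖x‖ ^ 2 = (γ - 1) * v x := by
        simp only [hv]; rw [← e2]; ring
      rw [e7]; ring
    rw [e6]
    simp only [abs_mul]
    rw [abs_of_pos hpp, abs_of_nonneg (a := |v x| ^ (p - 2)) (by positivity),
      abs_of_nonneg (a := ‖x‖ ^ (γ - 1)) (by positivity)]
    have h8 : |fderiv ℝ u x x| ≤ ‖fderiv ℝ u x‖ * ‖x‖ := (fderiv ℝ u x).le_opNorm x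
    calc p * |v x| ^ (p - 2) * |v x| * ‖x‖ ^ (γ - 1) * |fderiv ℝ u x x|
        ≤ p * |v x| ^ (p - 2) * |v x| * ‖x‖ ^ (γ - 1) * (‖fderiv ℝ u x‖ * ‖x‖) := by gcongr
      _ = p * ((‖x‖ ^ (γ - 1) * ‖x‖) * ‖fderiv ℝ u x‖ * (|v x| ^ (p - 2) * |v x|)) := by ring
      _ = _ := by rw [e4, e5]
  have hgi : Integrable g := hg1.continuous.integrable_of_hasCompactSupport hgc
  have hdg : Continuous (fderiv ℝ g) := hg1.continuous_fderiv (by simp)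
  have hdgi : Integrable (fun x => fderiv ℝ g x x) := by
    refine Continuous.integrable_of_hasCompactSupport (by fun_prop) ?_
    refine (hgc.fderiv ℝ).mono ?_
    intro x hx hx'
    exact hx (by simp [hx'])
  have hvp : Continuous fun x => |v x| ^ (p - 1) :=
    hv1.continuous.abs.rpow_const (fun x => Or.inr (by linarith))
  have hvpc : HasCompactSupport fun x => |v x| ^ (p - 1) :=
    hvc.comp_left (g := fun t : ℝ => |t| ^ (p - 1)) (by
      simp [Real.zero_rpow (show p - 1 ≠ 0 by linarith)])
  have hEul := ws_euler N hg1 hgc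
  have hI0 : 0 ≤ ∫ x, g x := integral_nonneg fun x => by positivity
  have hJ0 : 0 ≤ ∫ x, W x ^ p := integral_nonneg fun x => Real.rpow_nonneg (hWnn x) _
  have step1 : |(N : ℝ) + p * (γ - 1)| * ∫ x, g x ≤ p * ∫ x, W x * |v x| ^ (p - 1) := by
    have : ∫ x, (fderiv ℝ g x x - p * (γ - 1) * g x) = -((N : ℝ) + p * (γ - 1)) * ∫ x, g x := by
      rw [integral_sub hdgi (hgi.const_mul _), hEul, integral_const_mul]; ring
    calc |(N : ℝ) + p * (γ - 1)| * ∫ x, g x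
        = |∫ x, (fderiv ℝ g x x - p * (γ - 1) * g x)| := by
          rw [this, abs_mul, abs_neg, abs_of_nonneg hI0]
      _ ≤ ∫ x, |fderiv ℝ g x x - p * (γ - 1) * g x| := abs_integral_le_integral_abs
      _ ≤ ∫ x, p * (W x * |v x| ^ (p - 1)) := by
          refine integral_mono (hdgi.sub (hgi.const_mul _)).abs ?_ hrad
          exact ((hWcont.mul hvp).integrable_of_hasCompactSupport hWc.mul_right).const_mul _
      _ = _ := integral_const_mul _ _
  have hconj : p.HolderConjugate (p / (p - 1)) := Real.HolderConjugate.conjExponent hp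
  have step2 := integral_mul_le_Lp_mul_Lq_of_nonneg
    (μ := (volume : Measure (EuclideanSpace ℝ (Fin N)))) hconj
    (f := W) (g := fun x => |v x| ^ (p - 1))
    (Filter.Eventually.of_forall hWnn) (Filter.Eventually.of_forall fun x => by
      simp only [Pi.zero_apply]; positivity)
    (hWcont.memLp_of_hasCompactSupport hWc) (hvp.memLp_of_hasCompactSupport hvpc)
  have hp1 : p - 1 ≠ 0 := by linarith
  have e1 : ∀ x, (|v x| ^ (p - 1)) ^ (p / (p - 1)) = g x := by
    intro x
    rw [← Real.rpow_mul (abs_nonneg _), mul_div_cancel₀ _ hp1]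
  simp only [e1] at step2
  have e2 : 1 / (p / (p - 1)) = 1 - 1 / p := by field_simp
  rw [e2] at step2
  have hK : 0 < |(N : ℝ) + p * (γ - 1)| := abs_pos.mpr hne
  change (∫ x, g x) ^ (1 / p) ≤ _
  rcases hI0.eq_or_lt with hz | hpos
  · rw [← hz, Real.zero_rpow (by positivity)]
    positivity
  · have hsplit : ∫ x, g x = (∫ x, g x) ^ (1 / p) * (∫ x, g x) ^ (1 - 1 / p) := by
      rw [← Real.rpow_add hpos]; simp
    have hpp2 : 0 < (∫ x, g x) ^ (1 - 1 / p) := Real.rpow_pos_of_pos hpos _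
    rw [div_mul_eq_mul_div, le_div_iff₀ hK]
    refine le_of_mul_le_mul_right ?_ hpp2
    calc (∫ x, g x) ^ (1 / p) * |(N : ℝ) + p * (γ - 1)| * (∫ x, g x) ^ (1 - 1 / p)
        = |(N : ℝ) + p * (γ - 1)| * ((∫ x, g x) ^ (1 / p) * (∫ x, g x) ^ (1 - 1 / p)) := by ring
      _ = |(N : ℝ) + p * (γ - 1)| * ∫ x, g x := by rw [← hsplit]
      _ ≤ p * ((∫ x, W x ^ p) ^ (1 / p) * (∫ x, g x) ^ (1 - 1 / p)) :=
          step1.trans (mul_le_mul_of_nonneg_left step2 hpp.le)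
      _ = _ := by ring

lemma ws_interp {α : Type*} [MeasurableSpace α] {μ : Measure α} {p q r θ : ℝ} (hp : 0 < p)
    (hq : 0 < q) (hr : 0 < r) (h0 : 0 ≤ θ) (h1 : θ ≤ 1) (hs : 1 / q = (1 - θ) / p + θ / r)
    {f g h : α → ℝ} (hf : AEMeasurable f μ) (hg : AEMeasurable g μ)
    (hh : ∀ x, |h x| = |f x| ^ (1 - θ) * |g x| ^ θ) :
    eLpNorm h (ENNReal.ofReal q) μ ≤
      eLpNorm f (ENNReal.ofReal p) μ ^ (1 - θ) * eLpNorm g (ENNReal.ofReal r) μ ^ θ := by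
  have h1' : 0 ≤ 1 - θ := by linarith
  rw [eLpNorm_eq_lintegral_rpow_enorm_toReal (by simpa using hq) (by simp),
    eLpNorm_eq_lintegral_rpow_enorm_toReal (by simpa using hp) (by simp),
    eLpNorm_eq_lintegral_rpow_enorm_toReal (by simpa using hr) (by simp),
    ENNReal.toReal_ofReal hp.le, ENNReal.toReal_ofReal hq.le, ENNReal.toReal_ofReal hr.le]
  have hpt : ∀ x, ‖h x‖ₑ ^ q =
      (‖f x‖ₑ ^ p) ^ (q * (1 - θ) / p) * (‖g x‖ₑ ^ r) ^ (q * θ / r) := by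
    intro x
    have : ‖h x‖ₑ = ‖f x‖ₑ ^ (1 - θ) * ‖g x‖ₑ ^ θ := by
      simp only [Real.enorm_eq_ofReal_abs]
      rw [hh, ENNReal.ofReal_mul (by positivity), ENNReal.ofReal_rpow_of_nonneg (abs_nonneg _) h1',
        ENNReal.ofReal_rpow_of_nonneg (abs_nonneg _) h0]
    rw [this, ENNReal.mul_rpow_of_nonneg _ _ hq.le, ← ENNReal.rpow_mul, ← ENNReal.rpow_mul,
      ← ENNReal.rpow_mul, ← ENNReal.rpow_mul]
    congr 2 <;> field_simp
  simp_rw [hpt]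
  have hsum : q * (1 - θ) / p + q * θ / r = 1 := by
    have : q * (1 - θ) / p + q * θ / r = q * ((1 - θ) / p + θ / r) := by ring
    rw [this, ← hs]; field_simp
  have := ENNReal.lintegral_mul_norm_pow_le (μ := μ) (hf.enorm.pow_const p) (hg.enorm.pow_const r)
    (p := q * (1 - θ) / p) (q := q * θ / r) (by positivity) (by positivity) hsum
  refine (ENNReal.rpow_le_rpow this (by positivity : 0 ≤ 1 / q)).trans ?_
  rw [ENNReal.mul_rpow_of_nonneg _ _ (by positivity), ← ENNReal.rpow_mul, ← ENNReal.rpow_mul,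
    ← ENNReal.rpow_mul, ← ENNReal.rpow_mul]
  apply le_of_eq
  congr 2 <;> field_simp

lemma ws_eLpNorm {N : ℕ} {f : EuclideanSpace ℝ (Fin N) → ℝ} (hf : Continuous f)
    (hc : HasCompactSupport f) {r : ℝ} (hr : 0 < r) :
    eLpNorm f (ENNReal.ofReal r) volume = ENNReal.ofReal ((∫ x, |f x| ^ r) ^ (1 / r)) := by
  rw [(hf.memLp_of_hasCompactSupport hc).eLpNorm_eq_integral_rpow_norm (by simpa using hr)
    (by simp), ENNReal.toReal_ofReal hr.le, one_div]
  simp only [Real.norm_eq_abs]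

/-- Homogeneous weighted Sobolev inequality: under the compatibility conditions
`γ-1 ≤ β ≤ γ`, `1/p - 1/q = (1-γ+β)/N`, `N + p(γ-1) ≠ 0`, `p < N`, `q ≤ p*`,
there is `C > 0` such that every `u ∈ C_c^∞(ℝ^N \ {0})` satisfies
`‖ |x|^β u ‖_q ≤ C ‖ |x|^γ ∇u ‖_p`. -/
theorem weighted_sobolev_homogeneous (N : ℕ) (hN : 2 ≤ N) (β γ : ℝ) (p q : ℝ)
    (hp : 1 < p) (hpq : p ≤ q) (hβγ₁ : γ - 1 ≤ β) (hβγ₂ : β ≤ γ)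
    (hscal : 1 / p - 1 / q = (1 - γ + β) / (N : ℝ))
    (hne : (N : ℝ) + p * (γ - 1) ≠ 0) (hpN : p < N)
    (hq : q ≤ (N : ℝ) * p / ((N : ℝ) - p)) :
    ∃ C : ℝ, 0 < C ∧ ∀ u : EuclideanSpace ℝ (Fin N) → ℝ,
      ContDiff ℝ (⊤ : ℕ∞) u → HasCompactSupport u → (0 : EuclideanSpace ℝ (Fin N)) ∉ tsupport u →
      (∫ x : EuclideanSpace ℝ (Fin N), ‖x‖ ^ (q * β) * |u x| ^ q) ^ (1 / q) ≤
        C * (∫ x : EuclideanSpace ℝ (Fin N), ‖x‖ ^ (p * γ) * ‖fderiv ℝ u x‖ ^ p) ^ (1 / p) := by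
  have hpp : 0 < p := by linarith
  have hqq : 0 < q := by linarith
  have hN0 : (0 : ℝ) < N := by linarith
  have hNp : (0 : ℝ) < (N : ℝ) - p := by linarith
  set r : ℝ := (N : ℝ) * p / ((N : ℝ) - p) with hr
  have hr0 : 0 < r := by positivity
  have hrinv : r⁻¹ = p⁻¹ - (N : ℝ)⁻¹ := by
    rw [hr]; field_simp
  set θ : ℝ := 1 - γ + β with hθ
  have hθ0 : 0 ≤ θ := by linarith
  have hθ1 : θ ≤ 1 := by linarith
  have hs : 1 / q = (1 - θ) / p + θ / r := by
    rw [div_eq_mul_inv θ r, hrinv]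
    have : 1 / q = 1 / p - θ / N := by linarith
    rw [this]; field_simp; ring
  set K : NNReal := SNormLESNormFDerivOfEqConst ℝ
    (volume : Measure (EuclideanSpace ℝ (Fin N))) p.toNNReal with hK
  set C1 : ℝ := p / |(N : ℝ) + p * (γ - 1)| with hC1
  have hC10 : 0 ≤ C1 := by positivity
  set C2 : ℝ := K * (1 + |γ| * C1) with hC2
  have hC20 : 0 ≤ C2 := by positivity
  refine ⟨C1 + C2 + 1, by positivity, ?_⟩
  intro u hu' hc h0
  have hu : ContDiff ℝ 1 u := hu'.of_le (by exact_mod_cast le_top)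
  have hcd : Continuous (fderiv ℝ u) := hu.continuous_fderiv (by simp)
  have h0d : (0 : EuclideanSpace ℝ (Fin N)) ∉ tsupport (fderiv ℝ u) :=
    fun h => h0 (tsupport_fderiv_subset ℝ h)
  have hWcont : Continuous fun x : EuclideanSpace ℝ (Fin N) => ‖x‖ ^ γ * ‖fderiv ℝ u x‖ :=
    ws_cont γ hcd.norm (fun h => h0d (by rwa [ws_tsupport_norm] at h))
  have hWc : HasCompactSupport fun x : EuclideanSpace ℝ (Fin N) => ‖x‖ ^ γ * ‖fderiv ℝ u x‖ :=
    (hc.fderiv ℝ).norm.mul_left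
  have hvcont : ∀ a : ℝ, Continuous fun x : EuclideanSpace ℝ (Fin N) => ‖x‖ ^ a * u x :=
    fun a => ws_cont a hu.continuous h0
  have hvc : ∀ a : ℝ, HasCompactSupport fun x : EuclideanSpace ℝ (Fin N) => ‖x‖ ^ a * u x :=
    fun a => hc.mul_left
  set G : ENNReal := eLpNorm (fun x : EuclideanSpace ℝ (Fin N) => ‖x‖ ^ γ * ‖fderiv ℝ u x‖)
    (ENNReal.ofReal p) volume with hG
  have hGe : G = ENNReal.ofReal ((∫ x : EuclideanSpace ℝ (Fin N),
      (‖x‖ ^ γ * ‖fderiv ℝ u x‖) ^ p) ^ (1 / p)) := by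
    rw [hG, ws_eLpNorm hWcont hWc hpp]
    congr! 5 with x
    exact abs_of_nonneg (by positivity)
  have hA : eLpNorm (fun x : EuclideanSpace ℝ (Fin N) => ‖x‖ ^ (γ - 1) * u x)
      (ENNReal.ofReal p) volume ≤ ENNReal.ofReal C1 * G := by
    rw [hGe, ws_eLpNorm (hvcont _) (hvc _) hpp, ← ENNReal.ofReal_mul hC10]
    exact ENNReal.ofReal_le_ofReal (ws_hardy N γ p hp hne hu hc h0)
  have hS : eLpNorm (fun x : EuclideanSpace ℝ (Fin N) => ‖x‖ ^ γ * u x)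
      (ENNReal.ofReal r) volume ≤ ENNReal.ofReal C2 * G := by
    have h1 := eLpNorm_le_eLpNorm_fderiv_of_eq (F := ℝ)
      (volume : Measure (EuclideanSpace ℝ (Fin N))) (ws_contDiff γ hu h0) (hvc γ)
      (p := p.toNNReal) (p' := r.toNNReal) (by simpa using hp.le)
      (by rw [finrank_euclideanSpace_fin]; omega)
      (by rw [finrank_euclideanSpace_fin, Real.coe_toNNReal _ hr0.le, NNReal.coe_inv,
            Real.coe_toNNReal _ hpp.le, hrinv])
    change eLpNorm _ (ENNReal.ofReal r) _ ≤ K * eLpNorm _ (ENNReal.ofReal p) _ at h1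
    refine h1.trans ?_
    have h2 : eLpNorm (fderiv ℝ fun x : EuclideanSpace ℝ (Fin N) => ‖x‖ ^ γ * u x)
        (ENNReal.ofReal p) volume ≤ eLpNorm ((fun x : EuclideanSpace ℝ (Fin N) =>
          ‖x‖ ^ γ * ‖fderiv ℝ u x‖) + |γ| • fun x => ‖‖x‖ ^ (γ - 1) * u x‖)
          (ENNReal.ofReal p) volume := by
      refine eLpNorm_mono_real fun x => ?_
      refine (ws_fderiv_norm_le γ hu h0 x).trans (le_of_eq ?_)
      simp only [Pi.add_apply, Pi.smul_apply, smul_eq_mul, norm_mul, Real.norm_eq_abs]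
      rw [abs_of_nonneg (a := ‖x‖ ^ (γ - 1)) (by positivity)]
    have h3 : eLpNorm (fderiv ℝ fun x : EuclideanSpace ℝ (Fin N) => ‖x‖ ^ γ * u x)
        (ENNReal.ofReal p) volume ≤ G + ENNReal.ofReal |γ| * (ENNReal.ofReal C1 * G) := by
      refine h2.trans ((eLpNorm_add_le hWcont.aestronglyMeasurable
        ((hvcont (γ - 1)).norm.aestronglyMeasurable.const_smul _)
        (by rw [ENNReal.one_le_ofReal]; exact hp.le)).trans ?_)
      refine add_le_add le_rfl ?_
      rw [eLpNorm_const_smul, eLpNorm_norm, Real.enorm_eq_ofReal_abs, abs_abs]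
      gcongr
    calc (K : ENNReal) * _ ≤ K * (G + ENNReal.ofReal |γ| * (ENNReal.ofReal C1 * G)) := by gcongr
      _ = ENNReal.ofReal C2 * G := by
        rw [hC2, ENNReal.ofReal_mul (by positivity), ENNReal.ofReal_add (by positivity)
          (by positivity), ENNReal.ofReal_mul (by positivity), ENNReal.ofReal_coe_nnreal,
          ENNReal.ofReal_one]
        ring
  have hI := ws_interp (μ := (volume : Measure (EuclideanSpace ℝ (Fin N)))) hpp hqq hr0 hθ0 hθ1 hs
    (f := fun x => ‖x‖ ^ (γ - 1) * u x) (g := fun x => ‖x‖ ^ γ * u x)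
    (h := fun x => ‖x‖ ^ β * u x) (hvcont _).aemeasurable (hvcont _).aemeasurable (by
      intro x
      have hsum : ∀ t : ℝ, 0 ≤ t → t ^ (1 - θ) * t ^ θ = t := by
        intro t ht
        rw [← Real.rpow_add_of_nonneg ht (by linarith) hθ0]; simp
      by_cases hx : x = 0
      · subst hx
        simp only [image_eq_zero_of_notMem_tsupport h0, mul_zero, abs_zero]
        exact (hsum 0 le_rfl).symm
      · have hn : 0 < ‖x‖ := norm_pos_iff.mpr hx
        simp only [abs_mul, abs_of_nonneg (Real.rpow_nonneg (norm_nonneg x) _)]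
        rw [Real.mul_rpow (by positivity) (by positivity),
          Real.mul_rpow (by positivity) (by positivity)]
        have e1 : (‖x‖ ^ (γ - 1)) ^ (1 - θ) * (‖x‖ ^ γ) ^ θ = ‖x‖ ^ β := by
          rw [← Real.rpow_mul hn.le, ← Real.rpow_mul hn.le, ← Real.rpow_add hn]
          congr 1; rw [hθ]; ring
        calc ‖x‖ ^ β * |u x| = ((‖x‖ ^ (γ - 1)) ^ (1 - θ) * (‖x‖ ^ γ) ^ θ) *
              (|u x| ^ (1 - θ) * |u x| ^ θ) := by rw [e1, hsum _ (abs_nonneg _)]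
          _ = _ := by ring)
  have hle : eLpNorm (fun x : EuclideanSpace ℝ (Fin N) => ‖x‖ ^ β * u x) (ENNReal.ofReal q) volume
      ≤ ENNReal.ofReal (C1 + C2 + 1) * G := by
    refine hI.trans ?_
    have hA' := hA.trans (mul_le_mul_left (ENNReal.ofReal_le_ofReal
      (by linarith : C1 ≤ C1 + C2 + 1)) G)
    have hS' := hS.trans (mul_le_mul_left (ENNReal.ofReal_le_ofReal
      (by linarith : C2 ≤ C1 + C2 + 1)) G)
    refine (mul_le_mul' (ENNReal.rpow_le_rpow hA' (by linarith))
      (ENNReal.rpow_le_rpow hS' hθ0)).trans (le_of_eq ?_)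
    rw [← ENNReal.rpow_add_of_nonneg _ _ (by linarith) hθ0]
    simp
  rw [ws_eLpNorm (hvcont _) (hvc _) hqq, hGe, ← ENNReal.ofReal_mul (by positivity)] at hle
  have hfin := (ENNReal.ofReal_le_ofReal_iff (mul_nonneg (by positivity)
    (Real.rpow_nonneg (integral_nonneg fun x => by positivity) _))).mp hle
  have el : ∀ x : EuclideanSpace ℝ (Fin N), ‖x‖ ^ (q * β) * |u x| ^ q = |‖x‖ ^ β * u x| ^ q := by
    intro x
    rw [abs_mul, abs_of_nonneg (Real.rpow_nonneg (norm_nonneg x) _),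
      Real.mul_rpow (by positivity) (by positivity), ← Real.rpow_mul (norm_nonneg x), mul_comm β q]
  have er : ∀ x : EuclideanSpace ℝ (Fin N), ‖x‖ ^ (p * γ) * ‖fderiv ℝ u x‖ ^ p =
      (‖x‖ ^ γ * ‖fderiv ℝ u x‖) ^ p := by
    intro x
    rw [Real.mul_rpow (by positivity) (by positivity), ← Real.rpow_mul (norm_nonneg x),
      mul_comm γ p]
  simp only [el, er]
  exact hfin
end
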